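/- arXiv:1811.08402 — 2 statements merged into one kernel-verified Lean document; each statement's English description precedes it below -/
import Mathlib

section
/- Let R be a Gorenstein local ring of dimension d, and let I be an R-ideal of height g ≥ 1 and analytic spread ℓ. Assume I satisfies G_{ℓ+1} and Ext_R^{g+j−1}(I^j, R) = 0 for 1 ≤ j ≤ min{ℓ − g, d − g − 1}. Then I is of linear type. -/
open scoped TensorProduct

noncomputable section

universe u

section Defs
variable (R : Type u) [CommRing R]

/-- The total ring of fractions of `R`. -/
abbrev TotalQuot := Localization (nonZeroDivisors R)

/-- `E` has rank `e`: `E ⊗_R Quot(R)` is free of rank `e` over the total quotient ring. -/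
def HasRank (E : Type u) [AddCommGroup E] [Module R E] (e : ℕ) : Prop :=
  Nonempty ((TotalQuot R ⊗[R] E) ≃ₗ[TotalQuot R] (Fin e → TotalQuot R))

/-- Complement of a prime ideal, with the primality hypothesis explicit. -/
def primeCompl' (p : Ideal R) (hp : p.IsPrime) : Submonoid R :=
  @Ideal.primeCompl R _ p hp

/-- Minimal number of generators of a module. -/
def minGens (E : Type u) [AddCommGroup E] [Module R E] : ℕ :=
  sInf {n | ∃ f : Fin n → E, Submodule.span R (Set.range f) = ⊤}

/-- The grade of an ideal `I` on a module `M`: supremum of lengths of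
`M`-regular sequences contained in `I`. -/
def sequenceGrade (I : Ideal R) (M : Type u) [AddCommGroup M] [Module R M] : ℕ∞ :=
  sSup {n : ℕ∞ | ∃ rs : List R, (rs.length : ℕ∞) = n ∧ (∀ r ∈ rs, r ∈ I) ∧
    RingTheory.Sequence.IsRegular M rs}

/-- Depth of a module over a local ring. -/
def moduleDepth [IsLocalRing R] (M : Type u) [AddCommGroup M] [Module R M] : ℕ∞ :=
  sequenceGrade R (IsLocalRing.maximalIdeal R) M

/-- The grade of a module: grade of its annihilator on `R`. -/
def moduleGrade (M : Type u) [AddCommGroup M] [Module R M] : ℕ∞ :=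
  sequenceGrade R (Module.annihilator R M) R

/-- Dimension of a module: Krull dimension of `R` modulo the annihilator. -/
def moduleDim (M : Type u) [AddCommGroup M] [Module R M] : WithBot ℕ∞ :=
  ringKrullDim (R ⧸ Module.annihilator R M)

/-- Krull dimension of the localization `R_p`. -/
def localDimAt (p : Ideal R) (hp : p.IsPrime) : WithBot ℕ∞ :=
  ringKrullDim (Localization (primeCompl' R p hp))

/-- Height of an ideal: infimum of `dim R_p` over primes `p ⊇ I`. -/
def idealHeight (I : Ideal R) : WithBot ℕ∞ :=
  sInf {d | ∃ (p : Ideal R) (hp : p.IsPrime), I ≤ p ∧ d = localDimAt R p hp}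

/-- A local ring is Cohen-Macaulay if its depth equals its dimension. -/
def IsCMLocalRing [IsLocalRing R] : Prop :=
  (moduleDepth R R : WithBot ℕ∞) = ringKrullDim R

/-- A ring is Cohen-Macaulay if all its localizations at maximal ideals are. -/
def IsCMRing : Prop :=
  ∀ (p : Ideal R), ∀ hp : p.IsMaximal,
    letI : p.IsPrime := hp.isPrime
    (moduleDepth (Localization.AtPrime p) (Localization.AtPrime p) : WithBot ℕ∞)
      = ringKrullDim (Localization.AtPrime p)

/-- A finite module over a local ring is Cohen-Macaulay if it is zero or
its depth equals its dimension. -/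
def IsCMModule [IsLocalRing R] (M : Type u) [AddCommGroup M] [Module R M] : Prop :=
  Subsingleton M ∨ (moduleDepth R M : WithBot ℕ∞) = moduleDim R M

open CategoryTheory in
/-- Vanishing of `Ext_R^n(M, N)`. -/
def extVanish (M N : Type u) [AddCommGroup M] [Module R M] [AddCommGroup N] [Module R N]
    (n : ℕ) : Prop :=
  Subsingleton (((Ext R (ModuleCat.{u} R) n).obj (Opposite.op (ModuleCat.of R M))).obj
    (ModuleCat.of R N))

/-- A Noetherian local ring is Gorenstein iff it is Cohen-Macaulay and `R` has finite
injective dimension, i.e. `Ext^i(k, R) = 0` for all large `i`. -/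
def IsGorensteinLocalRing [IsLocalRing R] : Prop :=
  IsCMLocalRing R ∧ ∃ n : ℕ, ∀ i : ℕ, n < i → extVanish R (IsLocalRing.ResidueField R) R i

variable (E : Type u) [AddCommGroup E] [Module R E]

/-- Defining relations of the symmetric algebra, presented as the free commutative
`R`-algebra on `E` modulo linearity relations. -/
def symRels : Set (MvPolynomial E R) :=
  {p | ∃ x y : E, p = MvPolynomial.X (x + y) - MvPolynomial.X x - MvPolynomial.X y} ∪
  {p | ∃ (r : R) (x : E), p = MvPolynomial.X (r • x) - MvPolynomial.C r * MvPolynomial.X x}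

/-- The symmetric algebra of a module. -/
abbrev SymModAlg := MvPolynomial E R ⧸ Ideal.span (symRels R E)

/-- The `R`-torsion ideal of an `R`-algebra `A`. -/
def torsionIdeal (A : Type u) [CommRing A] [Algebra R A] : Ideal A where
  carrier := {a | ∃ r ∈ nonZeroDivisors R, r • a = 0}
  zero_mem' := ⟨1, one_mem _, smul_zero _⟩
  add_mem' := by
    rintro a b ⟨r, hr, ha⟩ ⟨s, hs, hb⟩
    refine ⟨r * s, mul_mem hr hs, ?_⟩
    have h1 : (r * s) • a = 0 := by rw [mul_comm, mul_smul, ha, smul_zero]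
    have h2 : (r * s) • b = 0 := by rw [mul_smul, hb, smul_zero]
    rw [smul_add, h1, h2, add_zero]
  smul_mem' := by
    rintro c a ⟨r, hr, ha⟩
    exact ⟨r, hr, by rw [smul_comm, ha, smul_zero]⟩

/-- The Rees algebra of a module: the symmetric algebra modulo `R`-torsion. -/
abbrev ReesModAlg := SymModAlg R E ⧸ torsionIdeal R (SymModAlg R E)

/-- The canonical map `E → R(E)`. -/
def reesι (x : E) : ReesModAlg R E :=
  Ideal.Quotient.mk _ (Ideal.Quotient.mk _ (MvPolynomial.X x))

/-- The `j`-th power `E^j` of a module: the `j`-th graded component of its Rees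
algebra, i.e. the `R`-span of products of `j` elements of `E`. -/
def reesPower (j : ℕ) : Submodule R (ReesModAlg R E) :=
  Submodule.span R {a | ∃ f : Fin j → E, a = ∏ i, reesι R E (f i)}

/-- A module is of linear type if its symmetric algebra is `R`-torsion-free,
i.e. the natural surjection `S(E) → R(E)` is an isomorphism. -/
def IsLinearType : Prop := torsionIdeal R (SymModAlg R E) = ⊥

/-- The extension of the maximal ideal to the Rees algebra. -/
def fiberIdeal [IsLocalRing R] : Ideal (ReesModAlg R E) :=
  Ideal.map (algebraMap R (ReesModAlg R E)) (IsLocalRing.maximalIdeal R)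

/-- The analytic spread: Krull dimension of the special fiber ring `R(E) ⊗ k`. -/
def analyticSpread [IsLocalRing R] : WithBot ℕ∞ :=
  ringKrullDim (ReesModAlg R E ⧸ fiberIdeal R E)

/-- The submodule `U·E^r` of the Rees algebra. -/
def mulPower (U : Submodule R E) (r : ℕ) : Submodule R (ReesModAlg R E) :=
  Submodule.span R {a | ∃ u ∈ U, ∃ f : Fin r → E, a = reesι R E u * ∏ i, reesι R E (f i)}

/-- `U` is a reduction of `E` if `E^{r+1} = U·E^r` for some `r`. -/
def IsReduction (U : Submodule R E) : Prop :=
  ∃ r : ℕ, reesPower R E (r + 1) = mulPower R E U r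

/-- A minimal reduction. -/
def IsMinimalReduction (U : Submodule R E) : Prop :=
  IsReduction R E U ∧ ∀ U' : Submodule R E, U' ≤ U → IsReduction R E U' → U' = U

/-- The reduction number of a reduction `U`. -/
def reductionNumberOf (U : Submodule R E) : ℕ :=
  sInf {r | reesPower R E (r + 1) = mulPower R E U r}

/-- The reduction number of `E`. -/
def reductionNumber : ℕ :=
  sInf {r | ∃ U : Submodule R E, IsMinimalReduction R E U ∧ reductionNumberOf R E U = r}

/-- The condition `G_s` for a module of rank `e`:
`μ(E_p) ≤ dim R_p + e - 1` for all primes with `1 ≤ dim R_p ≤ s - 1`. -/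
def Gcond (e s : ℕ) : Prop :=
  ∀ (p : Ideal R) (hp : p.IsPrime),
    (1 : WithBot ℕ∞) ≤ localDimAt R p hp → localDimAt R p hp + 1 ≤ (s : WithBot ℕ∞) →
    (minGens (Localization (primeCompl' R p hp)) (LocalizedModule (primeCompl' R p hp) E)
        : WithBot ℕ∞) ≤ localDimAt R p hp + ((e - 1 : ℕ) : WithBot ℕ∞)

/-- The condition `G_∞` for a module of rank `e`. -/
def GcondInf (e : ℕ) : Prop := ∀ s : ℕ, Gcond R E e s

/-- The condition `G_s` for an ideal: `μ(I_p) ≤ dim R_p` for all primes `p ⊇ I`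
with `dim R_p ≤ s - 1`. -/
def GcondIdeal (I : Ideal R) (s : ℕ) : Prop :=
  ∀ (p : Ideal R) (hp : p.IsPrime), I ≤ p → localDimAt R p hp + 1 ≤ (s : WithBot ℕ∞) →
    (minGens (Localization (primeCompl' R p hp)) (LocalizedModule (primeCompl' R p hp) ↥I)
        : WithBot ℕ∞) ≤ localDimAt R p hp

/-- The `0`-th Fitting ideal of a module. -/
def fitting0 (M : Type u) [AddCommGroup M] [Module R M] : Ideal R :=
  ⨆ (n : ℕ) (π : (Fin n → R) →ₗ[R] M) (_ : Function.Surjective π),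
    Ideal.span {d | ∃ A : Matrix (Fin n) (Fin n) R,
      (∀ jc : Fin n, π (fun i => A i jc) = 0) ∧ d = A.det}

end Defs

set_option linter.unusedSectionVars false
namespace LT

open RingTheory.Sequence CategoryTheory Abelian IsLocalRing
open scoped Pointwise

section A
variable {R : Type u} [CommRing R]

/-- all primes over `I` have height at least `k` -/
def HtGe (I : Ideal R) (k : ℕ) : Prop := ∀ p : Ideal R, p.IsPrime → I ≤ p → (k : ℕ∞) ≤ p.height

lemma HtGe.mono {I J : Ideal R} {k : ℕ} (h : HtGe I k) (hIJ : I ≤ J) : HtGe J k :=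
  fun p hp hJ => h p hp (hIJ.trans hJ)

lemma HtGe.of_le {I : Ideal R} {k l : ℕ} (h : HtGe I k) (hl : l ≤ k) : HtGe I l :=
  fun p hp hJ => le_trans (by exact_mod_cast hl) (h p hp hJ)

/-- local Cohen-Macaulay ring of dimension `d` -/
def IsCM (R : Type u) [CommRing R] [IsLocalRing R] (d : ℕ) : Prop :=
  ringKrullDim R = (d : WithBot ℕ∞) ∧ ∃ rs : List R, rs.length = d ∧
    (∀ r ∈ rs, r ∈ maximalIdeal R) ∧ IsRegular R rs

variable [IsLocalRing R] [IsNoetherianRing R]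

lemma IsCM.height_max {d : ℕ} (h : IsCM R d) : (maximalIdeal R).height = d := by
  have := IsLocalRing.maximalIdeal_height_eq_ringKrullDim (R := R)
  rw [h.1] at this
  exact_mod_cast this

lemma IsCM.height_le {d : ℕ} (h : IsCM R d) (p : Ideal R) (hp : p.IsPrime) : p.height ≤ d := by
  rw [← h.height_max]
  exact Ideal.height_mono (IsLocalRing.le_maximalIdeal hp.ne_top)

lemma reg0 {M : Type*} [AddCommGroup M] [Module R M] {x : R} (h : IsSMulRegular M x) {z : M}
    (hz : x • z = 0) : z = 0 := h (by simpa using hz)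

lemma ass_step {M : Type u} [AddCommGroup M] [Module R M] [Module.Finite R M]
    {x : R} (hx : x ∈ maximalIdeal R) (hreg : IsSMulRegular M x) {p : Ideal R}
    (hp : p ∈ associatedPrimes R M) :
    ∃ q ∈ associatedPrimes R (QuotSMulTop x M), p < q := by
  obtain ⟨hpp, z, hz⟩ := isAssociatedPrime_iff.mp hp
  have hmem : ∀ c, c ∈ p ↔ c • z = 0 := by
    intro c; rw [hz, Submodule.mem_colon_singleton, Submodule.mem_bot]
  have hz0 : z ≠ 0 := by
    rintro rfl
    exact hpp.ne_top ((Ideal.eq_top_iff_one _).2 ((hmem 1).2 (by simp)))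
  let N : Submodule R M := {
    carrier := {y | ∀ c ∈ p, c • y = 0}
    zero_mem' := by simp
    add_mem' := by
      intro a b ha hb c hc
      rw [smul_add, ha c hc, hb c hc, add_zero]
    smul_mem' := by
      intro r a ha c hc
      rw [smul_comm, ha c hc, smul_zero] }
  have hxp : x ∉ p := by
    intro h
    exact hz0 (reg0 hreg  ((hmem x).1 h))
  have hN : ∃ y ∈ N, y ∉ x • (⊤ : Submodule R M) := by
    by_contra! hcon
    have hle : N ≤ Ideal.span {x} • N := by
      intro y hy
      obtain ⟨w, -, rfl⟩ := (Submodule.mem_smul_pointwise_iff_exists _ _ _).1 (hcon y hy)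
      refine Submodule.smul_mem_smul (Ideal.mem_span_singleton_self x) ?_
      intro c hc
      have := hy c hc
      rw [smul_comm] at this
      exact reg0 hreg this
    have := Submodule.eq_bot_of_le_smul_of_le_jacobson_bot (Ideal.span {x}) N
      (IsNoetherian.noetherian N) hle (by
        rw [Ideal.span_singleton_le_iff_mem]
        exact IsLocalRing.maximalIdeal_le_jacobson _ hx)
    exact hz0 ((Submodule.mem_bot R).1 (this ▸ (fun c hc => (hmem c).1 hc : z ∈ N)))
  obtain ⟨y, hyN, hy⟩ := hN
  obtain ⟨q, hq, hle⟩ := exists_le_isAssociatedPrime_of_isNoetherianRing R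
    (Submodule.Quotient.mk y : QuotSMulTop x M) (by
      intro h; exact hy ((Submodule.Quotient.mk_eq_zero _).1 h))
  refine ⟨q, hq, lt_of_le_of_ne ?_ ?_⟩
  · intro c hc
    apply hle
    rw [Submodule.mem_colon_singleton, Submodule.mem_bot, ← Submodule.Quotient.mk_smul, hyN c hc]
    rfl
  · rintro rfl
    apply hxp
    apply hle
    rw [Submodule.mem_colon_singleton, Submodule.mem_bot, ← Submodule.Quotient.mk_smul]
    exact (Submodule.Quotient.mk_eq_zero _).2 (Submodule.smul_mem_pointwise_smul _ _ _ trivial)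

lemma ass_height {M : Type u} [AddCommGroup M] [Module R M] [Module.Finite R M]
    (rs : List R) (hrs : ∀ r ∈ rs, r ∈ maximalIdeal R) (hreg : IsRegular M rs) (p : Ideal R)
    (hp : p ∈ associatedPrimes R M) : p.height + rs.length ≤ (maximalIdeal R).height := by
  induction rs generalizing M p with
  | nil =>
    have := hp.1
    simpa using Ideal.height_mono (IsLocalRing.le_maximalIdeal hp.1.ne_top)
  | cons x rs ih =>
    rw [isRegular_cons_iff] at hreg
    obtain ⟨q, hq, hlt⟩ := ass_step (hrs x (by simp)) hreg.1 hp
    have := ih (fun r hr => hrs r (by simp [hr])) hreg.2 q hq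
    have hp1 := hp.1
    have hq1 := hq.1
    have h2 := Ideal.height_add_one_le_of_lt_of_isPrime hlt
    calc p.height + ((x :: rs).length : ℕ∞) = (p.height + 1) + rs.length := by
          simp [add_comm, add_left_comm]
      _ ≤ q.height + rs.length := by gcongr
      _ ≤ _ := this

lemma smul_max_lt {M : Type u} [AddCommGroup M] [Module R M] [Module.Finite R M] [Nontrivial M] :
    maximalIdeal R • (⊤ : Submodule R M) < ⊤ :=
  (Submodule.top_ne_ideal_smul_of_le_jacobson_annihilator (maximalIdeal_le_jacobson _)).symm.lt_top

lemma depth_quot {M : Type u} [AddCommGroup M] [Module R M] [Module.Finite R M] [Nontrivial M]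
    (rs : List R) (hrs : ∀ r ∈ rs, r ∈ maximalIdeal R) (hreg : IsWeaklyRegular M rs) (n : ℕ)
    (hn : ∃ ts : List R, ts.length = n ∧ (∀ r ∈ ts, r ∈ maximalIdeal R) ∧ IsRegular M ts) :
    ∃ ts : List R, ts.length = n - rs.length ∧ (∀ r ∈ ts, r ∈ maximalIdeal R) ∧
      IsRegular (M ⧸ (Ideal.ofList rs • ⊤ : Submodule R M)) ts := by
  induction rs generalizing M n with
  | nil =>
    obtain ⟨ts, h1, h2, h3⟩ := hn
    refine ⟨ts, by simpa using h1, h2, ?_⟩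
    have e := Submodule.quotEquivOfEqBot (Ideal.ofList ([] : List R) • ⊤ : Submodule R M) (by simp)
    exact (e.isRegular_congr ts).2 h3
  | cons x rs ih =>
    rw [isWeaklyRegular_cons_iff] at hreg
    have hx := hrs x (by simp)
    have : Nontrivial (QuotSMulTop x M) := nontrivial_quotSMulTop_of_mem_maximalIdeal _ hx
    have key : ∃ ts : List R, ts.length = n - 1 ∧ (∀ r ∈ ts, r ∈ maximalIdeal R) ∧
        IsRegular (QuotSMulTop x M) ts := by
      have h1 := ((ModuleCat.exists_isRegular_tfae (maximalIdeal R) n (ModuleCat.of R M)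
        smul_max_lt).out 3 1).1 hn
      refine ((ModuleCat.exists_isRegular_tfae (maximalIdeal R) (n - 1)
        (ModuleCat.of R (QuotSMulTop x M)) smul_max_lt).out 3 1).2 ?_
      intro i hi
      have zero1 := AddCommGrpCat.isZero_of_iff_subsingleton.mpr (h1 i (by omega))
      have zero2 := AddCommGrpCat.isZero_of_iff_subsingleton.mpr (h1 (i + 1) (by omega))
      exact AddCommGrpCat.subsingleton_of_isZero <| ShortComplex.Exact.isZero_of_both_zeros
        ((Ext.covariant_sequence_exact₃' _ (IsSMulRegular.smulShortComplex_shortExact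
          (M := ModuleCat.of R M) hreg.1)) i (i + 1) rfl)
        (zero1.eq_zero_of_src _) (zero2.eq_zero_of_tgt _)
    obtain ⟨ts, h1, h2, h3⟩ := ih (fun r hr => hrs r (by simp [hr])) hreg.2 (n - 1) key
    refine ⟨ts, by simp; omega, h2, ?_⟩
    exact ((Submodule.quotOfListConsSMulTopEquivQuotSMulTopInner M x rs).isRegular_congr ts).2 h3

lemma unmixed {d : ℕ} (h : IsCM R d) (rs : List R) (hrs : ∀ r ∈ rs, r ∈ maximalIdeal R)
    (hreg : IsWeaklyRegular R rs) (p : Ideal R)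
    (hp : p ∈ associatedPrimes R (R ⧸ (Ideal.ofList rs • ⊤ : Submodule R R))) :
    p.height ≤ rs.length := by
  obtain ⟨ts, h1, h2, h3⟩ := depth_quot rs hrs hreg d h.2
  have := ass_height ts h2 h3 p hp
  rw [h.height_max, h1] at this
  have hle := h.height_le p hp.1
  obtain ⟨k, hk⟩ := ENat.ne_top_iff_exists.1 (ne_top_of_le_ne_top (ENat.natCast_ne_top d) hle)
  rw [← hk] at this hle ⊢
  norm_cast at *
  omega

/-- an ideal of large height contains an element regular modulo a regular sequence -/
lemma exists_extend {d : ℕ} (h : IsCM R d) (rs : List R) (hrs : ∀ r ∈ rs, r ∈ maximalIdeal R)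
    (hreg : IsWeaklyRegular R rs) (P : Ideal R) (hP : HtGe P (rs.length + 1)) :
    ∃ x ∈ P, IsSMulRegular (R ⧸ (Ideal.ofList rs • ⊤ : Submodule R R)) x := by
  by_contra! hcon
  have hsub : (P : Set R) ⊆ ⋃ p ∈ associatedPrimes R
      (R ⧸ (Ideal.ofList rs • ⊤ : Submodule R R)), (p : Set R) := by
    intro x hx
    rw [biUnion_associatedPrimes_eq_compl_regular]
    exact hcon x hx
  have hfin := associatedPrimes.finite R (R ⧸ (Ideal.ofList rs • ⊤ : Submodule R R))
  obtain ⟨p, hp, hle⟩ := (Ideal.subset_union_prime_finite hfin (f := id) ⊤ ⊤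
    (fun p hp _ _ => hp.1)).1 hsub
  have h1 := hP p hp.1 hle
  have h2 := unmixed h rs hrs hreg p hp
  have := h1.trans h2
  norm_cast at this
  omega

lemma isWR_append {M : Type u} [AddCommGroup M] [Module R M] (rs : List R) (x : R) :
    IsWeaklyRegular M (rs ++ [x]) ↔ IsWeaklyRegular M rs ∧
      IsSMulRegular (M ⧸ (Ideal.ofList rs • ⊤ : Submodule R M)) x := by
  rw [isWeaklyRegular_append_iff, isWeaklyRegular_singleton_iff]

/-- an ideal of height at least `k`, inside the maximal ideal, contains a regular sequence of
length `k` extending a given one -/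
lemma exists_regular_extend {d : ℕ} (h : IsCM R d) (rs : List R)
    (hrs : ∀ r ∈ rs, r ∈ maximalIdeal R) (hreg : IsWeaklyRegular R rs)
    (P : Ideal R) (hPm : P ≤ maximalIdeal R) (k : ℕ) (hP : HtGe P (rs.length + k)) :
    ∃ ts : List R, ts.length = k ∧ (∀ r ∈ ts, r ∈ P) ∧ IsWeaklyRegular R (rs ++ ts) := by
  induction k with
  | zero => exact ⟨[], rfl, by simp, by simpa using hreg⟩
  | succ k ih =>
    obtain ⟨ts, h1, h2, h3⟩ := ih (hP.of_le (by omega))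
    have hm : ∀ r ∈ rs ++ ts, r ∈ maximalIdeal R := by
      intro r hr
      rcases List.mem_append.1 hr with hr | hr
      · exact hrs r hr
      · exact hPm (h2 r hr)
    obtain ⟨x, hx, hxr⟩ := exists_extend h (rs ++ ts) hm h3 P (by
      refine hP.of_le ?_
      simp; omega)
    refine ⟨ts ++ [x], by simp [h1], ?_, ?_⟩
    · intro r hr
      rcases List.mem_append.1 hr with hr | hr
      · exact h2 r hr
      · rw [List.mem_singleton.1 hr]; exact hx
    · rw [← List.append_assoc, isWR_append]
      exact ⟨h3, hxr⟩

lemma HtGe.inf_max {d k : ℕ} (h : IsCM R d) {P : Ideal R} (hP : HtGe P k) (hk : k ≤ d) :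
    HtGe (P ⊓ maximalIdeal R) k := by
  intro p hp hle
  rcases hp.inf_le.1 hle with h1 | h1
  · exact hP p hp h1
  · have := Ideal.height_mono h1
    rw [h.height_max] at this
    exact le_trans (by exact_mod_cast hk) this

lemma localize_CM {d : ℕ} (h : IsCM R d) (p : Ideal R) [p.IsPrime] :
    ∃ e : ℕ, p.height = e ∧ IsCM (Localization.AtPrime p) e := by
  have hle := h.height_le p inferInstance
  obtain ⟨e, he⟩ := ENat.ne_top_iff_exists.1 (ne_top_of_le_ne_top (ENat.natCast_ne_top d) hle)
  refine ⟨e, he.symm, ?_, ?_⟩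
  · rw [IsLocalization.AtPrime.ringKrullDim_eq_height p (Localization.AtPrime p), ← he]
    rfl
  · obtain ⟨ts, h1, h2, h3⟩ := exists_regular_extend h [] (by simp) (IsWeaklyRegular.nil R R) p
      (IsLocalRing.le_maximalIdeal (Ideal.IsPrime.ne_top inferInstance)) e (by
        intro q hq hpq
        simpa [he] using Ideal.height_mono hpq)
    refine ⟨ts.map (algebraMap R (Localization.AtPrime p)), by simpa using h1, ?_, ?_⟩
    · intro r hr
      obtain ⟨s, hs, rfl⟩ := List.mem_map.1 hr
      exact (IsLocalization.AtPrime.to_map_mem_maximal_iff _ p s).2 (h2 s hs)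
    · exact IsWeaklyRegular.isRegular_of_isLocalization_of_mem _ p (by simpa using h3) h2

end A
end LT

set_option linter.unusedSectionVars false
namespace LT

open RingTheory.Sequence CategoryTheory IsLocalRing
open scoped Pointwise

section B
variable {R : Type u} [CommRing R]

/-- Ext groups at module level -/
abbrev E (R : Type u) [CommRing R] (M N : Type u) [AddCommGroup M] [Module R M]
    [AddCommGroup N] [Module R N] (n : ℕ) : Type u :=
  Abelian.Ext (ModuleCat.of R M) (ModuleCat.of R N) n

variable {A B C : Type u} [AddCommGroup A] [Module R A] [AddCommGroup B] [Module R B]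
  [AddCommGroup C] [Module R C]
variable (N : Type u) [AddCommGroup N] [Module R N]

/-- pullback on Ext -/
def pull (f : A →ₗ[R] B) (n : ℕ) : E R B N n →ₗ[R] E R A N n where
  toFun x := (Abelian.Ext.mk₀ (ModuleCat.ofHom f)).comp x (zero_add n)
  map_add' := by intros; simp
  map_smul' := by intros; simp [Abelian.Ext.comp_smul]

lemma pull_comp (f : A →ₗ[R] B) (g : B →ₗ[R] C) (n : ℕ) (x : E R C N n) :
    pull N (g ∘ₗ f) n x = pull N f n (pull N g n x) := by
  simp [pull, ModuleCat.ofHom_comp]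

lemma pull_id (n : ℕ) (x : E R C N n) : pull N LinearMap.id n x = x := by
  simp [pull, ModuleCat.ofHom_id]

lemma pull_smul (r : R) (f : A →ₗ[R] B) (n : ℕ) (x : E R B N n) :
    pull N (r • f) n x = r • pull N f n x := by
  have : ModuleCat.ofHom (r • f) = r • ModuleCat.ofHom f := rfl
  simp [pull, this, Abelian.Ext.mk₀_smul, Abelian.Ext.smul_comp]

lemma pull_zero (n : ℕ) (x : E R B N n) : pull N (0 : A →ₗ[R] B) n x = 0 := by
  have : (0 : A →ₗ[R] B) = (0 : R) • 0 := by simp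
  rw [this, pull_smul, zero_smul]

/-- Ext invariance under linear equivalence -/
def pullEquiv (e : A ≃ₗ[R] B) (n : ℕ) : E R B N n ≃ₗ[R] E R A N n :=
  LinearEquiv.ofLinearMap (pull N e.toLinearMap n) (pull N e.symm.toLinearMap n)
    (by
      ext x
      simp only [LinearMap.comp_apply, LinearMap.id_apply]
      rw [← pull_comp]
      simp [pull_id])
    (by
      ext x
      simp only [LinearMap.comp_apply, LinearMap.id_apply]
      rw [← pull_comp]
      simp [pull_id])

lemma subsingleton_E_of_equiv (e : A ≃ₗ[R] B) (n : ℕ) [Subsingleton (E R A N n)] :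
    Subsingleton (E R B N n) := (pullEquiv N e n).toEquiv.subsingleton

lemma subsingleton_E_ring (n : ℕ) (hn : n ≠ 0) : Subsingleton (E R R N n) := by
  obtain ⟨k, rfl⟩ := Nat.exists_eq_succ_of_ne_zero hn
  have : Projective (ModuleCat.of R R) := (IsProjective.iff_projective R).1 inferInstance
  exact ⟨fun x y => by rw [Abelian.Ext.eq_zero_of_projective x, Abelian.Ext.eq_zero_of_projective y]⟩

/-- short exact sequences -/
structure SES (f : A →ₗ[R] B) (g : B →ₗ[R] C) : Prop where
  inj : Function.Injective f
  exact : Function.Exact f g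
  surj : Function.Surjective g

/-- the categorical short complex -/
abbrev SES.sc {f : A →ₗ[R] B} {g : B →ₗ[R] C} (h : SES f g) : ShortComplex (ModuleCat.{u} R) :=
  ShortComplex.mk (ModuleCat.ofHom f) (ModuleCat.ofHom g) (by
    ext x
    exact (h.exact (f x)).2 ⟨x, rfl⟩)

lemma SES.se {f : A →ₗ[R] B} {g : B →ₗ[R] C} (h : SES f g) : h.sc.ShortExact where
  exact := by
    rw [ShortComplex.ShortExact.moduleCat_exact_iff_function_exact]
    exact h.exact
  mono_f := (ModuleCat.mono_iff_injective _).2 h.inj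
  epi_g := (ModuleCat.epi_iff_surjective _).2 h.surj

/-- connecting map -/
def SES.δ {f : A →ₗ[R] B} {g : B →ₗ[R] C} (h : SES f g) (n : ℕ) :
    E R A N n →ₗ[R] E R C N (n + 1) where
  toFun x := h.se.extClass.comp x (add_comm 1 n)
  map_add' := by intros; simp
  map_smul' := by intros; simp [Abelian.Ext.comp_smul]

lemma SES.exB {f : A →ₗ[R] B} {g : B →ₗ[R] C} (h : SES f g) (n : ℕ) (x : E R B N n) (hx : pull N f n x = 0) :
    ∃ y, pull N g n y = x :=
  Abelian.Ext.contravariant_sequence_exact₂ h.se _ x hx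

lemma SES.exA {f : A →ₗ[R] B} {g : B →ₗ[R] C} (h : SES f g) (n : ℕ) (x : E R A N n) (hx : h.δ N n x = 0) : ∃ y, pull N f n y = x :=
  Abelian.Ext.contravariant_sequence_exact₁ h.se _ x (add_comm 1 n) hx

lemma SES.δ_pull {f : A →ₗ[R] B} {g : B →ₗ[R] C} (h : SES f g) (n : ℕ) (y : E R B N n) : h.δ N n (pull N f n y) = 0 := by
  have := (h.se).extClass_comp_assoc y (h := add_comm 1 n)
  exact this

lemma SES.exC {f : A →ₗ[R] B} {g : B →ₗ[R] C} (h : SES f g) (n : ℕ) (x : E R C N (n + 1)) (hx : pull N g (n + 1) x = 0) :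
    ∃ y, h.δ N n y = x :=
  Abelian.Ext.contravariant_sequence_exact₃ h.se _ x hx (add_comm 1 n)

lemma pull_inj_zero (g : B →ₗ[R] C) (hg : Function.Surjective g) :
    Function.Injective (pull N g 0) := by
  have : Epi (ModuleCat.ofHom g) := (ModuleCat.epi_iff_surjective _).2 hg
  exact Abelian.Ext.precomp_mk₀_injective_of_epi _ (ModuleCat.ofHom g)

/-- pullback along `g` is injective if the previous Ext of the kernel vanishes -/
lemma SES.inj_of_prev {f : A →ₗ[R] B} {g : B →ₗ[R] C} (h : SES f g) (n : ℕ) (hs : ∀ m, m + 1 = n → Subsingleton (E R A N m)) :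
    Function.Injective (pull N g n) := by
  rcases n with _ | n
  · exact pull_inj_zero N g h.surj
  · rw [← LinearMap.ker_eq_bot, LinearMap.ker_eq_bot']
    intro x hx
    obtain ⟨y, rfl⟩ := h.exC N n x hx
    have := hs n rfl
    rw [Subsingleton.elim y 0, map_zero]

lemma SES.surj_of_next {f : A →ₗ[R] B} {g : B →ₗ[R] C} (h : SES f g) (n : ℕ) (hs : Subsingleton (E R A N n)) :
    Function.Surjective (pull N g n) :=
  fun x => h.exB N n x (Subsingleton.elim _ _)

/-- pushforward -/
def push (M : Type u) [AddCommGroup M] [Module R M] (f : A →ₗ[R] B) (n : ℕ) :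
    E R M A n →ₗ[R] E R M B n where
  toFun x := x.comp (Abelian.Ext.mk₀ (ModuleCat.ofHom f)) (add_zero n)
  map_add' := by intros; simp
  map_smul' := by intros; simp [Abelian.Ext.smul_comp]

lemma push_smul_id (M : Type u) [AddCommGroup M] [Module R M] (r : R) (n : ℕ) (x : E R M A n) :
    push M (LinearMap.lsmul R A r) n x = r • x := by
  rw [Abelian.Ext.smul_eq_comp_mk₀]
  rfl

lemma SES.cov_inj {f : A →ₗ[R] B} {g : B →ₗ[R] C} (h : SES f g) (M : Type u) [AddCommGroup M] [Module R M] (n : ℕ)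
    (hs : ∀ m, m + 1 = n → Subsingleton (E R M C m)) : Function.Injective (push M f n) := by
  rcases n with _ | n
  · have : Mono (ModuleCat.ofHom f) := (ModuleCat.mono_iff_injective _).2 h.inj
    exact Abelian.Ext.postcomp_mk₀_injective_of_mono _ (ModuleCat.ofHom f)
  · rw [← LinearMap.ker_eq_bot, LinearMap.ker_eq_bot']
    intro x hx
    obtain ⟨y, rfl⟩ := Abelian.Ext.covariant_sequence_exact₁ _ h.se x hx rfl
    have := hs n rfl
    rw [Subsingleton.elim y 0, Abelian.Ext.zero_comp]

lemma SES.cov_ex {f : A →ₗ[R] B} {g : B →ₗ[R] C} (h : SES f g) (M : Type u) [AddCommGroup M] [Module R M] (n : ℕ) (x : E R M B n)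
    (hx : push M g n x = 0) : ∃ y, push M f n y = x :=
  Abelian.Ext.covariant_sequence_exact₂ _ h.se x hx

lemma ses_smul {u : R} (hu : IsSMulRegular A u) :
    SES (LinearMap.lsmul R A u) (Submodule.mkQ (u • (⊤ : Submodule R A))) where
  inj := hu
  exact := by
    intro y
    rw [Submodule.mkQ_apply, Submodule.Quotient.mk_eq_zero,
      Submodule.mem_smul_pointwise_iff_exists]
    simp
  surj := Submodule.mkQ_surjective _

lemma push_comp_smul (M : Type u) [AddCommGroup M] [Module R M] (f : A →ₗ[R] B) (n : ℕ) (r : R)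
    (x : E R M A n) : push M f n (r • x) = r • push M f n x := map_smul _ _ _

variable [IsLocalRing R] [IsNoetherianRing R]

lemma ext_vanish_of_regular (M : Type u) [AddCommGroup M] [Module R M] [Module.Finite R M]
    [Module.Finite R N] (rs : List R) (hm : ∀ r ∈ rs, r ∈ maximalIdeal R)
    (hM : ∀ r ∈ rs, ∀ z : M, r • z = 0) (hreg : IsWeaklyRegular N rs) [Nontrivial N] (i : ℕ)
    (hi : i < rs.length) : Subsingleton (E R M N i) := by
  have hR : RingTheory.Sequence.IsRegular N rs :=
    IsRegular.of_isWeaklyRegular_of_mem_maximalIdeal _ hm hreg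
  refine ModuleCat.subsingleton_ext_of_exists_isRegular (Ideal.ofList rs) (ModuleCat.of R M) ?_
    (ModuleCat.of R N) hR.top_ne_smul.symm.lt_top rs (fun r hr => Ideal.subset_span hr) hR i hi
  rw [Module.support_eq_zeroLocus]
  refine PrimeSpectrum.zeroLocus_anti_mono ?_
  change Ideal.ofList rs ≤ Module.annihilator R M
  refine Ideal.span_le.2 fun r hr => ?_
  exact Module.mem_annihilator.2 (hM r hr)

lemma ext_vanish_torsion {d : ℕ} (hd : IsCM R d) (M : Type u) [AddCommGroup M] [Module R M]
    [Module.Finite R M]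
    (hM : ∀ z : M, ∀ p : Ideal R, p.IsPrime → p ≠ maximalIdeal R → ∃ s, s ∉ p ∧ s • z = 0)
    (i : ℕ) (hi : i < d) : Subsingleton (E R M R i) := by
  obtain ⟨-, rs, h1, h2, h3⟩ := hd
  refine ModuleCat.subsingleton_ext_of_exists_isRegular (maximalIdeal R) (ModuleCat.of R M) ?_
    (ModuleCat.of R R) smul_max_lt rs h2 h3 i (by omega)
  intro p hp
  have : p.asIdeal = maximalIdeal R := by
    by_contra hne
    obtain ⟨z, hz⟩ := Module.mem_support_iff_exists_annihilator.1 hp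
    obtain ⟨s, hs, hsz⟩ := hM z p.asIdeal p.2 hne
    exact hs (hz (by simp [hsz]))
  rw [PrimeSpectrum.mem_zeroLocus, this]

/-- two-step regularity of Ext -/
lemma ext_two_regular (M : Type u) [AddCommGroup M] [Module R M] [Module.Finite R M]
    (rs : List R) (u v : R) (hm : ∀ r ∈ rs ++ [u, v], r ∈ maximalIdeal R)
    (hM : ∀ r ∈ rs, ∀ z : M, r • z = 0) (hreg : IsWeaklyRegular R (rs ++ [u, v])) :
    (∀ e : E R M R rs.length, u • e = 0 → e = 0) ∧
    (∀ e e' : E R M R rs.length, v • e = u • e' → ∃ e'', e = u • e'') := by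
  have hperm : IsWeaklyRegular R (u :: v :: rs) :=
    IsLocalRing.isWeaklyRegular_of_perm_of_subset_maximalIdeal hreg
      (by simpa using List.perm_append_comm (l₁ := rs) (l₂ := [u, v])) hm
  have hperm2 : IsWeaklyRegular R (u :: rs ++ [v]) := by
    refine IsLocalRing.isWeaklyRegular_of_perm_of_subset_maximalIdeal hperm ?_ ?_
    · simpa using List.perm_append_comm (l₁ := [v]) (l₂ := rs)
    · intro r hr; exact hm r (by simpa [or_comm, or_assoc, or_left_comm] using hr)
  have hrm : ∀ r ∈ rs, r ∈ maximalIdeal R := fun r hr => hm r (by simp [hr])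
  have hum : u ∈ maximalIdeal R := hm u (by simp)
  have hvm : v ∈ maximalIdeal R := hm v (by simp)
  rw [isWeaklyRegular_cons_iff, isWeaklyRegular_cons_iff] at hperm
  rw [List.cons_append, isWeaklyRegular_cons_iff, isWR_append] at hperm2
  have : Nontrivial (QuotSMulTop u R) := nontrivial_quotSMulTop_of_mem_maximalIdeal _ hum
  have : Nontrivial (QuotSMulTop v (QuotSMulTop u R)) :=
    nontrivial_quotSMulTop_of_mem_maximalIdeal _ hvm
  have s1 := ses_smul hperm.1
  have s2 := ses_smul hperm.2.1
  have i1 : Function.Injective (push M (LinearMap.lsmul R R u) rs.length) :=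
    s1.cov_inj M _ fun m hm' =>
      ext_vanish_of_regular (QuotSMulTop u R) M rs hrm hM hperm2.2.1 m (by omega)
  have i2 : Function.Injective (push M (LinearMap.lsmul R (QuotSMulTop u R) v) rs.length) :=
    s2.cov_inj M _ fun m hm' =>
      ext_vanish_of_regular (QuotSMulTop v (QuotSMulTop u R)) M rs hrm hM hperm.2.2 m (by omega)
  refine ⟨fun e he => i1 (by rw [push_smul_id, he, map_zero]), fun e e' he => ?_⟩
  have h0 : push M (Submodule.mkQ (u • (⊤ : Submodule R R))) rs.length e = 0 := by
    apply i2
    rw [push_smul_id, map_zero, ← map_smul, he, map_smul]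
    rw [← push_smul_id]
    have hz : (LinearMap.lsmul R (QuotSMulTop u R) u) = 0 := by
      refine LinearMap.ext fun y => ?_
      obtain ⟨y, rfl⟩ := Submodule.mkQ_surjective _ y
      change u • Submodule.Quotient.mk y = (0 : QuotSMulTop u R)
      rw [← Submodule.Quotient.mk_smul]
      exact (Submodule.Quotient.mk_eq_zero _).2 (Submodule.smul_mem_pointwise_smul _ _ _ trivial)
    have hz2 : ∀ x : E R M (QuotSMulTop u R) rs.length,
        push M (0 : QuotSMulTop u R →ₗ[R] QuotSMulTop u R) rs.length x = 0 := by
      intro x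
      change x.comp (Abelian.Ext.mk₀ 0) (add_zero _) = 0
      simp
    erw [hz]
    exact hz2 _
  obtain ⟨y, hy⟩ := s1.cov_ex M _ e h0
  exact ⟨y, by rw [← hy, push_smul_id]⟩

end B
end LT

set_option linter.unusedSectionVars false
namespace LT

open CategoryTheory IsLocalRing

lemma E_of_extVanish {R : Type u} [CommRing R] (M N : Type u) [AddCommGroup M] [Module R M]
    [AddCommGroup N] [Module R N] (n : ℕ) (h : extVanish R M N (n + 1)) :
    Subsingleton (E R M N (n + 1)) := by
  let P : ProjectiveResolution (ModuleCat.of R M) :=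
    projectiveResolution (ModuleCat.of R M)
  have h1 : Limits.IsZero (((Ext R (ModuleCat.{u} R) (n + 1)).obj
      (Opposite.op (ModuleCat.of R M))).obj (ModuleCat.of R N)) := by
    rw [ModuleCat.isZero_iff_subsingleton]
    exact h
  have h2 := h1.of_iso (P.isoExt (R := R) (n + 1) (ModuleCat.of R N)).symm
  rw [← HomologicalComplex.exactAt_iff_isZero_homology,
    HomologicalComplex.exactAt_iff' _ n (n + 1) (n + 2) (by simp) (by simp),
    ShortComplex.moduleCat_exact_iff] at h2
  suffices hz : ∀ α : E R M N (n + 1), α = 0 from ⟨fun a b => by rw [hz a, hz b]⟩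
  intro α
  obtain ⟨f, hf, rfl⟩ := P.extMk_surjective α (n + 2) rfl
  rw [P.extMk_eq_zero_iff f (n + 2) rfl hf n rfl]
  obtain ⟨g, hg⟩ := h2 f hf
  exact ⟨g, hg⟩

lemma subsingleton_E_proj {R : Type u} [CommRing R] (M N : Type u) [AddCommGroup M] [Module R M]
    [Module.Projective R M] [AddCommGroup N] [Module R N] (k : ℕ) :
    Subsingleton (E R M N (k + 1)) := by
  have : Projective (ModuleCat.of R M) := (IsProjective.iff_projective M).1 inferInstance
  exact ⟨fun x y => by rw [Abelian.Ext.eq_zero_of_projective x, Abelian.Ext.eq_zero_of_projective y]⟩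

section
variable {R : Type u} [CommRing R] {A B C : Type u} [AddCommGroup A] [Module R A]
  [AddCommGroup B] [Module R B] [AddCommGroup C] [Module R C] (N : Type u) [AddCommGroup N]
  [Module R N]

lemma mk0_surj (x : E R A N 0) : ∃ φ : A →ₗ[R] N, Abelian.Ext.mk₀ (ModuleCat.ofHom φ) = x := by
  obtain ⟨φ, rfl⟩ := (Abelian.Ext.mk₀_bijective (ModuleCat.of R A) (ModuleCat.of R N)).2 x
  exact ⟨φ.hom, rfl⟩

lemma pull_mk0 (f : A →ₗ[R] B) (φ : B →ₗ[R] N) :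
    pull N f 0 (Abelian.Ext.mk₀ (ModuleCat.ofHom φ) : E R B N 0) =
      Abelian.Ext.mk₀ (ModuleCat.ofHom (φ ∘ₗ f)) := by
  change (Abelian.Ext.mk₀ _).comp (Abelian.Ext.mk₀ _) (zero_add 0) = _
  rw [Abelian.Ext.mk₀_comp_mk₀]
  rfl

lemma SES.extend_of_ext1 {f : A →ₗ[R] B} {g : B →ₗ[R] C} (h : SES f g)
    (hs : Subsingleton (E R C N 1)) (φ : A →ₗ[R] N) : ∃ ψ : B →ₗ[R] N, ψ ∘ₗ f = φ := by
  obtain ⟨y, hy⟩ := h.exA N 0 (Abelian.Ext.mk₀ (ModuleCat.ofHom φ)) (Subsingleton.elim _ _)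
  obtain ⟨ψ, rfl⟩ := mk0_surj N y
  refine ⟨ψ, ?_⟩
  rw [pull_mk0] at hy
  have := (Abelian.Ext.mk₀_bijective (ModuleCat.of R A) (ModuleCat.of R N)).1 hy
  exact congrArg ModuleCat.Hom.hom this

lemma SES.ext1_of_extend {f : A →ₗ[R] B} {g : B →ₗ[R] C} (h : SES f g) [Module.Projective R B]
    (hs : ∀ φ : A →ₗ[R] N, ∃ ψ : B →ₗ[R] N, ψ ∘ₗ f = φ) : Subsingleton (E R C N 1) := by
  suffices hz : ∀ α : E R C N 1, α = 0 from ⟨fun a b => by rw [hz a, hz b]⟩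
  intro α
  have := subsingleton_E_proj B N (R := R) 0
  obtain ⟨y, rfl⟩ := h.exC N 0 α (Subsingleton.elim _ _)
  obtain ⟨φ, rfl⟩ := mk0_surj N y
  obtain ⟨ψ, rfl⟩ := hs φ
  rw [← pull_mk0]; exact h.δ_pull N 0 _

lemma SES.ext_shift {f : A →ₗ[R] B} {g : B →ₗ[R] C} (h : SES f g) [Module.Projective R B]
    (k : ℕ) : Subsingleton (E R A N (k + 1)) ↔ Subsingleton (E R C N (k + 2)) := by
  have h1 := subsingleton_E_proj B N (R := R) k
  have h2 := subsingleton_E_proj B N (R := R) (k + 1)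
  constructor
  · intro _
    suffices hz : ∀ α : E R C N (k + 2), α = 0 from ⟨fun a b => by rw [hz a, hz b]⟩
    intro α
    obtain ⟨y, rfl⟩ := h.exC N (k + 1) α (Subsingleton.elim _ _)
    rw [Subsingleton.elim y 0, map_zero]
  · intro _
    suffices hz : ∀ α : E R A N (k + 1), α = 0 from ⟨fun a b => by rw [hz a, hz b]⟩
    intro α
    obtain ⟨y, rfl⟩ := h.exA N (k + 1) α (Subsingleton.elim _ _)
    rw [Subsingleton.elim y 0, map_zero]

lemma SES.baseChange {f : A →ₗ[R] B} {g : B →ₗ[R] C} (h : SES f g) (S : Type u) [CommRing S]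
    [Algebra R S] [Module.Flat R S] : SES (f.baseChange S) (g.baseChange S) where
  inj := Module.Flat.lTensor_preserves_injective_linearMap (M := S) f h.inj
  exact := lTensor_exact S h.exact h.surj
  surj := LinearMap.lTensor_surjective S h.surj

end

lemma ext_baseChange {R : Type u} [CommRing R] [IsNoetherianRing R] (S : Type u) [CommRing S]
    [Algebra R S] [Module.Flat R S] (k : ℕ) : ∀ (M : Type u) [AddCommGroup M] [Module R M]
    [Module.Finite R M], Subsingleton (E R M R (k + 1)) →
      Subsingleton (E S (S ⊗[R] M) S (k + 1)) := by
  induction k with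
  | zero =>
    intro M _ _ _ hM
    obtain ⟨n, π, hπ⟩ := Module.Finite.exists_fin' R M
    have h : SES (LinearMap.ker π).subtype π :=
      ⟨Subtype.val_injective, LinearMap.exact_subtype_ker_map π, hπ⟩
    refine (h.baseChange S).ext1_of_extend S fun φ => ?_
    let φ' : LinearMap.ker π →ₗ[R] S := (φ.restrictScalars R) ∘ₗ (TensorProduct.mk R S _ 1)
    have : Module.FinitePresentation R (LinearMap.ker π) :=
      Module.finitePresentation_of_finite R _
    obtain ⟨κ, α, β, hαβ⟩ := Module.Flat.exists_factorization_of_finitePresentation φ'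
    choose ψ hψ using fun i : Fin κ => h.extend_of_ext1 R hM ((Finsupp.lapply i) ∘ₗ α)
    let Ψ : (Fin n → R) →ₗ[R] (Fin κ →₀ R) :=
      (Finsupp.linearEquivFunOnFinite R R (Fin κ)).symm.toLinearMap ∘ₗ LinearMap.pi ψ
    have hΨ : Ψ ∘ₗ (LinearMap.ker π).subtype = α := by
      ext x i
      have := LinearMap.congr_fun (hψ i) x
      simpa [Ψ] using this
    refine ⟨LinearMap.liftBaseChange S (β ∘ₗ Ψ), ?_⟩
    apply TensorProduct.AlgebraTensorModule.ext
    intro s x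
    have e1 : φ' x = β (Ψ x) := by
      rw [hαβ, ← hΨ]; rfl
    have e2 : φ (s ⊗ₜ x) = s • φ' x := by
      change _ = s • φ (1 ⊗ₜ x)
      rw [← map_smul, TensorProduct.smul_tmul']
      simp
    rw [e2, e1]
    simp
  | succ k ih =>
    intro M _ _ _ hM
    obtain ⟨n, π, hπ⟩ := Module.Finite.exists_fin' R M
    have h : SES (LinearMap.ker π).subtype π :=
      ⟨Subtype.val_injective, LinearMap.exact_subtype_ker_map π, hπ⟩
    exact ((h.baseChange S).ext_shift S k).1 (ih _ ((h.ext_shift R k).2 hM))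


lemma exists_equiv_map {R : Type u} [CommRing R] (S : Type u) [CommRing S]
    [Algebra R S] [Module.Flat R S] (J : Ideal R) :
    ∃ e : (S ⊗[R] J) ≃ₗ[S] (J.map (algebraMap R S)), ∀ s x,
      (e (s ⊗ₜ x) : S) = s * algebraMap R S x := by
  let F : (S ⊗[R] J) →ₗ[S] S := LinearMap.liftBaseChange S ((Algebra.linearMap R S) ∘ₗ J.subtype)
  have hinj : Function.Injective F := by
    have h1 := Module.Flat.lTensor_preserves_injective_linearMap (M := S) J.subtype
      Subtype.val_injective
    have h2 : ∀ z, F z = TensorProduct.rid R S (LinearMap.lTensor S J.subtype z) := by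
      intro z
      induction z with
      | zero => simp
      | add a b ha hb => rw [map_add, map_add, map_add, ha, hb]
      | tmul s x => simp [F, Algebra.smul_def, mul_comm]
    intro a b hab
    rw [h2, h2] at hab
    exact h1 ((TensorProduct.rid R S).injective hab)
  have hr : LinearMap.range F = J.map (algebraMap R S) := by
    apply le_antisymm
    · rintro _ ⟨z, rfl⟩
      induction z with
      | zero => simp
      | add a b ha hb => rw [map_add]; exact add_mem ha hb
      | tmul s x =>
        simp only [F, LinearMap.liftBaseChange_tmul, LinearMap.comp_apply, Submodule.subtype_apply,
          Algebra.linearMap_apply, smul_eq_mul]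
        exact Ideal.mul_mem_left _ _ (Ideal.mem_map_of_mem _ x.2)
    · refine Ideal.map_le_iff_le_comap.2 fun x hx => ?_
      exact ⟨1 ⊗ₜ ⟨x, hx⟩, by simp [F]⟩
  refine ⟨(LinearEquiv.ofInjective F hinj).trans (LinearEquiv.ofEq _ _ hr), fun s x => ?_⟩
  change F (s ⊗ₜ x) = _
  simp [F]

lemma ext_ideal_baseChange {R : Type u} [CommRing R] [IsNoetherianRing R] (S : Type u) [CommRing S]
    [Algebra R S] [Module.Flat R S] (J : Ideal R) (k : ℕ) (h : Subsingleton (E R J R (k + 1))) :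
    Subsingleton (E S (J.map (algebraMap R S)) S (k + 1)) := by
  obtain ⟨e, -⟩ := exists_equiv_map S J
  have := ext_baseChange S k J h
  exact subsingleton_E_of_equiv S e (k + 1)

end LT

set_option linter.unusedSectionVars false
set_option linter.unusedVariables false
namespace LT

open RingTheory.Sequence CategoryTheory IsLocalRing
open scoped Pointwise

section C1
variable {R : Type u} [CommRing R]

/-- the ideal generated by the first `i` elements -/
def J (a : ℕ → R) (i : ℕ) : Ideal R := Ideal.span (a '' {k | k < i})

/-- residual ideal -/
def K (a : ℕ → R) (I : Ideal R) (i : ℕ) : Ideal R where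
  carrier := {r | ∀ y ∈ I, r * y ∈ J a i}
  zero_mem' := by intro y _; simp
  add_mem' := by intro r s hr hs y hy; rw [add_mul]; exact add_mem (hr y hy) (hs y hy)
  smul_mem' := by
    intro c r hr y hy; rw [smul_eq_mul, mul_assoc]; exact Ideal.mul_mem_left _ _ (hr y hy)

lemma mem_K {a : ℕ → R} {I : Ideal R} {i : ℕ} {r : R} : r ∈ K a I i ↔ ∀ y ∈ I, r * y ∈ J a i :=
  Iff.rfl

@[simp] lemma J_zero (a : ℕ → R) : J a 0 = ⊥ := by simp [J]

lemma J_succ (a : ℕ → R) (i : ℕ) : J a (i + 1) = J a i ⊔ Ideal.span {a i} := by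
  rw [J, J, ← Ideal.span_union]
  congr 1
  ext x
  simp only [Set.mem_image, Set.mem_ofPred_eq, Set.mem_union, Set.mem_singleton_iff]
  constructor
  · rintro ⟨k, hk, rfl⟩
    rcases Nat.lt_succ_iff_lt_or_eq.1 hk with h | rfl
    · exact Or.inl ⟨k, h, rfl⟩
    · exact Or.inr rfl
  · rintro (⟨k, hk, rfl⟩ | rfl)
    · exact ⟨k, by omega, rfl⟩
    · exact ⟨i, by omega, rfl⟩

lemma J_mono (a : ℕ → R) {i j : ℕ} (h : i ≤ j) : J a i ≤ J a j :=
  Ideal.span_mono (Set.image_mono fun k (hk : k < i) => lt_of_lt_of_le hk h)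

lemma mem_J (a : ℕ → R) {k i : ℕ} (h : k < i) : a k ∈ J a i :=
  Ideal.subset_span ⟨k, h, rfl⟩

lemma J_le {a : ℕ → R} {I : Ideal R} (h : ∀ k, a k ∈ I) (i : ℕ) : J a i ≤ I := by
  refine Ideal.span_le.2 ?_
  rintro _ ⟨k, -, rfl⟩
  exact h k

lemma J_le_K (a : ℕ → R) (I : Ideal R) (i : ℕ) : J a i ≤ K a I i :=
  fun r hr y _ => Ideal.mul_mem_right _ _ hr

lemma mem_J_succ {a : ℕ → R} {i : ℕ} {x : R} :
    x ∈ J a (i + 1) ↔ ∃ y ∈ J a i, ∃ r, x = a i * r + y := by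
  rw [J_succ, Submodule.mem_sup]
  constructor
  · rintro ⟨y, hy, z, hz, rfl⟩
    obtain ⟨r, rfl⟩ := Ideal.mem_span_singleton.1 hz
    exact ⟨y, hy, r, add_comm _ _⟩
  · rintro ⟨y, hy, r, rfl⟩
    exact ⟨y, hy, _, Ideal.mem_span_singleton.2 ⟨r, rfl⟩, add_comm _ _⟩

lemma ofList_range (a : ℕ → R) (i : ℕ) : Ideal.ofList ((List.range i).map a) = J a i := by
  rw [Ideal.ofList, J]
  congr 1
  ext x
  simp

variable [IsLocalRing R] [IsNoetherianRing R]

lemma J_reg {d : ℕ} (h : IsCM R d) (a : ℕ → R) (i : ℕ) (hJ : ∀ j ≤ i, HtGe (J a j) j)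
    (ham : ∀ k < i, a k ∈ maximalIdeal R) : IsWeaklyRegular R ((List.range i).map a) := by
  induction i with
  | zero => simp
  | succ i ih =>
    have ih := ih (fun j hj => hJ j (by omega)) fun k hk => ham k (by omega)
    rw [List.range_succ, List.map_append, List.map_singleton, isWR_append]
    refine ⟨ih, ?_⟩
    have hm : ∀ r ∈ (List.range i).map a, r ∈ maximalIdeal R := by
      intro r hr
      obtain ⟨k, hk, rfl⟩ := List.mem_map.1 hr
      exact ham k (by have := List.mem_range.1 hk; omega)
    obtain ⟨x, hx, hreg⟩ := exists_extend h _ hm ih (J a (i + 1))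
      (by simpa using hJ (i + 1) le_rfl)
    rw [isSMulRegular_quotient_iff_mem_of_smul_mem] at hreg ⊢
    intro z hz
    apply hreg
    simp only [ofList_range, smul_eq_mul, Ideal.mul_top] at hz ⊢
    obtain ⟨y, hy, r, rfl⟩ := mem_J_succ.1 hx
    have : (a i * r + y) * z = r * (a i * z) + y * z := by ring
    rw [this]
    exact add_mem (Ideal.mul_mem_left _ _ hz) (Ideal.mul_mem_right _ _ hy)

lemma regJ {d : ℕ} (h : IsCM R d) (a : ℕ → R) (i : ℕ) (hJ : ∀ j ≤ i, HtGe (J a j) j)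
    (P : Ideal R) (hP : HtGe P (i + 1)) (r : R) (hr : ∀ y ∈ P, r * y ∈ J a i) : r ∈ J a i := by
  by_cases htop : J a i = ⊤
  · rw [htop]; trivial
  have ham : ∀ k < i, a k ∈ maximalIdeal R := fun k hk => le_maximalIdeal htop (mem_J a hk)
  have hm : ∀ r ∈ (List.range i).map a, r ∈ maximalIdeal R := by
    intro r hr
    obtain ⟨k, hk, rfl⟩ := List.mem_map.1 hr
    exact ham k (List.mem_range.1 hk)
  obtain ⟨x, hx, hreg⟩ := exists_extend h _ hm (J_reg h a i hJ ham) P (by simpa using hP)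
  rw [isSMulRegular_quotient_iff_mem_of_smul_mem] at hreg
  have := hreg r
  simp only [ofList_range, smul_eq_mul, Ideal.mul_top] at this
  exact this (by rw [mul_comm]; exact hr x hx)

end C1
end LT

set_option linter.unusedSectionVars false
set_option linter.unusedVariables false
namespace LT

open RingTheory.Sequence CategoryTheory IsLocalRing
open scoped Pointwise

section C2
variable {R : Type u} [CommRing R]

/-- saturation of an ideal with respect to a submonoid -/
def sat (S : Submonoid R) (B : Ideal R) : Ideal R where
  carrier := {x | ∃ s ∈ S, s * x ∈ B}
  zero_mem' := ⟨1, one_mem _, by simp⟩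
  add_mem' := by
    rintro x y ⟨s, hs, hx⟩ ⟨t, ht, hy⟩
    refine ⟨s * t, mul_mem hs ht, ?_⟩
    have : s * t * (x + y) = t * (s * x) + s * (t * y) := by ring
    rw [this]
    exact add_mem (Ideal.mul_mem_left _ _ hx) (Ideal.mul_mem_left _ _ hy)
  smul_mem' := by
    rintro c x ⟨s, hs, hx⟩
    refine ⟨s, hs, ?_⟩
    rw [smul_eq_mul, mul_left_comm]
    exact Ideal.mul_mem_left _ _ hx

lemma mem_sat {S : Submonoid R} {B : Ideal R} {x : R} : x ∈ sat S B ↔ ∃ s ∈ S, s * x ∈ B :=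
  Iff.rfl

lemma le_sat (S : Submonoid R) (B : Ideal R) : B ≤ sat S B := fun x hx =>
  ⟨1, one_mem _, by simpa using hx⟩

lemma sat_mono (S : Submonoid R) {B C : Ideal R} (h : B ≤ C) : sat S B ≤ sat S C :=
  fun _ ⟨s, hs, hx⟩ => ⟨s, hs, h hx⟩

lemma mem_sat_of_mul {S : Submonoid R} {B : Ideal R} {x s : R} (hs : s ∈ S)
    (h : s * x ∈ sat S B) : x ∈ sat S B := by
  obtain ⟨t, ht, h⟩ := h
  exact ⟨t * s, mul_mem ht hs, by rwa [mul_assoc]⟩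

lemma sat_mul_le {S : Submonoid R} (B C : Ideal R) : sat S B * C ≤ sat S (B * C) := by
  rw [Ideal.mul_le]
  rintro x ⟨s, hs, hx⟩ y hy
  exact ⟨s, hs, by rw [← mul_assoc]; exact Ideal.mul_mem_mul hx hy⟩

lemma sat_bot (B : Ideal R) : sat ⊥ B = B := by
  refine le_antisymm ?_ (le_sat _ _)
  rintro x ⟨s, hs, hx⟩
  rw [Submonoid.mem_bot] at hs
  simpa [hs] using hx

/-- the consequence of being a relative `d`-sequence -/
lemma dseq (S : Submonoid R) (I : Ideal R) (a : ℕ → R) (n : ℕ) (haI : ∀ k, a k ∈ I)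
    (h1 : ∀ i < n, ∀ x ∈ I, a i * x ∈ J a i → x ∈ sat S (J a i))
    (h2 : I ≤ sat S (J a n)) : ∀ t i, i + t = n → ∀ j, ∀ x ∈ J a i, x ∈ I ^ (j + 1) →
      x ∈ sat S (J a i * I ^ j) := by
  intro t
  induction t with
  | zero =>
    rintro i rfl j x _ hx
    rw [pow_succ'] at hx
    exact sat_mul_le _ _ (Ideal.mul_mono_left h2 hx)
  | succ t ih =>
    intro i hi j
    induction j with
    | zero => intro x hx _; exact le_sat _ _ (by simpa using hx)
    | succ j ihj =>
      intro x hx hxI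
      obtain ⟨s, hs, hsx⟩ := ih (i + 1) (by omega) (j + 1) x (J_mono a (by omega) hx) hxI
      rw [J_succ, Ideal.sup_mul, Submodule.mem_sup] at hsx
      obtain ⟨w, hw, z, hz, hwz⟩ := hsx
      obtain ⟨y, hy, rfl⟩ := Ideal.mem_span_singleton_mul.1 hz
      have hay : a i * y ∈ J a i := by
        have : a i * y = s * x - w := by rw [← hwz]; ring
        rw [this]
        exact sub_mem (Ideal.mul_mem_left _ _ hx) (Ideal.mul_le_left (I := J a i) (J := I ^ (j + 1)) hw)
      have hyI : y ∈ I := Ideal.pow_le_self (I := I) (n := j + 1) (by omega) hy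
      obtain ⟨s', hs', hy'⟩ := h1 i (by omega) y hyI hay
      obtain ⟨s'', hs'', hy''⟩ := ihj (s' * y) hy' (Ideal.mul_mem_left _ _ hy)
      refine ⟨s'' * s' * s, mul_mem (mul_mem hs'' hs') hs, ?_⟩
      have : s'' * s' * s * x = s'' * s' * w + (s'' * (s' * y)) * a i := by
        rw [mul_assoc (s'' * s'), ← hwz]; ring
      rw [this]
      refine add_mem (Ideal.mul_mem_left _ _ hw) ?_
      rw [pow_succ, ← mul_assoc]
      exact Ideal.mul_mem_mul hy'' (haI i)

/-- quotient of ideals -/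
abbrev Q (A B : Ideal R) : Type u := ↥A ⧸ (Submodule.submoduleOf B A)

/-- class of an element in `Q A B` -/
def qmk (A B : Ideal R) (x : R) (hx : x ∈ A) : Q A B := Submodule.Quotient.mk ⟨x, hx⟩

lemma qmk_surj {A B : Ideal R} (z : Q A B) : ∃ x, ∃ hx : x ∈ A, qmk A B x hx = z := by
  obtain ⟨⟨x, hx⟩, rfl⟩ := Submodule.Quotient.mk_surjective _ z
  exact ⟨x, hx, rfl⟩

lemma qmk_eq_zero {A B : Ideal R} {x : R} (hx : x ∈ A) : qmk A B x hx = 0 ↔ x ∈ B := by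
  rw [qmk, Submodule.Quotient.mk_eq_zero]
  rfl

lemma smul_qmk {A B : Ideal R} {x : R} (hx : x ∈ A) (r : R) :
    r • qmk A B x hx = qmk A B (r * x) (A.mul_mem_left r hx) := rfl

lemma qmk_sub {A B : Ideal R} {x y : R} (hx : x ∈ A) (hy : y ∈ A) :
    qmk A B x hx - qmk A B y hy = qmk A B (x - y) (sub_mem hx hy) := rfl

/-- multiplication by `y` -/
def qmul (A B A' B' : Ideal R) (y : R) (h1 : ∀ x ∈ A, y * x ∈ A') (h2 : ∀ x ∈ B, y * x ∈ B') :
    Q A B →ₗ[R] Q A' B' :=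
  Submodule.mapQ _ _ (LinearMap.restrict (LinearMap.lsmul R R y) h1) (fun x hx => h2 _ hx)

lemma qmul_qmk {A B A' B' : Ideal R} {y : R} (h1 : ∀ x ∈ A, y * x ∈ A')
    (h2 : ∀ x ∈ B, y * x ∈ B') {x : R} (hx : x ∈ A) :
    qmul A B A' B' y h1 h2 (qmk A B x hx) = qmk A' B' (y * x) (h1 x hx) := rfl

lemma qmul_smul_comm {A B A' B' : Ideal R} {y z : R} (h1 : ∀ x ∈ A, y * x ∈ A')
    (h2 : ∀ x ∈ B, y * x ∈ B') (h1' : ∀ x ∈ A, z * x ∈ A')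
    (h2' : ∀ x ∈ B, z * x ∈ B') :
    z • qmul A B A' B' y h1 h2 = y • qmul A B A' B' z h1' h2' := by
  refine LinearMap.ext fun w => ?_
  obtain ⟨x, hx, rfl⟩ := qmk_surj w
  simp only [LinearMap.smul_apply, qmul_qmk, smul_qmk]
  congr 1
  ring

/-- connecting sequence -/
lemma connect [IsLocalRing R] [IsNoetherianRing R] {d : ℕ} (hd : IsCM R d)
    {A B C : Type u} [AddCommGroup A] [Module R A] [AddCommGroup B] [Module R B]
    [AddCommGroup C] [Module R C] [Module.Finite R A] [Module.Finite R B] [Module.Finite R C]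
    (f : A →ₗ[R] B) (g : B →ₗ[R] C) (hg : Function.Surjective g) (hfg : Function.Exact f g)
    (hf : ∀ z : A, f z = 0 → ∀ p : Ideal R, p.IsPrime → p ≠ maximalIdeal R → ∃ s, s ∉ p ∧ s • z = 0)
    (q : ℕ) (hq : q < d) : ∃ δ : E R A R q →ₗ[R] E R C R (q + 1),
      (∀ x, δ x = 0 → ∃ y, pull R f q y = x) ∧ (∀ y, δ (pull R f q y) = 0) ∧
      (∀ x, pull R g (q + 1) x = 0 → ∃ y, δ y = x) := by
  have s1 : SES (LinearMap.ker f).subtype f.rangeRestrict :=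
    ⟨Subtype.val_injective, by
      rw [LinearMap.exact_iff, LinearMap.ker_rangeRestrict, Submodule.range_subtype],
      LinearMap.surjective_rangeRestrict f⟩
  have s2 : SES (LinearMap.range f).subtype g :=
    ⟨Subtype.val_injective, by
      rw [LinearMap.exact_iff, Submodule.range_subtype]
      exact LinearMap.exact_iff.1 hfg, hg⟩
  have hz : ∀ i < d, Subsingleton (E R (LinearMap.ker f) R i) := by
    intro i hi
    refine ext_vanish_torsion hd _ ?_ i hi
    rintro ⟨z, hz⟩ p hp hpm
    obtain ⟨s, hs, h⟩ := hf z hz p hp hpm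
    exact ⟨s, hs, Subtype.ext h⟩
  have b1 : Function.Injective (pull R f.rangeRestrict q) :=
    s1.inj_of_prev R q fun m hm => hz m (by omega)
  have b2 : Function.Surjective (pull R f.rangeRestrict q) :=
    s1.surj_of_next R q (hz q hq)
  let e := LinearEquiv.ofBijective _ ⟨b1, b2⟩
  have hpull : ∀ y, e (pull R (LinearMap.range f).subtype q y) = pull R f q y := by
    intro y
    change pull R f.rangeRestrict q (pull R (LinearMap.range f).subtype q y) = _
    rw [← pull_comp]
    rfl
  refine ⟨s2.δ R q ∘ₗ e.symm.toLinearMap, ?_, ?_, ?_⟩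
  · intro x hx
    obtain ⟨y, hy⟩ := s2.exA R q (e.symm x) hx
    refine ⟨y, ?_⟩
    rw [← hpull, hy, e.apply_symm_apply]
  · intro y
    simp only [LinearMap.comp_apply, LinearEquiv.coe_coe]
    rw [← hpull, e.symm_apply_apply]; exact s2.δ_pull R q y
  · intro x hx
    obtain ⟨y, hy⟩ := s2.exC R q x hx
    exact ⟨e y, by simpa using hy⟩

end C2
end LT

set_option linter.unusedSectionVars false
set_option linter.unusedVariables false
namespace LT

open RingTheory.Sequence CategoryTheory IsLocalRing
open scoped Pointwise

/-- hypotheses of the core theorem -/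
structure Hyp {R : Type u} [CommRing R] [IsLocalRing R] (d g n : ℕ) (I : Ideal R) (a : ℕ → R) :
    Prop where
  cm : IsCM R d
  g1 : 1 ≤ g
  htI : HtGe I g
  aI : ∀ k, a k ∈ I
  htK : ∀ i ≤ n, HtGe (K a I i) i
  htIK : ∀ i < n, HtGe (I ⊔ K a I i) (i + 1)
  htn : HtGe (K a I n) (n + 1)
  ext : ∀ j, 1 ≤ j → j + g ≤ n → j + g + 1 ≤ d → Subsingleton (E R ↥(I ^ j) R (g + j - 1))

/-- local conclusions on the punctured spectrum -/
structure Loc {R : Type u} [CommRing R] [IsLocalRing R] (n : ℕ) (I : Ideal R) (a : ℕ → R) :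
    Prop where
  l1 : ∀ p : Ideal R, p.IsPrime → p ≠ maximalIdeal R → ∀ i < n, ∀ x ∈ I, a i * x ∈ J a i →
    ∃ s, s ∉ p ∧ s * x ∈ J a i
  l2 : ∀ p : Ideal R, p.IsPrime → p ≠ maximalIdeal R → ∀ x ∈ I, ∃ s, s ∉ p ∧ s * x ∈ J a n

section C3
variable {R : Type u} [CommRing R] [IsLocalRing R] [IsNoetherianRing R] {d g n : ℕ} {I : Ideal R}
  {a : ℕ → R}

lemma Hyp.htJ (h : Hyp d g n I a) (i : ℕ) (hi : i ≤ g) (hn : i ≤ n) : HtGe (J a i) i := by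
  intro p hp hJp
  have : K a I i * I ≤ p := by
    rw [Ideal.mul_le]
    intro r hr y hy
    exact hJp (hr y hy)
  rcases hp.mul_le.1 this with h1 | h1
  · exact h.htK i hn p hp h1
  · exact h.htI.of_le hi p hp h1

lemma Hyp.J_colon (h : Hyp d g n I a) {i : ℕ} (hi : i < g) (hn : i < n) {r : R}
    (hr : a i * r ∈ J a i) : r ∈ J a i := by
  refine regJ h.cm a i (fun j hj => h.htJ j (by omega) (by omega)) (J a (i + 1))
    (h.htJ (i + 1) hi hn) r ?_
  intro y hy
  obtain ⟨y, hy', t, rfl⟩ := mem_J_succ.1 hy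
  have : r * (a i * t + y) = t * (a i * r) + r * y := by ring
  rw [this]
  exact add_mem (Ideal.mul_mem_left _ _ hr) (Ideal.mul_mem_left _ _ hy')

lemma Hyp.K_eq (h : Hyp d g n I a) {i : ℕ} (hi : i < g) (hn : i ≤ n) : K a I i ≤ J a i := by
  intro r hr
  exact regJ h.cm a i (fun j hj => h.htJ j (by omega) (by omega)) I
    (h.htI.of_le (by omega)) r hr

/-- the modules `T(i,k)` -/
abbrev T (g : ℕ) (I : Ideal R) (a : ℕ → R) (i k : ℕ) : Type u :=
  Q (I ^ (k + 1 - g)) (J a i * I ^ (k - g))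

lemma pow_aux {y x : R} (hy : y ∈ I) (k : ℕ) (hx : x ∈ I ^ (k - g)) : y * x ∈ I ^ (k + 1 - g) := by
  rcases Nat.lt_or_ge k g with h | h
  · have : k + 1 - g = 0 := by omega
    rw [this]; simp
  · have : k + 1 - g = (k - g) + 1 := by omega
    rw [this, pow_succ']
    exact Ideal.mul_mem_mul hy hx

lemma pow_aux2 {y x : R} (hy : y ∈ I) (i k : ℕ) (hx : x ∈ J a i * I ^ (k - g)) :
    y * x ∈ J a i * I ^ (k + 1 - g) := by
  have h1 : y * x ∈ Ideal.span {y} * (J a i * I ^ (k - g)) :=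
    Ideal.mul_mem_mul (Ideal.mem_span_singleton_self y) hx
  rw [mul_left_comm] at h1
  refine Ideal.mul_mono_right ?_ h1
  rw [Ideal.mul_le]
  intro r hr s hs
  obtain ⟨t, rfl⟩ := Ideal.mem_span_singleton.1 hr
  rw [mul_assoc]
  exact pow_aux hy k (Ideal.mul_mem_left _ _ hs)

/-- multiplication by an element of `I` -/
def tmap (g : ℕ) (a : ℕ → R) (i k : ℕ) {y : R} (hy : y ∈ I) : T g I a i k →ₗ[R] T g I a i (k + 1) :=
  qmul _ _ _ _ y (fun x hx => pow_aux hy (k + 1) hx) (fun x hx => pow_aux2 hy i k hx)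

/-- projection -/
def tproj (g : ℕ) (I : Ideal R) (a : ℕ → R) (i k : ℕ) : T g I a i k →ₗ[R] T g I a (i + 1) k :=
  qmul _ _ _ _ 1 (fun x hx => by simpa using hx)
    (fun x hx => by simpa using Ideal.mul_mono_left (J_mono a (Nat.le_succ i)) hx)

lemma tproj_surj (i k : ℕ) : Function.Surjective (tproj g I a i k) := by
  intro z
  obtain ⟨x, hx, rfl⟩ := qmk_surj z
  refine ⟨qmk _ _ x hx, ?_⟩
  rw [tproj, qmul_qmk]
  simp

lemma t_exact (h : ∀ k, a k ∈ I) (i k : ℕ) :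
    Function.Exact (tmap g a i k (h i)) (tproj g I a i (k + 1)) := by
  intro z
  obtain ⟨x, hx, rfl⟩ := qmk_surj z
  rw [tproj, qmul_qmk, qmk_eq_zero, one_mul, J_succ, Ideal.sup_mul, Submodule.mem_sup]
  constructor
  · rintro ⟨w, hw, y, hy, rfl⟩
    obtain ⟨y, hy', rfl⟩ := Ideal.mem_span_singleton_mul.1 hy
    refine ⟨qmk _ _ y hy', ?_⟩
    rw [tmap, qmul_qmk, ← sub_eq_zero, qmk_sub, qmk_eq_zero]
    have : a i * y - (w + a i * y) = -w := by ring
    rw [this]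
    exact neg_mem hw
  · rintro ⟨z, hz⟩
    obtain ⟨y, hy, rfl⟩ := qmk_surj z
    rw [tmap, qmul_qmk, ← sub_eq_zero, qmk_sub, qmk_eq_zero] at hz
    exact ⟨_, neg_mem hz, a i * y, Ideal.mem_span_singleton_mul.2 ⟨y, hy, rfl⟩, by ring⟩

lemma t_ker (h : Hyp d g n I a) (hL : Loc n I a) {i k : ℕ} (hi : i < n) (hik : i ≤ k)
    (z : T g I a i k) (hz : tmap g a i k (h.aI i) z = 0) (p : Ideal R) (hp : p.IsPrime)
    (hpm : p ≠ maximalIdeal R) : ∃ s, s ∉ p ∧ s • z = 0 := by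
  obtain ⟨x, hx, rfl⟩ := qmk_surj z
  rw [tmap, qmul_qmk, qmk_eq_zero] at hz
  rcases Nat.lt_or_ge k g with hk | hk
  · refine ⟨1, fun h1 => hp.ne_top ((Ideal.eq_top_iff_one _).2 h1), ?_⟩
    rw [one_smul, qmk_eq_zero]
    have e : k - g = 0 := by omega
    rw [e, pow_zero, Ideal.one_eq_top, Ideal.mul_top]
    exact h.J_colon (by omega) hi (Ideal.mul_le_left hz)
  · obtain ⟨c, rfl⟩ := Nat.exists_eq_add_of_le hk
    have e1 : g + c + 1 - g = c + 1 := by omega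
    have hx' : x ∈ I ^ (c + 1) := e1 ▸ hx
    have hxI : x ∈ I := Ideal.pow_le_self (by omega) hx'
    obtain ⟨s, hs, hsx⟩ := hL.l1 p hp hpm i hi x hxI (Ideal.mul_le_left hz)
    have hd := dseq p.primeCompl I a n h.aI
      (fun i hi x hx hax => hL.l1 p hp hpm i hi x hx hax)
      (fun x hx => hL.l2 p hp hpm x hx) (n - i) i (by omega) c (s * x) hsx
      (Ideal.mul_mem_left _ _ hx')
    obtain ⟨t, ht, htx⟩ := hd
    refine ⟨t * s, p.primeCompl.mul_mem ht hs, ?_⟩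
    rw [smul_qmk, qmk_eq_zero, mul_assoc]
    have e2 : g + c - g = c := by omega
    rw [e2]
    exact htx

lemma exists_delta (h : Hyp d g n I a) (hL : Loc n I a) {i k : ℕ} (hi : i < n) (hik : i ≤ k)
    (q : ℕ) (hq : q < d) : ∃ δ : E R (T g I a i k) R q →ₗ[R] E R (T g I a (i + 1) (k + 1)) R (q + 1),
      (∀ x, δ x = 0 → ∃ y, pull R (tmap g a i k (h.aI i)) q y = x) ∧
      (∀ y, δ (pull R (tmap g a i k (h.aI i)) q y) = 0) ∧
      (∀ x, pull R (tproj g I a i (k + 1)) (q + 1) x = 0 → ∃ y, δ y = x) :=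
  connect h.cm _ _ (tproj_surj i (k + 1)) (t_exact h.aI i k) (t_ker h hL hi hik) q hq

/-- `T(0,k)` is a power of `I` -/
def T0equiv (k : ℕ) : T g I a 0 k ≃ₗ[R] ↥(I ^ (k + 1 - g)) :=
  Submodule.quotEquivOfEqBot _ (by
    rw [J_zero, Ideal.bot_mul, eq_bot_iff]
    rintro ⟨x, hx⟩ h
    exact Subtype.ext h)

lemma star (h : Hyp d g n I a) (hL : Loc n I a) (i : ℕ) : ∀ k, i < k → k + 1 ≤ n → k + 2 ≤ d →
    Subsingleton (E R (T g I a i k) R k) := by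
  induction i with
  | zero =>
    intro k hk hkn hkd
    suffices Subsingleton (E R ↥(I ^ (k + 1 - g)) R k) from
      subsingleton_E_of_equiv R (T0equiv k).symm k
    rcases Nat.lt_or_ge k g with hkg | hkg
    · have e : k + 1 - g = 0 := by omega
      rw [e]
      have : Subsingleton (E R R R k) := subsingleton_E_ring R k (by omega)
      have e' : I ^ 0 = (⊤ : Ideal R) := by simp
      rw [e']
      exact subsingleton_E_of_equiv R (Submodule.topEquiv (R := R) (M := R)).symm k
    · have := h.ext (k + 1 - g) (by omega) (by omega) (by omega)
      have e : g + (k + 1 - g) - 1 = k := by omega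
      rwa [e] at this
  | succ i ih =>
    intro k hk hkn hkd
    obtain ⟨q, rfl⟩ : ∃ q, k = q + 1 := ⟨k - 1, by omega⟩
    obtain ⟨δ, h1, h2, h3⟩ := exists_delta h hL (i := i) (k := q) (by omega) (by omega) q (by omega)
    have s1 := ih q (by omega) (by omega) (by omega)
    have s2 := ih (q + 1) (by omega) hkn hkd
    have hz : ∀ x : E R (T g I a (i + 1) (q + 1)) R (q + 1), x = 0 := by
      intro x
      obtain ⟨y, rfl⟩ := h3 x (Subsingleton.elim _ _)
      rw [Subsingleton.elim y 0, map_zero]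
    exact ⟨fun x y => by rw [hz x, hz y]⟩

/-- `K_i` kills `T(i,i)` -/
lemma K_kill (h : Hyp d g n I a) (i : ℕ) (hi : i ≤ n) (r : R) (hr : r ∈ K a I i)
    (z : T g I a i i) : r • z = 0 := by
  obtain ⟨x, hx, rfl⟩ := qmk_surj z
  rw [smul_qmk, qmk_eq_zero]
  rcases Nat.lt_or_ge i g with hk | hk
  · have e : i - g = 0 := by omega
    rw [e, pow_zero, Ideal.one_eq_top, Ideal.mul_top]
    exact Ideal.mul_mem_right _ _ (h.K_eq hk hi hr)
  · have e : i + 1 - g = (i - g) + 1 := by omega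
    rw [e, pow_succ'] at hx
    have h1 : r * x ∈ Ideal.span {r} * (I * I ^ (i - g)) :=
      Ideal.mul_mem_mul (Ideal.mem_span_singleton_self r) hx
    rw [← mul_assoc] at h1
    refine Ideal.mul_mono_left ?_ h1
    rw [Ideal.mul_le]
    intro u hu s hs
    obtain ⟨t, rfl⟩ := Ideal.mem_span_singleton.1 hu
    rw [mul_assoc]
    exact hr _ (Ideal.mul_mem_left _ _ hs)

lemma kill_ext {M : Type u} [AddCommGroup M] [Module R M] (r : R) (h : ∀ z : M, r • z = 0) (q : ℕ)
    (e : E R M R q) : r • e = 0 := by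
  have h1 : r • (LinearMap.id : M →ₗ[R] M) = 0 := LinearMap.ext fun z => h z
  have h2 := pull_smul R r (LinearMap.id : M →ₗ[R] M) q e
  rw [h1, pull_zero, pull_id] at h2
  exact h2.symm

/-- existence of the canonical generator -/
def PP (g : ℕ) (I : Ideal R) (a : ℕ → R) (i : ℕ) : Prop :=
  ∃ φ : E R (T g I a i i) R i, (∀ e, ∃ r : R, e = r • φ) ∧ ∀ r : R, r • φ = 0 ↔ r ∈ K a I i

/-- sections supported at the closed point vanish -/
def HH (I : Ideal R) (a : ℕ → R) (i : ℕ) : Prop :=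
  ∀ x ∈ I, (∀ p : Ideal R, p.IsPrime → p ≠ maximalIdeal R → ∃ s, s ∉ p ∧ s * x ∈ J a i) → x ∈ J a i

lemma PP_zero (h : Hyp d g n I a) : PP g I a 0 := by
  have hg := h.g1
  have hK : K a I 0 = ⊥ := by
    rw [eq_bot_iff, ← J_zero a]; exact h.K_eq (by omega) (by omega)
  have e1 : I ^ (0 + 1 - g) = ⊤ := by
    have : 0 + 1 - g = 0 := by omega
    rw [this]; simp
  let e : T g I a 0 0 ≃ₗ[R] R :=
    (T0equiv 0).trans ((LinearEquiv.ofEq _ _ e1).trans Submodule.topEquiv)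
  let φ : T g I a 0 0 →ₗ[R] R := e.toLinearMap
  refine ⟨Abelian.Ext.mk₀ (ModuleCat.ofHom φ), ?_, ?_⟩
  · intro x
    obtain ⟨ψ, rfl⟩ := mk0_surj R x
    refine ⟨ψ (e.symm 1), ?_⟩
    rw [← Abelian.Ext.mk₀_smul]
    congr 1
    have : ψ = ψ (e.symm 1) • φ := by
      refine LinearMap.ext fun z => ?_
      obtain ⟨r, rfl⟩ := e.symm.surjective z
      have : e.symm r = r • e.symm 1 := by rw [← map_smul, smul_eq_mul, mul_one]
      rw [this, map_smul, LinearMap.smul_apply, map_smul]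
      simp [φ, mul_comm]
    conv_lhs => rw [this]
    rfl
  · intro r
    rw [hK, Ideal.mem_bot]
    constructor
    · intro hr
      rw [← Abelian.Ext.mk₀_smul] at hr
      have h2 := (Abelian.Ext.mk₀_bijective (ModuleCat.of R (T g I a 0 0)) (ModuleCat.of R R)).1
        (hr.trans (Abelian.Ext.mk₀_zero _ _).symm)
      have h3 : r • φ = 0 := congrArg ModuleCat.Hom.hom h2
      have h4 := LinearMap.congr_fun h3 (e.symm 1)
      simpa [φ] using h4
    · rintro rfl; simp

lemma inf_of_HH (h : Hyp d g n I a) (hL : Loc n I a) {i : ℕ} (hi : i < n) (hH : HH I a i) {x : R}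
    (hx : x ∈ I) (hxK : x ∈ K a I i) : x ∈ J a i :=
  hH x hx fun p hp hpm => hL.l1 p hp hpm i hi x hx (by rw [mul_comm]; exact hxK _ (h.aI i))

lemma colon_of_HH (h : Hyp d g n I a) (hL : Loc n I a) {i : ℕ} (hi : i < n) (hH : HH I a i) {x : R}
    (hx : a i * x ∈ J a i) : x ∈ K a I i := by
  intro y hy
  have hxy : x * y ∈ I := Ideal.mul_mem_left _ _ hy
  refine hH _ hxy fun p hp hpm => hL.l1 p hp hpm i hi _ hxy ?_
  rw [← mul_assoc]
  exact Ideal.mul_mem_right _ _ hx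

lemma PP_succ (h : Hyp d g n I a) (hL : Loc n I a) {i : ℕ} (hi : i + 2 ≤ n) (hd : i + 3 ≤ d)
    (hH : HH I a i) (hP : PP g I a i) : PP g I a (i + 1) := by
  obtain ⟨φ, h1, h2⟩ := hP
  obtain ⟨δ, d1, d2, d3⟩ := exists_delta h hL (i := i) (k := i) (by omega) le_rfl i (by omega)
  have s := star h hL i (i + 1) (by omega) (by omega) (by omega)
  refine ⟨δ φ, ?_, ?_⟩
  · intro e
    obtain ⟨y, rfl⟩ := d3 e (Subsingleton.elim _ _)
    obtain ⟨r, rfl⟩ := h1 y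
    exact ⟨r, map_smul _ _ _⟩
  · intro r
    constructor
    · intro hr
      rw [← map_smul] at hr
      obtain ⟨f, hf⟩ := d1 _ hr
      intro y hy
      obtain ⟨s, hs⟩ := h1 (pull R (tmap g a i i hy) i f)
      have e1 : a i • tmap g a i i hy = y • tmap g a i i (h.aI i) := qmul_smul_comm _ _ _ _
      have e2 := pull_smul R (a i) (tmap g a i i hy) i f
      rw [e1, pull_smul, hf, hs, smul_smul, smul_smul, ← sub_eq_zero, ← sub_smul, h2] at e2
      have hI : y * r - a i * s ∈ I :=
        sub_mem (Ideal.mul_mem_right _ _ hy) (Ideal.mul_mem_right _ _ (h.aI i))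
      exact mem_J_succ.2 ⟨_, inf_of_HH h hL (by omega) hH hI e2, s, by ring⟩
    · intro hr
      exact kill_ext r (K_kill h (i + 1) (by omega) r hr) _ _

lemma exists_uv (h : Hyp d g n I a) {i : ℕ} (hi : i ≤ n) (hd : i + 2 ≤ d) (hP : PP g I a i) :
    ∃ u ∈ maximalIdeal R, ∃ v ∈ maximalIdeal R, (∀ r, u * r ∈ K a I i → r ∈ K a I i) ∧
      ∀ r s, v * r - u * s ∈ K a I i → ∃ t, r - u * t ∈ K a I i := by
  obtain ⟨φ, h1, h2⟩ := hP
  obtain ⟨rs, hl, hrs, hreg⟩ := exists_regular_extend h.cm [] (by simp) (by simp)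
    (K a I i ⊓ maximalIdeal R) inf_le_right i (by
      simpa using HtGe.inf_max h.cm (h.htK i hi) (by omega))
  rw [List.nil_append] at hreg
  obtain ⟨ts, hl2, hts, hreg2⟩ := exists_regular_extend h.cm rs (fun r hr => (hrs r hr).2) hreg
    (maximalIdeal R) le_rfl 2 (by
      intro p hp hmp
      have := Ideal.height_mono hmp
      rw [h.cm.height_max] at this
      refine le_trans ?_ this
      rw [hl]
      exact_mod_cast hd)
  obtain ⟨u, v, rfl⟩ := List.length_eq_two.1 hl2
  have key := ext_two_regular (T g I a i i) rs u v (by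
      intro r hr
      rcases List.mem_append.1 hr with hr | hr
      · exact (hrs r hr).2
      · exact hts r hr) (fun r hr z => K_kill h i hi r (hrs r hr).1 z) hreg2
  rw [hl] at key
  refine ⟨u, hts u (by simp), v, hts v (by simp), ?_, ?_⟩
  · intro r hr
    rw [← h2] at hr ⊢
    exact key.1 _ (by rw [smul_smul, hr])
  · intro r s hrs
    rw [← h2, sub_smul, sub_eq_zero, mul_smul, mul_smul] at hrs
    obtain ⟨e, he⟩ := key.2 _ _ hrs
    obtain ⟨t, rfl⟩ := h1 e
    refine ⟨t, ?_⟩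
    rw [← h2, sub_smul, sub_eq_zero, he, smul_smul]

lemma HH_zero (h : Hyp d g n I a) (hd : 1 ≤ d) : HH I a 0 := by
  intro x hx hp
  by_contra hne
  have hx0 : x ≠ 0 := by rintro rfl; simp at hne
  obtain ⟨p, hpa, hxp⟩ := exists_le_isAssociatedPrime_of_isNoetherianRing R x hx0
  obtain ⟨-, rs, hl, hm, hreg⟩ := h.cm
  have hh := ass_height rs hm hreg p hpa
  have hpm : p ≠ maximalIdeal R := by
    rintro rfl
    rw [h.cm.height_max, hl] at hh
    have : d + d ≤ d := by exact_mod_cast hh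
    omega
  obtain ⟨s, hs, hsx⟩ := hp p hpa.1 hpm
  refine hs (hxp ?_)
  rw [Submodule.mem_colon_singleton]
  simpa using hsx

lemma HH_succ (h : Hyp d g n I a) (hL : Loc n I a) {i : ℕ} (hi : i + 1 ≤ n) (hd : i + 2 ≤ d)
    (hH : HH I a i) (hP : PP g I a i) : HH I a (i + 1) := by
  obtain ⟨u, hu, v, hv, huv1, huv2⟩ := exists_uv h (by omega) hd hP
  -- socle case
  have soc : ∀ x ∈ I, (∀ r ∈ maximalIdeal R, r * x ∈ J a (i + 1)) → x ∈ J a (i + 1) := by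
    intro x hx hxm
    obtain ⟨j1, hj1, r, hr⟩ := mem_J_succ.1 (hxm u hu)
    obtain ⟨j2, hj2, s, hs⟩ := mem_J_succ.1 (hxm v hv)
    have hw : v * r - u * s ∈ K a I i := by
      refine colon_of_HH h hL (by omega) hH ?_
      have : a i * (v * r - u * s) = u * j2 - v * j1 := by
        have e1 : a i * r = u * x - j1 := by rw [hr]; ring
        have e2 : a i * s = v * x - j2 := by rw [hs]; ring
        calc a i * (v * r - u * s) = v * (a i * r) - u * (a i * s) := by ring
          _ = _ := by rw [e1, e2]; ring
      rw [this]
      exact sub_mem (Ideal.mul_mem_left _ _ hj2) (Ideal.mul_mem_left _ _ hj1)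
    obtain ⟨t, ht⟩ := huv2 r s hw
    have h3 : x - a i * t ∈ K a I i := by
      apply huv1
      have : u * (x - a i * t) = (r - u * t) * a i + j1 := by
        rw [mul_sub, hr]; ring
      rw [this]
      exact J_le_K _ _ _ (add_mem (ht _ (h.aI i)) hj1)
    have h4 := inf_of_HH h hL (by omega) hH
      (sub_mem hx (Ideal.mul_mem_right _ _ (h.aI i))) h3
    exact mem_J_succ.2 ⟨_, h4, t, by ring⟩
  intro x hx hxp
  by_contra hne
  let z : Submodule.span R {(Submodule.Quotient.mk x : R ⧸ J a (i + 1))} :=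
    ⟨_, Submodule.mem_span_singleton_self _⟩
  have hz : z ≠ 0 := by
    intro h0
    have := congrArg Subtype.val h0
    exact hne ((Submodule.Quotient.mk_eq_zero _).1 this)
  obtain ⟨p, hpa, -⟩ := exists_le_isAssociatedPrime_of_isNoetherianRing R z hz
  have hpp := hpa.1
  obtain ⟨w, hw⟩ := (isAssociatedPrime_iff.1 hpa).2
  obtain ⟨c, hc⟩ := Submodule.mem_span_singleton.1 w.2
  have hpiff : ∀ r, r ∈ p ↔ r * (c * x) ∈ J a (i + 1) := by
    intro r
    rw [hw, Submodule.mem_colon_singleton, Submodule.mem_bot, ← Subtype.coe_inj,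
      Submodule.coe_smul, ← hc, ← Submodule.Quotient.mk_smul, ← Submodule.Quotient.mk_smul]
    exact Submodule.Quotient.mk_eq_zero _
  have hpm : p = maximalIdeal R := by
    by_contra hpm
    obtain ⟨s, hs, hsx⟩ := hxp p hpp hpm
    apply hs
    rw [hpiff, mul_left_comm]
    exact Ideal.mul_mem_left _ _ hsx
  have := soc (c * x) (Ideal.mul_mem_left _ _ hx) (fun r hr => by
    rw [← hpiff, hpm]; exact hr)
  apply hpp.ne_top
  rw [Ideal.eq_top_iff_one, hpiff, one_mul]
  exact this

lemma HH_all (h : Hyp d g n I a) (hL : Loc n I a) (i : ℕ) :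
    (i ≤ n → i + 1 ≤ d → HH I a i) ∧ (i + 1 ≤ n → i + 2 ≤ d → PP g I a i) := by
  induction i with
  | zero => exact ⟨fun _ hd => HH_zero h (by omega), fun _ _ => PP_zero h⟩
  | succ i ih =>
    exact ⟨fun hn hd => HH_succ h hL hn hd (ih.1 (by omega) (by omega)) (ih.2 hn hd),
      fun hn hd => PP_succ h hL hn hd (ih.1 (by omega) (by omega)) (ih.2 (by omega) (by omega))⟩

/-- conclusion of the core theorem -/
def Concl (n : ℕ) (I : Ideal R) (a : ℕ → R) : Prop :=
  J a n = I ∧ ∀ i < n, ∀ x ∈ I, a i * x ∈ J a i → x ∈ J a i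

lemma HtGe.eq_top {k : ℕ} (hcm : IsCM R d) {P : Ideal R} (h : HtGe P k) (hk : d < k) : P = ⊤ := by
  by_contra hP
  have := h (maximalIdeal R) inferInstance (le_maximalIdeal hP)
  rw [hcm.height_max] at this
  have : k ≤ d := by exact_mod_cast this
  omega

lemma concl_of_loc (h : Hyp d g n I a) (hL : Loc n I a) : Concl n I a := by
  have htop : ∀ i, K a I i = ⊤ → I ≤ J a i := by
    intro i hi x hx
    have : (1 : R) ∈ K a I i := by rw [hi]; trivial
    simpa using this x hx
  constructor
  · refine le_antisymm (J_le h.aI n) ?_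
    rcases Nat.lt_or_ge n d with hn | hn
    · intro x hx
      exact (HH_all h hL n).1 le_rfl hn x hx fun p hp hpm => hL.l2 p hp hpm x hx
    · exact htop n (h.htn.eq_top h.cm (by omega))
  · intro i hi x hx hax
    rcases Nat.lt_or_ge i d with hid | hid
    · exact (HH_all h hL i).1 hi.le hid x hx fun p hp hpm => hL.l1 p hp hpm i hi x hx hax
    · rcases Nat.lt_or_ge d i with hdi | hdi
      · exact htop i ((h.htK i hi.le).eq_top h.cm hdi) hx
      · obtain rfl : i = d := le_antisymm hdi hid
        have h1 := (h.htIK i hi).eq_top h.cm (by omega)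
        by_cases hK : K a I i = ⊤
        · exact htop i hK hx
        have hI : I = ⊤ := by
          by_contra hI
          have := sup_le (le_maximalIdeal hI) (le_maximalIdeal hK)
          rw [h1] at this
          exact (IsLocalRing.maximalIdeal.isMaximal R).ne_top (top_le_iff.1 this)
        have h2 := htop (i + 1) ((h.htK (i + 1) hi).eq_top h.cm (by omega))
        rw [hI] at h2
        by_cases hJ : J a i = ⊤
        · rw [hJ]; trivial
        have hu : IsUnit (a i) := by
          by_contra hu
          have h3 : J a (i + 1) ≤ maximalIdeal R := by
            rw [J_succ]
            refine sup_le (le_maximalIdeal hJ) ?_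
            rw [Ideal.span_singleton_le_iff_mem]
            exact hu
          exact (IsLocalRing.maximalIdeal.isMaximal R).ne_top (top_le_iff.1 (h2.trans h3))
        exact (Ideal.unit_mul_mem_iff_mem _ hu).1 hax

end C3
end LT

set_option linter.unusedSectionVars false
set_option linter.unusedVariables false
namespace LT

open RingTheory.Sequence CategoryTheory IsLocalRing
open scoped Pointwise

lemma J_map {R S : Type u} [CommRing R] [CommRing S] (f : R →+* S) (a : ℕ → R) (i : ℕ) :
    (J a i).map f = J (f ∘ a) i := by
  rw [J, J, Ideal.map_span, ← Set.image_comp]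

lemma K_map_le {R S : Type u} [CommRing R] [CommRing S] (f : R →+* S) (a : ℕ → R) (I : Ideal R)
    (i : ℕ) : (K a I i).map f ≤ K (f ∘ a) (I.map f) i := by
  rw [Ideal.map_le_iff_le_comap]
  intro r hr
  change ∀ y ∈ I.map f, f r * y ∈ J (f ∘ a) i
  intro y hy
  have h1 : f r * y ∈ Ideal.map f (Ideal.span {r} * I) := by
    rw [Ideal.map_mul]
    exact Ideal.mul_mem_mul (Ideal.mem_map_of_mem _ (Ideal.mem_span_singleton_self r)) hy
  rw [← J_map]
  refine Ideal.map_mono ?_ h1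
  rw [Ideal.mul_le]
  intro u hu s hs
  obtain ⟨t, rfl⟩ := Ideal.mem_span_singleton.1 hu
  rw [mul_assoc]
  exact hr _ (Ideal.mul_mem_left _ _ hs)

lemma HtGe.localize {R : Type u} [CommRing R] {P : Ideal R} {k : ℕ} (h : HtGe P k) (p : Ideal R)
    [p.IsPrime] : HtGe (P.map (algebraMap R (Localization.AtPrime p))) k := by
  intro q hq hPq
  have h1 := h (q.comap (algebraMap R (Localization.AtPrime p))) inferInstance
    (Ideal.map_le_iff_le_comap.1 hPq)
  have h2 := IsLocalization.height_under p.primeCompl q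
  rw [Ideal.under_def] at h2
  rwa [← h2]

theorem core (d : ℕ) : ∀ (R : Type u) [CommRing R] [IsLocalRing R] [IsNoetherianRing R] (g n : ℕ)
    (I : Ideal R) (a : ℕ → R), Hyp d g n I a → Concl n I a := by
  induction d using Nat.strong_induction_on with
  | _ d ih =>
  intro R _ _ _ g n I a h
  have key : ∀ p : Ideal R, ∀ hp : p.IsPrime, p ≠ maximalIdeal R →
      Concl n (I.map (algebraMap R (Localization.AtPrime p)))
        (algebraMap R (Localization.AtPrime p) ∘ a) := by
    intro p hp hpm
    obtain ⟨e, he, hcm⟩ := localize_CM h.cm p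
    have hed : e < d := by
      have h1 : p < maximalIdeal R := lt_of_le_of_ne (le_maximalIdeal hp.ne_top) hpm
      have h2 := Ideal.height_add_one_le_of_lt_of_isPrime h1
      rw [he, h.cm.height_max] at h2
      exact_mod_cast h2
    refine ih e hed _ g n _ _ ⟨hcm, h.g1, h.htI.localize p,
      fun k => Ideal.mem_map_of_mem _ (h.aI k),
      fun i hi => ((h.htK i hi).localize p).mono (K_map_le _ _ _ _), fun i hi => ?_,
      (h.htn.localize p).mono (K_map_le _ _ _ _), fun j hj hjn hjd => ?_⟩
    · refine ((h.htIK i hi).localize p).mono ?_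
      rw [Ideal.map_sup]
      exact sup_le_sup le_rfl (K_map_le _ _ _ _)
    · have := h.ext j hj hjn (by omega)
      obtain ⟨k, hk⟩ : ∃ k, g + j - 1 = k + 1 := ⟨g + j - 2, by have := h.g1; omega⟩
      rw [hk] at this ⊢
      rw [← Ideal.map_pow]
      exact ext_ideal_baseChange _ _ k this
  have back : ∀ p : Ideal R, ∀ hp : p.IsPrime, ∀ i x,
      algebraMap R (Localization.AtPrime p) x ∈ J (algebraMap R (Localization.AtPrime p) ∘ a) i →
      ∃ s, s ∉ p ∧ s * x ∈ J a i := by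
    intro p hp i x hx
    rw [← J_map, IsLocalization.algebraMap_mem_map_algebraMap_iff p.primeCompl] at hx
    obtain ⟨s, hs, h⟩ := hx
    exact ⟨s, hs, h⟩
  refine concl_of_loc h ⟨fun p hp hpm i hi x hx hax => ?_, fun p hp hpm x hx => ?_⟩
  · refine back p hp i x ((key p hp hpm).2 i hi _ (Ideal.mem_map_of_mem _ hx) ?_)
    rw [Function.comp_apply, ← map_mul, ← J_map]
    exact Ideal.mem_map_of_mem _ hax
  · refine back p hp n x ?_
    rw [(key p hp hpm).1]
    exact Ideal.mem_map_of_mem _ hx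

end LT

set_option linter.unusedSectionVars false
set_option linter.unusedVariables false
namespace LT

open IsLocalRing

section G1
variable {S : Type u} [CommRing S] {A : Type u} [CommRing A] [Algebra S A] {I : Ideal S}

/-- graph of `ι` -/
def gam (ι : I →ₗ[S] A) : I →ₗ[S] (A × S) := LinearMap.prod ι I.subtype

/-- graph over a subideal -/
def Gam (ι : I →ₗ[S] A) (B : Ideal S) : Submodule S (A × S) :=
  Submodule.map (gam ι) (Submodule.submoduleOf B I)

lemma Gam_mono (ι : I →ₗ[S] A) {B C : Ideal S} (h : B ≤ C) : Gam ι B ≤ Gam ι C :=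
  Submodule.map_mono fun x hx => h hx

lemma map_snd_Gam (ι : I →ₗ[S] A) {B : Ideal S} (h : B ≤ I) :
    Submodule.map (AlgHom.snd S A S).toLinearMap (Gam ι B) = B := by
  ext x
  constructor
  · rintro ⟨_, ⟨y, hy, rfl⟩, rfl⟩
    exact hy
  · intro hx
    exact ⟨gam ι ⟨x, h hx⟩, ⟨⟨x, h hx⟩, hx, rfl⟩, rfl⟩

lemma Gam_succ (ι : I →ₗ[S] A) (a : ℕ → S) (haI : ∀ k, a k ∈ I) (i : ℕ) {z : A × S}
    {P : Submodule S (A × S)} (hz : z ∈ Gam ι (J a (i + 1)) * P) :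
    ∃ w ∈ Gam ι (J a i) * P, ∃ h ∈ P, z = w + gam ι ⟨a i, haI i⟩ * h := by
  induction hz using Submodule.mul_induction_on' with
  | mem_mul_mem m hm n hn =>
    obtain ⟨⟨y, hyI⟩, hy, rfl⟩ := hm
    obtain ⟨y', hy', r, hr⟩ := mem_J_succ.1 (show y ∈ J a (i + 1) from hy)
    have hy'I := J_le haI i hy'
    refine ⟨gam ι ⟨y', hy'I⟩ * n, Submodule.mul_mem_mul ⟨⟨y', hy'I⟩, hy', rfl⟩ hn, r • n,
      P.smul_mem _ hn, ?_⟩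
    have : (⟨y, hyI⟩ : I) = r • ⟨a i, haI i⟩ + ⟨y', hy'I⟩ := by
      apply Subtype.ext
      simp [hr, mul_comm]
    rw [this, map_add, map_smul, add_mul, smul_mul_assoc, mul_smul_comm, add_comm]
  | add x hx y hy ihx ihy =>
    obtain ⟨w, hw, h, hh, rfl⟩ := ihx
    obtain ⟨w', hw', h', hh', rfl⟩ := ihy
    exact ⟨w + w', add_mem hw hw', h + h', add_mem hh hh', by ring⟩

lemma G_key (ι : I →ₗ[S] A) (a : ℕ → S) (n : ℕ) (haI : ∀ k, a k ∈ I) (hn : J a n = I)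
    (hds : ∀ i < n, ∀ x ∈ I, a i * x ∈ J a i → x ∈ J a i) (j : ℕ) :
    ∀ i ≤ n, ∀ z ∈ Gam ι (J a i) * Gam ι I ^ j, z.2 = 0 → z = 0 := by
  have hsnd : ∀ i j, Submodule.map (AlgHom.snd S A S).toLinearMap (Gam ι (J a i) * Gam ι I ^ j) =
      J a i * I ^ j := by
    intro i j
    rw [Submodule.map_mul, Submodule.map_pow, map_snd_Gam ι (J_le haI i), map_snd_Gam ι le_rfl]
  have hd := dseq ⊥ I a n haI (by simpa only [sat_bot] using hds) (by rw [sat_bot, hn])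
  induction j with
  | zero =>
    intro i hi z hz hz2
    rw [pow_zero, mul_one] at hz
    obtain ⟨y, hy, rfl⟩ := hz
    have : y = 0 := Subtype.ext hz2
    rw [this, map_zero]
  | succ j ihj =>
    intro i
    induction i with
    | zero =>
      intro _ z hz _
      have : Gam ι (J a 0) = ⊥ := by
        rw [eq_bot_iff]
        rintro _ ⟨y, hy, rfl⟩
        have : y = 0 := Subtype.ext (by simpa [Submodule.submoduleOf] using hy)
        rw [this, map_zero]; exact zero_mem _
      rw [this, Submodule.bot_mul] at hz
      exact hz
    | succ i ihi =>
      intro hi z hz hz2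
      obtain ⟨w, hw, h, hh, rfl⟩ := Gam_succ ι a haI i hz
      have hw2 : w.2 ∈ J a i * I ^ (j + 1) := by
        rw [← hsnd]; exact ⟨w, hw, rfl⟩
      have hh2 : h.2 ∈ I ^ (j + 1) := by
        have : h.2 ∈ Submodule.map (AlgHom.snd S A S).toLinearMap (Gam ι I ^ (j + 1)) :=
          ⟨h, hh, rfl⟩
        rwa [Submodule.map_pow, map_snd_Gam ι le_rfl] at this
      have e : w.2 + a i * h.2 = 0 := hz2
      have h1 : a i * h.2 ∈ J a i := by
        rw [eq_neg_of_add_eq_zero_right e]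
        exact neg_mem (Ideal.mul_le_left hw2)
      have h2 : h.2 ∈ J a i := hds i (by omega) _ (Ideal.pow_le_self (by omega) hh2) h1
      have h3 := hd (n - i) i (by omega) j _ h2 hh2
      rw [sat_bot, ← hsnd] at h3
      obtain ⟨h', hh', hhh⟩ := h3
      have hle : Gam ι (J a i) * Gam ι I ^ j ≤ Gam ι I ^ (j + 1) := by
        rw [pow_succ']
        exact mul_le_mul' (Gam_mono ι (J_le haI i)) le_rfl
      have h4 : h - h' = 0 := by
        refine ihj n le_rfl _ ?_ ?_
        · rw [hn, ← pow_succ']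
          exact sub_mem hh (hle hh')
        · have : h'.2 = h.2 := hhh
          rw [Prod.snd_sub, this, sub_self]
      obtain rfl : h = h' := sub_eq_zero.1 h4
      refine ihi (by omega) _ (add_mem hw ?_) hz2
      have h5 : gam ι ⟨a i, haI i⟩ * h ∈ Gam ι I * (Gam ι (J a i) * Gam ι I ^ j) :=
        Submodule.mul_mem_mul ⟨⟨a i, haI i⟩, haI i, rfl⟩ hh'
      rw [mul_left_comm, ← pow_succ'] at h5
      exact h5

lemma G_pow (ι : I →ₗ[S] A) (a : ℕ → S) (n : ℕ) (haI : ∀ k, a k ∈ I) (hn : J a n = I)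
    (hds : ∀ i < n, ∀ x ∈ I, a i * x ∈ J a i → x ∈ J a i) (j : ℕ) (z : A × S)
    (hz : z ∈ Gam ι I ^ j) (hz2 : z.2 = 0) : z = 0 := by
  rcases j with _ | j
  · rw [pow_zero, Submodule.mem_one] at hz
    obtain ⟨s, rfl⟩ := hz
    have : s = 0 := hz2
    rw [this, map_zero]
  · refine G_key ι a n haI hn hds j n le_rfl z ?_ hz2
    rwa [hn, ← pow_succ']

/-- torsion elements vanish -/
lemma G_torsion (ι : I →ₗ[S] A) (a : ℕ → S) (n : ℕ) (haI : ∀ k, a k ∈ I) (hn : J a n = I)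
    (hds : ∀ i < n, ∀ x ∈ I, a i * x ∈ J a i → x ∈ J a i)
    (Θ : A →ₐ[S] Polynomial S) (hΘ : ∀ x : I, Θ (ι x) = Polynomial.C (x : S) * Polynomial.X)
    (hgen : Algebra.adjoin S (Set.range ι) = ⊤) (r : S) (hr : ∀ s, r * s = 0 → s = 0) (α : A)
    (hα : r • α = 0) : α = 0 := by
  have h1 : ∀ e : ℕ, ∀ z ∈ Gam ι I ^ e, Θ z.1 = Polynomial.C z.2 * Polynomial.X ^ e := by
    intro e
    induction e with
    | zero =>
      intro z hz
      rw [pow_zero, Submodule.mem_one] at hz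
      obtain ⟨s, rfl⟩ := hz
      simp [Prod.algebraMap_apply, Polynomial.algebraMap_eq]
    | succ e ih =>
      intro z hz
      rw [pow_succ'] at hz
      induction hz using Submodule.mul_induction_on' with
      | mem_mul_mem m hm n hn =>
        obtain ⟨x, hx, rfl⟩ := hm
        have e1 : (gam ι x * n).1 = ι x * n.1 := rfl
        have e2 : (gam ι x * n).2 = (x : S) * n.2 := rfl
        rw [e1, e2, map_mul, hΘ, ih n hn, Polynomial.C_mul]
        ring
      | add x hx y hy ihx ihy =>
        rw [Prod.fst_add, Prod.snd_add, map_add, ihx, ihy, Polynomial.C_add]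
        ring
  -- decomposition
  let D : Subalgebra S A := 
    { carrier := {α | ∃ N, ∃ f : ℕ → A × S, (∀ e, f e ∈ Gam ι I ^ e) ∧
        α = ∑ e ∈ Finset.range N, (f e).1}
      add_mem' := by
        rintro _ _ ⟨N, f, hf, rfl⟩ ⟨N', f', hf', rfl⟩
        refine ⟨max N N', fun e => (if e < N then f e else 0) + (if e < N' then f' e else 0), ?_, ?_⟩
        · intro e
          refine add_mem ?_ ?_ <;> split_ifs <;> simp [*]
        · simp only [Prod.fst_add, Finset.sum_add_distrib]
          congr 1
          · rw [← Finset.sum_subset (Finset.range_mono (le_max_left N N'))]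
            · exact Finset.sum_congr rfl fun e he => by rw [if_pos (Finset.mem_range.1 he)]
            · intro e _ he
              rw [if_neg (by simpa using he)]; rfl
          · rw [← Finset.sum_subset (Finset.range_mono (le_max_right N N'))]
            · exact Finset.sum_congr rfl fun e he => by rw [if_pos (Finset.mem_range.1 he)]
            · intro e _ he
              rw [if_neg (by simpa using he)]; rfl
      mul_mem' := by
        rintro _ _ ⟨N, f, hf, rfl⟩ ⟨N', f', hf', rfl⟩
        refine ⟨N + N', fun e => ∑ p ∈ (Finset.range N ×ˢ Finset.range N') with p.1 + p.2 = e,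
          f p.1 * f' p.2, ?_, ?_⟩
        · intro e
          refine sum_mem fun p hp => ?_
          rw [Finset.mem_filter] at hp
          rw [← hp.2, pow_add]
          exact Submodule.mul_mem_mul (hf _) (hf' _)
        · simp only [Prod.fst_sum, Prod.fst_mul]
          rw [Finset.sum_fiberwise_of_maps_to, Finset.sum_product, Finset.sum_mul_sum]
          intro p hp
          rw [Finset.mem_product, Finset.mem_range, Finset.mem_range] at hp
          rw [Finset.mem_range]
          omega
      algebraMap_mem' := by
        intro s
        refine ⟨1, fun e => if e = 0 then algebraMap S (A × S) s else 0, ?_, ?_⟩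
        · intro e
          beta_reduce
          split_ifs with he
          · rw [he, pow_zero]; exact Submodule.mem_one.2 ⟨s, rfl⟩
          · exact zero_mem _
        · simp }
  have hD : α ∈ D := by
    have : Algebra.adjoin S (Set.range ι) ≤ D := by
      rw [Algebra.adjoin_le_iff]
      rintro _ ⟨x, rfl⟩
      refine ⟨2, fun e => if e = 1 then gam ι x else 0, ?_, ?_⟩
      · intro e
        beta_reduce
        split_ifs with he
        · rw [he, pow_one]; exact ⟨x, x.2, rfl⟩
        · exact zero_mem _
      · simp [Finset.sum_range_succ, gam]
    rw [hgen] at this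
    exact this trivial
  obtain ⟨N, f, hf, rfl⟩ := hD
  refine Finset.sum_eq_zero fun e he => ?_
  have h2 : Polynomial.coeff (Θ (r • ∑ e ∈ Finset.range N, (f e).1)) e = 0 := by
    rw [hα, map_zero, Polynomial.coeff_zero]
  have h3 : r * (f e).2 = 0 := by
    rw [map_smul, map_sum, Finset.sum_congr rfl (fun e _ => h1 e _ (hf e)), Polynomial.coeff_smul,
      Polynomial.finsetSum_coeff] at h2
    simp only [Polynomial.coeff_C_mul_X_pow] at h2
    rw [Finset.sum_ite_eq, if_pos he] at h2
    exact h2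
  rw [G_pow ι a n haI hn hds e (f e) (hf e) (hr _ h3)]
  rfl

end G1
end LT

set_option linter.unusedSectionVars false
set_option linter.unusedVariables false
namespace LT

open IsLocalRing

section H1
variable {R : Type u} [CommRing R] (M : Type u) [AddCommGroup M] [Module R M]

/-- the canonical map to the symmetric algebra -/
def symι : M →ₗ[R] SymModAlg R M where
  toFun x := Ideal.Quotient.mk _ (MvPolynomial.X x)
  map_add' x y := by
    rw [← map_add, Ideal.Quotient.eq]
    exact Ideal.subset_span (Or.inl ⟨x, y, by ring⟩)
  map_smul' r x := by
    have : r • (Ideal.Quotient.mk (Ideal.span (symRels R M)) (MvPolynomial.X x)) =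
      Ideal.Quotient.mk (Ideal.span (symRels R M)) (MvPolynomial.C r * MvPolynomial.X x) := by
      rw [← MvPolynomial.smul_eq_C_mul]; rfl
    rw [RingHom.id_apply, this, Ideal.Quotient.eq]
    exact Ideal.subset_span (Or.inr ⟨r, x, rfl⟩)

lemma symι_gen : Algebra.adjoin R (Set.range (symι (R := R) M)) = ⊤ := by
  rw [eq_top_iff]
  rintro z -
  obtain ⟨z, rfl⟩ := Ideal.Quotient.mk_surjective z
  induction z using MvPolynomial.induction_on with
  | C r => exact Subalgebra.algebraMap_mem _ r
  | add p q hp hq => rw [map_add]; exact add_mem hp hq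
  | mul_X p x hp =>
    rw [map_mul]
    exact mul_mem hp (Algebra.subset_adjoin ⟨x, rfl⟩)

variable {M}
/-- universal property -/
def symLift {B : Type u} [CommRing B] [Algebra R B] (φ : M →ₗ[R] B) : SymModAlg R M →ₐ[R] B :=
  Ideal.Quotient.liftₐ _ (MvPolynomial.aeval φ) (by
    intro p hp
    have : Ideal.span (symRels R M) ≤ RingHom.ker (MvPolynomial.aeval (R := R) φ) := by
      rw [Ideal.span_le]
      rintro _ (⟨x, y, rfl⟩ | ⟨r, x, rfl⟩)
      · simp
      · simp [Algebra.smul_def]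
    exact this hp)

lemma symLift_ι {B : Type u} [CommRing B] [Algebra R B] (φ : M →ₗ[R] B) (x : M) :
    symLift φ (symι M x) = φ x := by
  have : symLift φ (symι M x) = MvPolynomial.aeval φ (MvPolynomial.X (R := R) x) := rfl
  rw [this, MvPolynomial.aeval_X]

end H1

lemma descent {R S : Type u} [CommRing R] [CommRing S] [Algebra R S] [Module.FaithfullyFlat R S]
    (I : Ideal R) (a : ℕ → S) (n : ℕ) (haI : ∀ k, a k ∈ I.map (algebraMap R S))
    (hc : Concl n (I.map (algebraMap R S)) a) : IsLinearType R ↥I := by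
  obtain ⟨e, he⟩ := exists_equiv_map S I
  let φ : I →ₗ[R] Polynomial S :=
    { toFun := fun x => Polynomial.C (algebraMap R S x) * Polynomial.X
      map_add' := by intro x y; simp [add_mul]
      map_smul' := by
        intro r x
        rw [RingHom.id_apply, Algebra.smul_def, IsScalarTower.algebraMap_apply R S (Polynomial S),
          Polynomial.algebraMap_eq, ← mul_assoc, ← Polynomial.C_mul, ← map_mul]
        rfl }
  let Θ : (S ⊗[R] SymModAlg R I) →ₐ[S] Polynomial S :=
    Algebra.TensorProduct.lift (Algebra.ofId S _) (symLift φ) (fun _ _ => Commute.all _ _)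
  let ι : (I.map (algebraMap R S)) →ₗ[S] (S ⊗[R] SymModAlg R I) :=
    (LinearMap.baseChange S (symι ↥I)) ∘ₗ e.symm.toLinearMap
  have hι : ∀ s x, ι (e (s ⊗ₜ x)) = s ⊗ₜ symι _ x := by
    intro s x
    simp [ι]
  have hΘ : ∀ x, Θ (ι x) = Polynomial.C (x : S) * Polynomial.X := by
    intro x
    obtain ⟨w, rfl⟩ := e.surjective x
    induction w using TensorProduct.induction_on with
    | zero => simp
    | add x y hx hy => 
      rw [map_add, map_add, map_add, hx, hy, Submodule.coe_add, Polynomial.C_add]; ring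
    | tmul s x =>
      rw [hι, he, Algebra.TensorProduct.lift_tmul, symLift_ι, Polynomial.C_mul, mul_assoc]
      rfl
  have hgen : Algebra.adjoin S (Set.range ι) = ⊤ := by
    have h1 : ∀ z : SymModAlg R I, (1 : S) ⊗ₜ[R] z ∈ Algebra.adjoin S (Set.range ι) := by
      intro z
      have : z ∈ Algebra.adjoin R (Set.range (symι (R := R) ↥I)) := by rw [symι_gen]; trivial
      have h2 : Algebra.adjoin R (Set.range (symι (R := R) ↥I)) ≤
          Subalgebra.comap (Algebra.TensorProduct.includeRight : _ →ₐ[R] S ⊗[R] SymModAlg R I)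
          ((Algebra.adjoin S (Set.range ι)).restrictScalars R) := by
        rw [Algebra.adjoin_le_iff]
        rintro _ ⟨x, rfl⟩
        exact Algebra.subset_adjoin ⟨e (1 ⊗ₜ x), hι _ _⟩
      exact h2 this
    rw [eq_top_iff]
    rintro z -
    induction z using TensorProduct.induction_on with
    | zero => exact zero_mem _
    | add x y hx hy => exact add_mem (hx) (hy)
    | tmul s x =>
      have : s ⊗ₜ[R] x = s • ((1 : S) ⊗ₜ[R] x) := by rw [TensorProduct.smul_tmul', smul_eq_mul, mul_one]
      rw [this]
      exact Subalgebra.smul_mem _ (h1 x) s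
  unfold IsLinearType
  rw [eq_bot_iff]
  rintro z ⟨r, hr, hz⟩
  have hr' : ∀ s : S, algebraMap R S r * s = 0 → s = 0 := by
    intro s hs
    have hreg : IsSMulRegular R r := by
      intro x y hxy
      exact (mem_nonZeroDivisors_iff_left.1 hr |> fun h => sub_eq_zero.1 (h _ (by
        have : r * x = r * y := hxy
        rw [mul_sub, this, sub_self])))
    have h3 : IsSMulRegular S (algebraMap R S r) := hreg.of_flat
    exact h3.right_eq_zero_of_smul hs
  have key := G_torsion ι a n haI hc.1 hc.2 Θ hΘ hgen (algebraMap R S r) hr' ((1 : S) ⊗ₜ[R] z) (by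
    rw [algebraMap_smul, ← TensorProduct.tmul_smul, hz, TensorProduct.tmul_zero])
  have := Module.FaithfullyFlat.tensorProduct_mk_injective (A := R) (B := S) (SymModAlg R I)
  exact this (key.trans (TensorProduct.tmul_zero _ _).symm)
end LT

set_option linter.unusedSectionVars false
set_option linter.unusedVariables false
namespace LT

open IsLocalRing

section E1
variable {S : Type u} [CommRing S]

lemma avoid [IsLocalRing S] [Infinite (ResidueField S)] {M : Type u} [AddCommGroup M] [Module S M]
    (T : Set (Submodule S M)) (hT : T.Finite) (hne : ∀ N ∈ T, N ≠ ⊤) : ∃ x, ∀ N ∈ T, x ∉ N := by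
  by_contra hcon
  push Not at hcon
  have hc : ⋃ p ∈ hT.toFinset, ((p : Submodule S M) : Set M) = Set.univ := by
    rw [Set.eq_univ_iff_forall]
    intro x
    obtain ⟨N, hN, hx⟩ := hcon x
    exact Set.mem_biUnion (by simpa using hN) hx
  have ⟨N, hN, hfi⟩ := Submodule.exists_finiteIndex_of_cover hc
  have hfin : Finite (M ⧸ N) := AddSubgroup.finite_quotient_of_finiteIndex
  have : Nontrivial (M ⧸ N) := Submodule.Quotient.nontrivial_iff.mpr (hne N (by simpa using hN))
  obtain ⟨x, hx⟩ := exists_ne (0 : M ⧸ N)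
  have hinj : Function.Injective (fun c : ResidueField S =>
      (Function.surjInv (residue_surjective (R := S)) c) • x) := by
    intro c c' h
    by_contra hne
    have hu : IsUnit (Function.surjInv (residue_surjective (R := S)) c -
        Function.surjInv (residue_surjective (R := S)) c') := by
      by_contra hu
      have : residue S (Function.surjInv (residue_surjective (R := S)) c -
        Function.surjInv (residue_surjective (R := S)) c') = 0 := by
        rw [residue_eq_zero_iff]; exact hu
      rw [map_sub, Function.surjInv_eq (residue_surjective (R := S)) c,
        Function.surjInv_eq (residue_surjective (R := S)) c', sub_eq_zero] at this
      exact hne this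
    have h0 : (Function.surjInv (residue_surjective (R := S)) c -
        Function.surjInv (residue_surjective (R := S)) c') • x = 0 := by
      rw [sub_smul, sub_eq_zero]; exact h
    exact hx ((hu.smul_eq_zero).1 h0)
  have := Infinite.of_injective _ hinj
  exact not_finite (M ⧸ N)

lemma nak [IsNoetherianRing S] {I B p : Ideal S} (hp : p.IsPrime) {s : S} (hs : s ∉ p)
    (h : ∀ x ∈ I, s * x ∈ p * I ⊔ B) : ∃ s', s' ∉ p ∧ ∀ x ∈ I, s' * x ∈ B := by
  let N : Submodule S ↥I := Submodule.submoduleOf B I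
  have h1 : ∀ y (hy : y ∈ p * I), ∃ hy' : y ∈ I, N.mkQ ⟨y, hy'⟩ ∈ p • (⊤ : Submodule S (↥I ⧸ N)) := by
    intro y hy
    induction hy using Submodule.mul_induction_on' with
    | mem_mul_mem m hm n hn =>
      refine ⟨Ideal.mul_mem_left _ _ hn, ?_⟩
      have : N.mkQ ⟨m * n, Ideal.mul_mem_left _ _ hn⟩ = m • N.mkQ ⟨n, hn⟩ := by
        rw [← map_smul]; rfl
      rw [this]
      exact Submodule.smul_mem_smul hm trivial
    | add x hx y hy ihx ihy =>
      obtain ⟨hx', hx'⟩ := ihx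
      obtain ⟨hy', hy'⟩ := ihy
      refine ⟨add_mem ‹_› ‹_›, ?_⟩
      have := add_mem hx' hy'
      rw [← map_add] at this
      exact this
  obtain ⟨P, hP, hdeg, hco, hz⟩ := LinearMap.exists_monic_and_natDegree_eq_and_coeff_mem_pow_and_aeval_eq_zero S
    (algebraMap S (Module.End S (↥I ⧸ N)) s) p (by
      rintro _ ⟨x, rfl⟩
      obtain ⟨⟨x, hx⟩, rfl⟩ := N.mkQ_surjective x
      rw [Module.algebraMap_end_apply, ← map_smul]
      obtain ⟨y, hy, b, hb, e⟩ := Submodule.mem_sup.1 (h x hx)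
      obtain ⟨hy', hy''⟩ := h1 y hy
      have : N.mkQ (s • ⟨x, hx⟩) = N.mkQ ⟨y, hy'⟩ := by
        rw [← sub_eq_zero, ← map_sub, Submodule.mkQ_apply, Submodule.Quotient.mk_eq_zero]
        show s * x - y ∈ B
        rw [← e]; simpa using hb
      rw [this]; exact hy'')
  refine ⟨P.eval s, ?_, ?_⟩
  · intro hc
    rw [Polynomial.eval_eq_sum_range, Finset.sum_range_succ, hP.coeff_natDegree, one_mul] at hc
    have : ∑ i ∈ Finset.range P.natDegree, P.coeff i * s ^ i ∈ p := by
      refine sum_mem fun i hi => Ideal.mul_mem_right _ _ ?_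
      rw [Finset.mem_range] at hi
      exact Ideal.pow_le_self (by omega) (hco i)
    exact hs (hp.mem_of_pow_mem _ ((Submodule.add_mem_iff_right _ this).1 hc))
  · intro x hx
    have h2 := LinearMap.congr_fun hz (N.mkQ ⟨x, hx⟩)
    rw [Polynomial.aeval_algebraMap_apply, Module.algebraMap_end_apply, LinearMap.zero_apply,
      ← map_smul, Submodule.mkQ_apply, Submodule.Quotient.mk_eq_zero] at h2
    have h3 : (P.aeval s) * x ∈ B := h2
    rwa [Polynomial.coe_aeval_eq_eval] at h3

/-- `I` is locally generated modulo `B` by `t` elements at `p`, witnessed by `s` -/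
def genW (I : Ideal S) (t : ℕ) (B : Ideal S) (s : S) : Prop :=
  ∃ F : Finset S, F.card ≤ t ∧ (∀ v ∈ F, v ∈ I) ∧ ∀ x ∈ I, s * x ∈ B ⊔ Ideal.span (F : Set S)

/-- `I_p` is generated modulo `B` by `t` elements -/
def gen (I : Ideal S) (t : ℕ) (B : Ideal S) (p : Ideal S) : Prop := ∃ s, s ∉ p ∧ genW I t B s

lemma gen.mono {I : Ideal S} {t t' : ℕ} {B B' p : Ideal S} (h : gen I t B p) (ht : t ≤ t')
    (hB : B ≤ B') : gen I t' B' p := by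
  obtain ⟨s, hs, F, hF, hFI, h⟩ := h
  exact ⟨s, hs, F, hF.trans ht, hFI, fun x hx => sup_le_sup_right hB _ (h x hx)⟩

lemma gen_zero {I B p : Ideal S} : gen I 0 B p ↔ ∃ s, s ∉ p ∧ ∀ x ∈ I, s * x ∈ B := by
  constructor
  · rintro ⟨s, hs, F, hF, hFI, h⟩
    have : F = ∅ := by simpa using hF
    subst this
    exact ⟨s, hs, by simpa using h⟩
  · rintro ⟨s, hs, h⟩
    exact ⟨s, hs, ∅, by simp, by simp, by simpa using h⟩

/-- bad elements of `I` at `p` -/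
def Lp (I B p : Ideal S) (hp : p.IsPrime) : Ideal S where
  carrier := {x | ∃ s, s ∉ p ∧ s * x ∈ p * I ⊔ B}
  zero_mem' := ⟨1, fun h => hp.ne_top ((Ideal.eq_top_iff_one _).2 h), by simp⟩
  add_mem' := by
    rintro x y ⟨s, hs, h⟩ ⟨s', hs', h'⟩
    refine ⟨s * s', fun hc => (hp.mem_or_mem hc).elim hs hs', ?_⟩
    rw [show s * s' * (x + y) = s' * (s * x) + s * (s' * y) by ring]
    exact add_mem (Ideal.mul_mem_left _ _ h) (Ideal.mul_mem_left _ _ h')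
  smul_mem' := by
    rintro c x ⟨s, hs, h⟩
    refine ⟨s, hs, ?_⟩
    rw [smul_eq_mul, mul_left_comm]
    exact Ideal.mul_mem_left _ _ h

lemma Lp_ne [IsNoetherianRing S] {I B p : Ideal S} (hp : p.IsPrime) (h : I ≤ Lp I B p hp) :
    gen I 0 B p := by
  obtain ⟨T, hT⟩ := (isNoetherianRing_iff_ideal_fg S).1 ‹_› I
  have h1 : ∀ x : S, ∃ s, s ∉ p ∧ (x ∈ T → s * x ∈ p * I ⊔ B) := by
    intro x
    by_cases hx : x ∈ T
    · obtain ⟨s, hs, h⟩ := h (hT ▸ Ideal.subset_span hx)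
      exact ⟨s, hs, fun _ => h⟩
    · exact ⟨1, fun h => hp.ne_top ((Ideal.eq_top_iff_one _).2 h), fun h => absurd h hx⟩
  choose σ hσ1 hσ2 using h1
  rw [gen_zero]
  refine nak hp (s := ∏ x ∈ T, σ x) (fun hc => ?_) ?_
  · obtain ⟨x, -, hx⟩ := (hp.prod_mem_iff).1 hc
    exact hσ1 x hx
  · intro x hx
    rw [← hT] at hx
    induction hx using Submodule.span_induction with
    | zero => simp
    | mem x hx =>
      obtain ⟨c, hc⟩ := Finset.dvd_prod_of_mem σ hx
      rw [hc, mul_right_comm]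
      exact Ideal.mul_mem_right _ _ (hσ2 x hx)
    | add x y _ _ hx hy => rw [mul_add]; exact add_mem hx hy
    | smul c x _ hx => rw [smul_eq_mul, mul_left_comm]; exact Ideal.mul_mem_left _ _ hx

lemma gen_step {I B p : Ideal S} (hp : p.IsPrime) {t : ℕ} (h : gen I (t + 1) B p) {a : S}
    (haI : a ∈ I) (ha : a ∉ Lp I B p hp) : gen I t (B ⊔ Ideal.span {a}) p := by
  classical
  obtain ⟨s, hs, F, hF, hFI, h⟩ := h
  obtain ⟨b, hb, w, hw, e⟩ := Submodule.mem_sup.1 (h a haI)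
  obtain ⟨c, -, hc⟩ := Submodule.mem_span_finset.1 hw
  have h1 : ∃ v ∈ F, c v ∉ p := by
    by_contra hcon
    push Not at hcon
    refine ha ⟨s, hs, ?_⟩
    rw [← e, ← hc]
    refine add_mem (Ideal.mem_sup_right hb) (Ideal.mem_sup_left (sum_mem fun v hv => ?_))
    exact Ideal.mul_mem_mul (hcon v hv) (hFI v hv)
  obtain ⟨v, hv, hcv⟩ := h1
  refine ⟨c v * s, fun hc => (hp.mem_or_mem hc).elim hcv hs, F.erase v, ?_,
    fun w hw => hFI w (Finset.mem_of_mem_erase hw), ?_⟩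
  · rw [Finset.card_erase_of_mem hv]; omega
  have hsub : ∀ w ∈ F.erase v, w ∈ B ⊔ Ideal.span {a} ⊔ Ideal.span ((F.erase v : Finset S) : Set S) :=
    fun w hw => Ideal.mem_sup_right (Ideal.subset_span hw)
  have h2 : c v * v ∈ B ⊔ Ideal.span {a} ⊔ Ideal.span ((F.erase v : Finset S) : Set S) := by
    have : c v * v = s * a - b - ∑ w ∈ F.erase v, c w • w := by
      rw [← e, ← hc, ← Finset.add_sum_erase _ _ hv, smul_eq_mul]; ring
    rw [this]
    refine sub_mem (sub_mem ?_ ?_) (sum_mem fun w hw => Ideal.mul_mem_left _ _ (hsub w hw))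
    · exact Ideal.mem_sup_left (Ideal.mem_sup_right
        (Ideal.mul_mem_left _ _ (Ideal.mem_span_singleton_self a)))
    · exact Ideal.mem_sup_left (Ideal.mem_sup_left hb)
  have h3 : ∀ x ∈ B ⊔ Ideal.span (F : Set S),
      c v * x ∈ B ⊔ Ideal.span {a} ⊔ Ideal.span ((F.erase v : Finset S) : Set S) := by
    intro x hx
    have : B ⊔ Ideal.span (F : Set S) ≤ Submodule.comap (LinearMap.mulLeft S (c v)) 
        (B ⊔ Ideal.span {a} ⊔ Ideal.span ((F.erase v : Finset S) : Set S)) := by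
      refine sup_le (fun b hb => Ideal.mem_sup_left (Ideal.mem_sup_left (Ideal.mul_mem_left _ _ hb))) ?_
      rw [Ideal.span_le]
      intro w hw
      by_cases hwv : w = v
      · subst hwv; exact h2
      · exact Ideal.mul_mem_left _ _ (hsub w (Finset.mem_erase.2 ⟨hwv, hw⟩))
    exact this hx
  intro x hx
  rw [mul_assoc]
  exact h3 _ (h x hx)

end E1
end LT

set_option linter.unusedSectionVars false
set_option linter.unusedVariables false
namespace LT

open IsLocalRing

lemma J_congr {R : Type u} [CommRing R] {a b : ℕ → R} {i : ℕ} (h : ∀ k < i, a k = b k) :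
    J a i = J b i := by
  unfold J
  congr 1
  exact Set.image_congr fun k hk => h k hk

section E2
variable {S L M : Type u} [CommRing S] [IsLocalRing S] [IsNoetherianRing S]
  [CommRing L] [IsLocalRing L] [IsNoetherianRing L] [Algebra S L] [AddCommGroup M] [Module S M]

/-- the invariant -/
def InvI (I : Ideal S) (ℓ i : ℕ) (B : Ideal S) (B' : Ideal L) : Prop :=
  (∀ t (p : Ideal S), p.IsPrime → I ≤ p → i + t ≤ ℓ → p.height ≤ (i + t : ℕ) → gen I t B p) ∧
  (∀ p : Ideal S, p.IsPrime → B ≤ p → ¬ I ≤ p → (i : ℕ∞) ≤ p.height) ∧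
  (∀ P : PrimeSpectrum L, B' ≤ P.asIdeal → P.asIdeal ≠ maximalIdeal L →
    (i : ℕ∞) + Order.coheight P ≤ ℓ)

lemma inv_step [Infinite (ResidueField S)] {I : Ideal S} {ℓ i : ℕ} {B : Ideal S} {B' : Ideal L}
    (α : M →ₗ[S] S) (β : M →ₗ[S] L) (hα : LinearMap.range α = I)
    (hβ : ∀ P : Ideal L, P.IsPrime → P ≠ maximalIdeal L → ∃ c, β c ∉ P)
    (h : InvI I ℓ i B B') :
    ∃ x, InvI I ℓ (i + 1) (B ⊔ Ideal.span {α x}) (B' ⊔ Ideal.span {β x}) := by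
  obtain ⟨hA, hB, hC⟩ := h
  have hαI : ∀ x, α x ∈ I := fun x => hα ▸ ⟨x, rfl⟩
  let Zt : ℕ → Ideal S := fun t => I ⊔ Ideal.span {s | genW I t B s}
  have hZt : ∀ t (p : Ideal S), Zt t ≤ p → ¬ gen I t B p := by
    rintro t p hp ⟨s, hs, hg⟩
    exact hs (hp (Ideal.mem_sup_right (Ideal.subset_span hg)))
  have hZt' : ∀ t (p : Ideal S), I ≤ p → ¬ gen I t B p → Zt t ≤ p := by
    intro t p hI hp
    refine sup_le hI (Ideal.span_le.2 fun s hs => ?_)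
    by_contra hsp
    exact hp ⟨s, hsp, hs⟩
  let T1 : Set (Submodule S M) := {N | ∃ t ≤ ℓ, ∃ q ∈ (Zt t).minimalPrimes, ∃ hq : q.IsPrime,
    N = Submodule.comap α (Lp I B q hq)}
  let T2 : Set (Submodule S M) := {N | ∃ q ∈ B.minimalPrimes, ¬ I ≤ q ∧ N = Submodule.comap α q}
  let T3 : Set (Submodule S M) := {N | ∃ q ∈ B'.minimalPrimes, q ≠ maximalIdeal L ∧
    N = Submodule.comap β (Submodule.restrictScalars S q)}
  have hT1 : T1.Finite := by
    classical
    refine ((Set.finite_Iic ℓ).biUnion (t := fun t => (fun q : Ideal S => if hq : q.IsPrime then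
      Submodule.comap α (Lp I B q hq) else ⊥) '' (Zt t).minimalPrimes) 
        fun t _ => ((Zt t).finite_minimalPrimes_of_isNoetherianRing).image _).subset ?_
    rintro N ⟨t, ht, q, hq, hqp, rfl⟩
    exact Set.mem_biUnion (show t ∈ Set.Iic ℓ from ht) ⟨q, hq, dif_pos hqp⟩
  have hT2 : T2.Finite := by
    refine (B.finite_minimalPrimes_of_isNoetherianRing.image (Submodule.comap α)).subset ?_
    rintro N ⟨q, hq, -, rfl⟩
    exact ⟨q, hq, rfl⟩
  have hT3 : T3.Finite := by
    refine (B'.finite_minimalPrimes_of_isNoetherianRing.image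
      (fun q => Submodule.comap β (Submodule.restrictScalars S q))).subset ?_
    rintro N ⟨q, hq, -, rfl⟩
    exact ⟨q, hq, rfl⟩
  obtain ⟨x, hx⟩ := avoid (T1 ∪ (T2 ∪ T3)) (hT1.union (hT2.union hT3)) (by
    rintro N (⟨t, ht, q, hq, hqp, rfl⟩ | ⟨q, hq, hIq, rfl⟩ | ⟨q, hq, hqm, rfl⟩) htop
    · refine hZt t q hq.1.2 ((Lp_ne hqp ?_).mono (Nat.zero_le t) le_rfl)
      intro y hy
      have hy' : y ∈ LinearMap.range α := by rw [hα]; exact hy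
      obtain ⟨x, rfl⟩ := hy'
      have : x ∈ Submodule.comap α (Lp I B q hqp) := by rw [htop]; trivial
      exact this
    · apply hIq
      rw [← hα]
      rintro _ ⟨x, rfl⟩
      have : x ∈ Submodule.comap α q := by rw [htop]; trivial
      exact this
    · obtain ⟨c, hc⟩ := hβ q hq.1.1 hqm
      apply hc
      have : c ∈ Submodule.comap β (Submodule.restrictScalars S q) := by rw [htop]; trivial
      exact this)
  refine ⟨x, ?_, ?_, ?_⟩
  · intro t p hp hI hit hht
    by_cases hg : gen I t B p
    · exact hg.mono le_rfl le_sup_left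
    obtain ⟨q, hq, hqp⟩ := Ideal.exists_minimalPrimes_le (hZt' t p hI hg)
    have hq1 : q.IsPrime := hq.1.1
    have hqe : q = p := by
      by_contra hne
      have hlt : q < p := lt_of_le_of_ne hqp hne
      have h1 := Ideal.height_add_one_le_of_lt_of_isPrime hlt
      have h2 : q.height ≤ (i + t : ℕ) := by
        have h3 := h1.trans hht
        have : ((i + 1 + t : ℕ) : ℕ∞) = ((i + t : ℕ) : ℕ∞) + 1 := by push_cast; ring
        rw [this] at h3
        exact (ENat.add_le_add_iff_right ENat.one_ne_top).1 h3
      exact hZt t q hq.1.2 (hA t q hq1 (le_sup_left.trans hq.1.2) (by omega) h2)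
    subst hqe
    refine gen_step hq1 (hA (t + 1) q hq1 hI (by omega) (hht.trans (by norm_cast; omega))) (hαI x) ?_
    exact hx _ (Or.inl ⟨t, by omega, q, hq, hq1, rfl⟩)
  · intro p hp hBp hIp
    obtain ⟨q, hq, hqp⟩ := Ideal.exists_minimalPrimes_le (le_sup_left.trans hBp)
    have hq1 : q.IsPrime := hq.1.1
    have hIq : ¬ I ≤ q := fun h => hIp (h.trans hqp)
    have h1 := hB q hq1 hq.1.2 hIq
    have h2 : α x ∉ q := hx _ (Or.inr (Or.inl ⟨q, hq, hIq, rfl⟩))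
    have hlt : q < p := lt_of_le_of_ne hqp (by
      rintro rfl
      exact h2 (hBp (Ideal.mem_sup_right (Ideal.mem_span_singleton_self _))))
    have h3 := Ideal.height_add_one_le_of_lt_of_isPrime hlt
    push_cast
    exact le_trans (by gcongr) h3
  · intro P hBP hPm
    have hPp := P.2
    obtain ⟨q, hq, hqp⟩ := Ideal.exists_minimalPrimes_le (le_sup_left.trans hBP)
    have hq1 : q.IsPrime := hq.1.1
    have hqm : q ≠ maximalIdeal L := by
      rintro rfl
      exact hPm (le_antisymm (le_maximalIdeal hPp.ne_top) hqp)
    have h1 := hC ⟨q, hq1⟩ hq.1.2 hqm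
    have h2 : β x ∉ q := hx _ (Or.inr (Or.inr ⟨q, hq, hqm, rfl⟩))
    have hlt : (⟨q, hq1⟩ : PrimeSpectrum L) < P := lt_of_le_of_ne hqp (by
      rintro rfl
      exact h2 (hBP (Ideal.mem_sup_right (Ideal.mem_span_singleton_self _))))
    have h3 := Order.coheight_add_one_le hlt
    push_cast
    rw [add_assoc, add_comm 1]
    exact le_trans (by gcongr) h1

lemma exists_seq {M : Type u} [Nonempty M] (P : ℕ → (ℕ → M) → Prop)
    (hc : ∀ i c c', (∀ k < i, c k = c' k) → P i c → P i c') (h0 : ∀ c, P 0 c)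
    (hs : ∀ i c, P i c → ∃ x, P (i + 1) (Function.update c i x)) (N : ℕ) :
    ∃ c, ∀ i ≤ N, P i c := by
  induction N with
  | zero => exact ⟨fun _ => Classical.arbitrary M, by
      intro i hi
      obtain rfl : i = 0 := by omega
      exact h0 _⟩
  | succ N ih =>
    obtain ⟨c, h⟩ := ih
    obtain ⟨x, hx⟩ := hs N c (h N le_rfl)
    refine ⟨Function.update c N x, fun i hi => ?_⟩
    rcases Nat.lt_or_ge N i with h1 | h1
    · obtain rfl : i = N + 1 := by omega
      exact hx
    · refine hc i c _ (fun k hk => ?_) (h i h1)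
      rw [Function.update_of_ne (by omega)]

lemma inv_seq [Infinite (ResidueField S)] {I : Ideal S} {ℓ : ℕ}
    (α : M →ₗ[S] S) (β : M →ₗ[S] L) (hα : LinearMap.range α = I)
    (hβ : ∀ P : Ideal L, P.IsPrime → P ≠ maximalIdeal L → ∃ c, β c ∉ P)
    (hdim : ringKrullDim L ≤ ℓ)
    (hG : ∀ t (p : Ideal S), p.IsPrime → I ≤ p → t ≤ ℓ → p.height ≤ t → gen I t ⊥ p) (N : ℕ) :
    ∃ c : ℕ → M, ∀ i ≤ N, InvI I ℓ i (J (fun k => α (c k)) i) (J (fun k => β (c k)) i) := by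
  refine exists_seq _ ?_ ?_ ?_ N
  · intro i c c' h hP
    have h1 : J (fun k => α (c k)) i = J (fun k => α (c' k)) i := 
      J_congr fun k hk => congrArg α (h k hk)
    have h2 : J (fun k => β (c k)) i = J (fun k => β (c' k)) i := 
      J_congr fun k hk => congrArg β (h k hk)
    rwa [← h1, ← h2]
  · intro c
    rw [J_zero, J_zero]
    refine ⟨?_, ?_, ?_⟩
    · intro t p hp hI ht hh
      rw [zero_add] at ht hh
      exact hG t p hp hI ht hh
    · intro p hp _ _; simp
    · intro P _ _
      rw [Nat.cast_zero, zero_add]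
      have := (Order.coheight_le_krullDim P).trans hdim
      exact_mod_cast this
  · intro i c h
    obtain ⟨x, hx⟩ := inv_step α β hα hβ h
    refine ⟨x, ?_⟩
    have h1 : J (fun k => α (c k)) i = J (fun k => α (Function.update c i x k)) i := 
      J_congr fun k hk => by rw [Function.update_of_ne (by omega)]
    have h2 : J (fun k => β (c k)) i = J (fun k => β (Function.update c i x k)) i := 
      J_congr fun k hk => by rw [Function.update_of_ne (by omega)]
    rw [J_succ, J_succ, ← h1, ← h2, Function.update_self]
    exact hx

end E2
end LT

set_option linter.unusedSectionVars false
set_option linter.unusedVariables false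
namespace LT

open IsLocalRing

section E3
variable {S F : Type u} [CommRing S] [IsLocalRing S] [IsNoetherianRing S] [CommRing F] [Algebra S F]
  {m : ℕ}

/-- generic linear forms -/
def lin (S : Type u) [CommRing S] (m : ℕ) : (Fin m → S) →ₗ[S] MvPolynomial (Fin m) S :=
  Fintype.linearCombination S MvPolynomial.X

/-- evaluation into the Rees algebra -/
def ev (f : Fin m → S) : MvPolynomial (Fin m) S →ₐ[S] Polynomial S :=
  MvPolynomial.aeval fun l => Polynomial.C (f l) * Polynomial.X

lemma ev_lin (f : Fin m → S) (c : Fin m → S) :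
    ev f (lin S m c) = Polynomial.C (Fintype.linearCombination S f c) * Polynomial.X := by
  simp only [ev, lin, Fintype.linearCombination_apply, map_sum, MvPolynomial.aeval_X,
    Finset.sum_mul, smul_eq_mul, map_mul, Algebra.smul_def, AlgHom.commutes,
    Polynomial.algebraMap_eq, mul_assoc]

lemma ev_coeff_zero (f : Fin m → S) (h : MvPolynomial (Fin m) S) :
    (ev f h).coeff 0 = MvPolynomial.constantCoeff h := by
  have : (Polynomial.constantCoeff).comp (ev f : MvPolynomial (Fin m) S →+* Polynomial S) =
      MvPolynomial.constantCoeff := by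
    apply MvPolynomial.ringHom_ext
    · intro r
      simp [ev, Polynomial.algebraMap_eq]
    · intro i
      simp [ev]
  exact RingHom.congr_fun this h

/-- the irrelevant maximal ideal -/
def M0 (S : Type u) [CommRing S] [IsLocalRing S] (m : ℕ) : Ideal (MvPolynomial (Fin m) S) :=
  RingHom.ker ((residue S).comp (MvPolynomial.constantCoeff (σ := Fin m)))

instance : (M0 S m).IsPrime := RingHom.ker_isPrime _

lemma mem_M0 {h : MvPolynomial (Fin m) S} :
    h ∈ M0 S m ↔ MvPolynomial.constantCoeff h ∈ maximalIdeal S := by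
  rw [M0, RingHom.mem_ker, RingHom.comp_apply, residue_eq_zero_iff]

lemma lin_mem (c : Fin m → S) : lin S m c ∈ M0 S m := by
  rw [mem_M0]
  simp [lin, Fintype.linearCombination_apply]

lemma exists_lift (f : Fin m → S) (N : ℕ) : ∀ x ∈ (LinearMap.range (Fintype.linearCombination S f) :
    Ideal S) ^ N, ∃ t ∈ (M0 S m) ^ N, ev f t = Polynomial.C x * Polynomial.X ^ N := by
  induction N with
  | zero =>
    intro x _
    exact ⟨MvPolynomial.C x, by simp, by simp [ev, Polynomial.algebraMap_eq]⟩
  | succ N ih =>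
    intro x hx
    rw [pow_succ'] at hx
    induction hx using Submodule.mul_induction_on' with
    | mem_mul_mem y hy z hz =>
      obtain ⟨c, rfl⟩ := hy
      obtain ⟨t, ht, e⟩ := ih z hz
      refine ⟨lin S m c * t, ?_, ?_⟩
      · rw [pow_succ']; exact Ideal.mul_mem_mul (lin_mem c) ht
      · rw [map_mul, ev_lin, e, Polynomial.C_mul]; ring
    | add y hy z hz ihy ihz =>
      obtain ⟨t, ht, e⟩ := ihy
      obtain ⟨t', ht', e'⟩ := ihz
      exact ⟨t + t', add_mem ht ht', by rw [map_add, e, e', Polynomial.C_add]; ring⟩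

/-- fiber data -/
structure Fib (S F : Type u) [CommRing S] [IsLocalRing S] [CommRing F] [Algebra S F]
    {m : ℕ} (f : Fin m → S) (I : Ideal S) (ℓ : ℕ) (Ψ : MvPolynomial (Fin m) S →ₐ[S] F) : Prop where
  surj : Function.Surjective Ψ
  hm : ∀ r ∈ maximalIdeal S, algebraMap S F r = 0
  hker : ∀ h, Ψ h = 0 → ∀ e, (ev f h).coeff e ∈ maximalIdeal S * I ^ e
  dim : ringKrullDim F ≤ ℓ

set_option maxHeartbeats 800000 in
lemma exists_general [Infinite (ResidueField S)] {f : Fin m → S} {I : Ideal S} {ℓ : ℕ}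
    {Ψ : MvPolynomial (Fin m) S →ₐ[S] F} (hF : Fib S F f I ℓ Ψ)
    (hI : LinearMap.range (Fintype.linearCombination S f) = I)
    (hG : ∀ t (p : Ideal S), p.IsPrime → I ≤ p → t ≤ ℓ → p.height ≤ t → gen I t ⊥ p) (N : ℕ)
    (hN : ℓ ≤ N) :
    ∃ a : ℕ → S, (∀ k, a k ∈ I) ∧
      (∀ i ≤ N, ∀ t (p : Ideal S), p.IsPrime → I ≤ p → i + t ≤ ℓ → p.height ≤ (i + t : ℕ) →
        gen I t (J a i) p) ∧
      (∀ i ≤ N, ∀ p : Ideal S, p.IsPrime → J a i ≤ p → ¬ I ≤ p → (i : ℕ∞) ≤ p.height) ∧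
      (∀ p : Ideal S, p.IsPrime → J a ℓ ≤ p → I ≤ p) := by
  have hk : RingHom.ker Ψ ≤ M0 S m := by
    intro h hh
    have := hF.hker h hh 0
    rw [ev_coeff_zero, pow_zero, Ideal.one_eq_top, Ideal.mul_top] at this
    exact mem_M0.2 this
  let M' : Ideal F := (M0 S m).map Ψ
  have hM' : M'.IsPrime := Ideal.map_isPrime_of_surjective hF.surj hk
  have hFn : IsNoetherianRing F := isNoetherianRing_of_surjective (MvPolynomial (Fin m) S) F Ψ.toRingHom hF.surj
  let L := Localization.AtPrime M'
  have hLn : IsNoetherianRing L := IsLocalization.isNoetherianRing M'.primeCompl L hFn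
  have hLdim : ringKrullDim L ≤ ℓ := by
    rw [IsLocalization.AtPrime.ringKrullDim_eq_height M' L]
    exact (Ideal.height_le_ringKrullDim_of_ne_top hM'.ne_top).trans hF.dim
  let β : (Fin m → S) →ₗ[S] L :=
    (IsScalarTower.toAlgHom S F L).toLinearMap ∘ₗ Ψ.toLinearMap ∘ₗ lin S m
  have hβ' : ∀ c, β c = algebraMap F L (Ψ (lin S m c)) := fun c => rfl
  have hmax : maximalIdeal L = M'.map (algebraMap F L) :=
    (Localization.AtPrime.map_eq_maximalIdeal).symm
  have hβ : ∀ P : Ideal L, P.IsPrime → P ≠ maximalIdeal L → ∃ c, β c ∉ P := by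
    intro P hP hPm
    by_contra hcon
    push Not at hcon
    apply hPm
    refine le_antisymm (le_maximalIdeal hP.ne_top) ?_
    rw [hmax, Ideal.map_le_iff_le_comap, Ideal.map_le_iff_le_comap]
    have h1 : ∀ h : MvPolynomial (Fin m) S, algebraMap F L (Ψ (h -
        MvPolynomial.C (MvPolynomial.constantCoeff h))) ∈ P := by
      intro h
      induction h using MvPolynomial.induction_on with
      | C r => simp
      | add p q hp hq =>
        have := add_mem hp hq
        rw [← map_add, ← map_add] at this
        convert this using 3
        rw [map_add, map_add]; ring
      | mul_X p l hp =>
        have h2 : lin S m (Pi.single l 1) = MvPolynomial.X l := by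
          simp [lin, Fintype.linearCombination_apply_single]
        have h3 := hcon (Pi.single l 1)
        rw [hβ', h2] at h3
        have : MvPolynomial.constantCoeff (p * MvPolynomial.X l) = 0 := by simp
        rw [this, map_zero, sub_zero, map_mul, map_mul]
        exact Ideal.mul_mem_left _ _ h3
    intro h hh
    have h2 := h1 h
    have h3 : Ψ (MvPolynomial.C (MvPolynomial.constantCoeff h)) = 0 := by
      rw [← MvPolynomial.algebraMap_eq, AlgHom.commutes]
      exact hF.hm _ (mem_M0.1 hh)
    rw [map_sub, h3, sub_zero] at h2
    exact h2
  obtain ⟨c, hc⟩ := inv_seq (Fintype.linearCombination S f) β hI hβ hLdim hG N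
  have haI : ∀ k, Fintype.linearCombination S f (c k) ∈ I := fun k => by rw [← hI]; exact ⟨_, rfl⟩
  refine ⟨fun k => Fintype.linearCombination S f (c k), haI, fun i hi => (hc i hi).1, fun i hi => (hc i hi).2.1, ?_⟩
  -- the reduction property
  have h1 : maximalIdeal L ≤ (J (fun k => β (c k)) ℓ).radical := by
    rw [Ideal.radical_eq_sInf]
    refine le_sInf ?_
    rintro P ⟨hJP, hP⟩
    by_contra hle
    have hne : P ≠ maximalIdeal L := fun h => hle h.ge
    have h2 := (hc ℓ hN).2.2 ⟨P, hP⟩ hJP hne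
    have hlt : (⟨P, hP⟩ : PrimeSpectrum L) < ⟨maximalIdeal L, inferInstance⟩ :=
      lt_of_le_of_ne (le_maximalIdeal hP.ne_top) (fun h => hne (congrArg PrimeSpectrum.asIdeal h))
    have h3 := (le_add_self).trans (Order.coheight_add_one_le hlt)
    have h4 : (ℓ : ℕ∞) + 1 ≤ ℓ := le_trans (by gcongr) h2
    exact absurd h4 (by norm_cast; omega)
  obtain ⟨D, hD⟩ := Ideal.exists_pow_le_of_le_radical_of_fg h1 (IsNoetherian.noetherian _)
  set a : ℕ → S := fun k => Fintype.linearCombination S f (c k) with ha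
  have h2 : I ^ D ≤ J a ℓ ⊔ maximalIdeal S • I ^ D := by
    intro x hx
    rw [← hI] at hx
    obtain ⟨t, ht, et⟩ := exists_lift f D x hx
    rw [hI] at hx
    have h3 : algebraMap F L (Ψ t) ∈ J (fun k => β (c k)) ℓ := by
      apply hD
      rw [hmax, ← Ideal.map_pow, ← Ideal.map_pow]
      exact Ideal.mem_map_of_mem _ (Ideal.mem_map_of_mem _ ht)
    have h4 : J (fun k => β (c k)) ℓ =
        ((J (fun k => lin S m (c k)) ℓ).map (Ψ : MvPolynomial (Fin m) S →+* F)).map (algebraMap F L) := by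
      rw [J_map, J_map]; rfl
    rw [h4, IsLocalization.algebraMap_mem_map_algebraMap_iff M'.primeCompl] at h3
    obtain ⟨u, hu, h5⟩ := h3
    obtain ⟨u, rfl⟩ := hF.surj u
    have hu0 : u ∉ M0 S m := fun h => hu (Ideal.mem_map_of_mem _ h)
    have h5' := (Ideal.mem_map_iff_of_surjective (Ψ : MvPolynomial (Fin m) S →+* F)
      (show Function.Surjective (Ψ : MvPolynomial (Fin m) S →+* F) from hF.surj)).1 h5
    obtain ⟨j, hj, hje⟩ := h5'
    have hje' : Ψ j = Ψ u * Ψ t := hje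
    have h6 : Ψ (u * t - j) = 0 := by
      rw [map_sub, map_mul, sub_eq_zero]; exact hje'.symm
    have h7 := hF.hker _ h6 D
    have h8 : (ev f j).coeff D ∈ J a ℓ := by
      refine Ideal.mem_map_C_iff.1 ?_ D
      have h9 : ev f j ∈ (J (fun k => lin S m (c k)) ℓ).map (ev f : MvPolynomial (Fin m) S →+* Polynomial S) :=
        Ideal.mem_map_of_mem _ hj
      rw [J_map] at h9
      refine (Ideal.span_le.2 ?_ : J _ ℓ ≤ _) h9
      rintro _ ⟨k, hk, rfl⟩
      have : (ev f) (lin S m (c k)) = Polynomial.C (a k) * Polynomial.X := ev_lin f (c k)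
      show (ev f) (lin S m (c k)) ∈ _
      rw [this]
      exact Ideal.mul_mem_right _ _ (Ideal.mem_map_of_mem _ (mem_J a hk))
    rw [map_sub, map_mul, et, Polynomial.coeff_sub, ← mul_assoc, Polynomial.coeff_mul_X_pow',
      if_pos le_rfl, Nat.sub_self, Polynomial.coeff_mul_C, ev_coeff_zero] at h7
    have hunit : IsUnit (MvPolynomial.constantCoeff u) := by
      by_contra h
      exact hu0 (mem_M0.2 h)
    rw [← Ideal.unit_mul_mem_iff_mem _ hunit]
    have := add_mem (Ideal.mem_sup_right h7 : _ ∈ J a ℓ ⊔ _) (Ideal.mem_sup_left h8)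
    rw [sub_add_cancel] at this
    exact this
  have h3 : I ^ D ≤ J a ℓ := Submodule.le_of_le_smul_of_le_jacobson_bot (IsNoetherian.noetherian _)
    (by rw [IsLocalRing.jacobson_eq_maximalIdeal _ bot_ne_top]) h2
  intro p hp hJ
  exact hp.le_of_pow_le (h3.trans hJ)

end E3
end LT

set_option linter.unusedSectionVars false
set_option linter.unusedVariables false
namespace LT

open IsLocalRing

lemma general_concl {S F : Type u} [CommRing S] [IsLocalRing S] [IsNoetherianRing S] [CommRing F]
    [Algebra S F] {m : ℕ} [Infinite (ResidueField S)] {f : Fin m → S} {I : Ideal S} {d g ℓ : ℕ}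
    {Ψ : MvPolynomial (Fin m) S →ₐ[S] F} (hF : Fib S F f I ℓ Ψ)
    (hI : LinearMap.range (Fintype.linearCombination S f) = I) (hIm : I ≤ maximalIdeal S)
    (cm : IsCM S d) (g1 : 1 ≤ g) (htI : HtGe I g)
    (hG : ∀ t (p : Ideal S), p.IsPrime → I ≤ p → t ≤ ℓ → p.height ≤ t → gen I t ⊥ p)
    (ext : ∀ j, 1 ≤ j → j + g ≤ ℓ → j + g + 1 ≤ d → Subsingleton (E S ↥(I ^ j) S (g + j - 1))) :
    ∃ (a : ℕ → S) (n : ℕ), (∀ k, a k ∈ I) ∧ Concl n I a := by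
  obtain ⟨a, haI, hA, hB, hC⟩ := exists_general hF hI hG (ℓ + d) (by omega)
  have hg0 : ∀ i (p : Ideal S), K a I i ≤ p → ¬ gen I 0 (J a i) p := by
    intro i p hp hg
    obtain ⟨s, hs, h⟩ := gen_zero.1 hg
    exact hs (hp h)
  have hIK : ∀ i ≤ ℓ, ∀ p : Ideal S, p.IsPrime → I ≤ p → K a I i ≤ p → ((i + 1 : ℕ) : ℕ∞) ≤ p.height := by
    intro i hi p hp hIp hK
    by_contra hlt
    push Not at hlt
    refine hg0 i p hK (hA i (by omega) 0 p hp hIp (by omega) ?_)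
    rw [Nat.cast_add, Nat.cast_one] at hlt
    exact ENat.lt_add_one_iff (by simp) |>.1 hlt
  refine ⟨a, min ℓ d, haI, core d S g (min ℓ d) I a ⟨cm, g1, htI, haI, ?_, ?_, ?_, ?_⟩⟩
  · intro i hi p hp hK
    by_cases hIp : I ≤ p
    · exact le_trans (by norm_cast; omega) (hIK i (by omega) p hp hIp hK)
    · exact hB i (by omega) p hp ((J_le_K a I i).trans hK) hIp
  · intro i hi p hp hK
    exact hIK i (by omega) p hp (le_sup_left.trans hK) (le_sup_right.trans hK)
  · intro p hp hK
    by_cases hIp : I ≤ p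
    · exact hIK _ (by omega) p hp hIp hK
    have hJ := (J_le_K a I _).trans hK
    rcases le_total ℓ d with h | h
    · rw [min_eq_left h] at hJ
      exact absurd (hC p hp hJ) hIp
    · rw [min_eq_right h] at hJ
      have h1 := hB d (by omega) p hp hJ hIp
      exfalso
      apply hIp
      have : p = maximalIdeal S := by
        by_contra hne
        have hlt : p < maximalIdeal S := lt_of_le_of_ne (le_maximalIdeal hp.ne_top) hne
        have h2 := Ideal.height_add_one_le_of_lt_of_isPrime hlt
        rw [cm.height_max] at h2
        have h3 : (d : ℕ∞) + 1 ≤ d := le_trans (by gcongr) h2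
        exact absurd h3 (by norm_cast; omega)
      rw [this]; exact hIm
  · intro j h1 h2 h3
    exact ext j h1 (by omega) h3
end LT

set_option linter.unusedSectionVars false
set_option linter.unusedVariables false
namespace LT

open IsLocalRing

section F1
variable {A B : Type u} [CommRing A] [CommRing B] [Algebra A B] [Algebra.IsIntegral A B]

lemma dim_le_of_integral : ringKrullDim B ≤ ringKrullDim A := by
  refine Order.krullDim_le_of_strictMono (PrimeSpectrum.comap (algebraMap A B)) ?_
  intro P Q h
  have := P.2
  obtain ⟨hle, hn⟩ := h
  have hlt : P.asIdeal < Q.asIdeal := lt_of_le_not_ge hle hn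
  obtain ⟨x, hxQ, hxP⟩ := SetLike.exists_of_lt hlt
  exact Ideal.comap_lt_comap_of_integral_mem_sdiff hle ⟨hxQ, hxP⟩ (Algebra.IsIntegral.isIntegral x)

lemma coheight_le_of_integral (n : ℕ) : ∀ P : PrimeSpectrum B, Order.coheight P ≤ n →
    Order.coheight (PrimeSpectrum.comap (algebraMap A B) P) ≤ n := by
  induction n using Nat.strong_induction_on with
  | _ n ih =>
    intro P hP
    rw [Order.coheight_le_coe_iff] at hP ⊢
    intro q hq
    have := P.2
    have := q.2
    obtain ⟨Q, hQP, hQ, hQq⟩ := Ideal.exists_ideal_over_prime_of_isIntegral_of_isPrime q.asIdeal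
      P.asIdeal (le_of_lt hq)
    have hlt : P < ⟨Q, hQ⟩ := lt_of_le_of_ne hQP (by
      rintro rfl
      exact hq.ne (PrimeSpectrum.ext hQq))
    have h1 := hP ⟨Q, hQ⟩ hlt
    rcases n with _ | n
    · exact absurd h1 (by simp)
    · have h2 := ih n (by omega) ⟨Q, hQ⟩ (by
        rw [Nat.cast_add, Nat.cast_one] at h1
        exact (ENat.lt_add_one_iff (by simp)).1 h1)
      have h3 : q = PrimeSpectrum.comap (algebraMap A B) ⟨Q, hQ⟩ := PrimeSpectrum.ext hQq.symm
      rw [h3]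
      exact lt_of_le_of_lt h2 (by norm_cast; omega)

end F1

lemma dim_baseChange (k k' A : Type u) [Field k] [Field k'] [Algebra k k'] [CommRing A]
    [Algebra k A] [Algebra.FiniteType k A] (ℓ : ℕ) (h : ringKrullDim A = ℓ) :
    ringKrullDim (k' ⊗[k] A) ≤ ℓ := by
  have : Nontrivial A := by
    by_contra hn
    rw [not_nontrivial_iff_subsingleton] at hn
    rw [ringKrullDim_eq_bot_of_subsingleton] at h
    exact absurd h (by simp)
  obtain ⟨s, φ, hinj, hfin⟩ := exists_finite_inj_algHom_of_fg k A
  let P := MvPolynomial (Fin s) k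
  letI : Algebra P A := φ.toRingHom.toAlgebra
  have hIntg : Algebra.IsIntegral P A := by
    have : Module.Finite P A := hfin
    infer_instance
  -- s ≤ ℓ
  have hs : s ≤ ℓ := by
    obtain ⟨Q, -, hQ, hQb⟩ := Ideal.exists_ideal_over_prime_of_isIntegral (R := P) (S := A) ⊥ ⊥ (by
      have : Ideal.comap (algebraMap P A) ⊥ = ⊥ := by
        rw [← RingHom.ker_eq_comap_bot]
        exact (RingHom.injective_iff_ker_eq_bot _).1 hinj
      rw [this])
    have h1 : (Order.coheight (⟨Q, hQ⟩ : PrimeSpectrum A) : WithBot ℕ∞) ≤ ℓ := by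
      rw [← h]; exact Order.coheight_le_krullDim _
    have h2 := coheight_le_of_integral (A := P) ℓ ⟨Q, hQ⟩ (by exact_mod_cast h1)
    have h3 : PrimeSpectrum.comap (algebraMap P A) ⟨Q, hQ⟩ = ⊥ := PrimeSpectrum.ext hQb
    have h4 : (Order.coheight (⊥ : PrimeSpectrum P) : WithBot ℕ∞) = s := by
      rw [Order.coheight_bot_eq_krullDim]
      have := MvPolynomial.ringKrullDim_of_isNoetherianRing (R := k) (ι := Fin s)
      rw [ringKrullDim_eq_zero_of_field, zero_add, Nat.card_fin] at this
      exact this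
    rw [h3] at h2
    have h5 : (Order.coheight (⊥ : PrimeSpectrum P) : WithBot ℕ∞) ≤ (ℓ : ℕ∞) := by exact_mod_cast h2
    rw [h4] at h5
    exact_mod_cast h5
  -- base change is integral
  let φ' : MvPolynomial (Fin s) k' →ₐ[k'] (k' ⊗[k] A) :=
    (Algebra.TensorProduct.map (AlgHom.id k' k') φ).comp
      (MvPolynomial.algebraTensorAlgEquiv (σ := Fin s) k k').symm.toAlgHom
  letI : Algebra (MvPolynomial (Fin s) k') (k' ⊗[k] A) := φ'.toRingHom.toAlgebra
  have hφA : ∀ x : A, φ.toRingHom.IsIntegralElem x := fun x => hIntg.isIntegral x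
  have hIntg' : Algebra.IsIntegral (MvPolynomial (Fin s) k') (k' ⊗[k] A) := by
    constructor
    intro z
    induction z using TensorProduct.induction_on with
    | zero => exact isIntegral_zero
    | add x y hx hy => exact hx.add hy
    | tmul c x =>
      have e : c ⊗ₜ[k] x = (algebraMap (MvPolynomial (Fin s) k') (k' ⊗[k] A) (MvPolynomial.C c)) *
          ((1 : k') ⊗ₜ[k] x) := by
        have : algebraMap (MvPolynomial (Fin s) k') (k' ⊗[k] A) (MvPolynomial.C c) =
          φ' (algebraMap _ _ c) := rfl
        rw [this, AlgHom.commutes, Algebra.TensorProduct.algebraMap_apply,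
          Algebra.TensorProduct.tmul_mul_tmul]
        simp
      rw [e]
      refine isIntegral_algebraMap.mul ?_
      let ψ : P →+* MvPolynomial (Fin s) k' := MvPolynomial.map (algebraMap k k')
      have hcomp : (algebraMap (MvPolynomial (Fin s) k') (k' ⊗[k] A)).comp ψ =
          (Algebra.TensorProduct.includeRight : A →ₐ[k] k' ⊗[k] A).toRingHom.comp (algebraMap P A) := by
        refine RingHom.ext fun p => ?_
        show φ' (MvPolynomial.map (algebraMap k k') p) = (1 : k') ⊗ₜ[k] (φ p)
        simp only [φ', AlgHom.comp_apply]
        have : (MvPolynomial.algebraTensorAlgEquiv (σ := Fin s) k k').symm.toAlgHom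
          (MvPolynomial.map (algebraMap k k') p) = 1 ⊗ₜ p :=
          MvPolynomial.algebraTensorAlgEquiv_symm_map (σ := Fin s) k k' p
        rw [this]
        simp
      exact (Algebra.IsIntegral.isIntegral (R := P) x).map_of_comp_eq ψ
        (Algebra.TensorProduct.includeRight : A →ₐ[k] k' ⊗[k] A).toRingHom hcomp
  refine (dim_le_of_integral (A := MvPolynomial (Fin s) k')).trans ?_
  rw [MvPolynomial.ringKrullDim_of_isNoetherianRing, ringKrullDim_eq_zero_of_field, zero_add,
    Nat.card_fin]
  exact_mod_cast hs
end LT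

set_option linter.unusedSectionVars false
set_option linter.unusedVariables false
namespace LT

open IsLocalRing

lemma dim_fib {R S F : Type u} [CommRing R] [IsLocalRing R] [CommRing S] [IsLocalRing S]
    [Algebra R S] [IsLocalHom (algebraMap R S)] [CommRing F] [Algebra R F] [Algebra.FiniteType R F]
    (hR : ∀ r ∈ maximalIdeal R, algebraMap R F r = 0)
    (hS : ∀ s ∈ maximalIdeal S, algebraMap S (S ⊗[R] F) s = 0) (ℓ : ℕ)
    (h : ringKrullDim F = ℓ) : ringKrullDim (S ⊗[R] F) ≤ ℓ := by
  let α : ResidueField R →+* F := Ideal.Quotient.lift (maximalIdeal R) (algebraMap R F) hR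
  let β : ResidueField S →+* S ⊗[R] F := Ideal.Quotient.lift (maximalIdeal S) (algebraMap S _) hS
  let γ : ResidueField R →+* S ⊗[R] F :=
    (Algebra.TensorProduct.includeRight : F →ₐ[R] S ⊗[R] F).toRingHom.comp α
  let _ : Algebra (ResidueField R) F := α.toAlgebra
  let _ : Algebra (ResidueField S) (S ⊗[R] F) := β.toAlgebra
  let _ : Algebra (ResidueField R) (S ⊗[R] F) := γ.toAlgebra
  have hα : ∀ r, algebraMap (ResidueField R) F (residue R r) = algebraMap R F r := fun r => rfl
  have hβ : ∀ r, algebraMap (ResidueField S) (S ⊗[R] F) (residue S r) = algebraMap S _ r :=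
    fun r => rfl
  have hγ : ∀ x, algebraMap (ResidueField R) (S ⊗[R] F) x =
    (1 : S) ⊗ₜ[R] algebraMap (ResidueField R) F x := fun r => rfl
  have t1 : IsScalarTower R (ResidueField R) F := IsScalarTower.of_algebraMap_eq fun r => (hα r).symm
  have t2 : IsScalarTower (ResidueField R) (ResidueField S) (S ⊗[R] F) := by
    refine IsScalarTower.of_algebraMap_eq fun x => ?_
    obtain ⟨r, rfl⟩ := residue_surjective x
    have : algebraMap (ResidueField R) (ResidueField S) (residue R r) = residue S (algebraMap R S r) := rfl
    rw [this, hβ, hγ, hα, Algebra.TensorProduct.algebraMap_apply, Algebra.algebraMap_self_apply]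
    rw [Algebra.algebraMap_eq_smul_one r, Algebra.algebraMap_eq_smul_one r, TensorProduct.smul_tmul]
  have ft : Algebra.FiniteType (ResidueField R) F :=
    Algebra.FiniteType.of_restrictScalars_finiteType R _ _
  let ir : F →ₐ[ResidueField R] S ⊗[R] F :=
    { (Algebra.TensorProduct.includeRight : F →ₐ[R] S ⊗[R] F).toRingHom with
      commutes' := fun x => (hγ x).symm }
  let θ : ResidueField S ⊗[ResidueField R] F →ₐ[ResidueField S] S ⊗[R] F :=
    Algebra.TensorProduct.lift (Algebra.ofId _ _) ir (fun _ _ => Commute.all _ _)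
  have hθ : Function.Surjective θ.toRingHom := by
    intro z
    induction z with
    | zero => exact ⟨0, map_zero _⟩
    | add x y hx hy =>
      obtain ⟨a, rfl⟩ := hx
      obtain ⟨b, rfl⟩ := hy
      exact ⟨a + b, map_add _ _ _⟩
    | tmul s x =>
      refine ⟨residue S s ⊗ₜ x, ?_⟩
      show θ (residue S s ⊗ₜ x) = _
      rw [Algebra.TensorProduct.lift_tmul]
      show algebraMap (ResidueField S) (S ⊗[R] F) (residue S s) * ((1 : S) ⊗ₜ[R] x) = _
      rw [hβ, Algebra.TensorProduct.algebraMap_apply, Algebra.TensorProduct.tmul_mul_tmul]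
      simp
  exact (ringKrullDim_le_of_surjective _ hθ).trans (dim_baseChange _ _ _ ℓ h)

section
variable {R : Type u} [CommRing R] [IsLocalRing R] {I : Ideal R} {m : ℕ}

lemma rees_gen {f₀ : Fin m → ↥I} (hf : Submodule.span R (Set.range f₀) = ⊤) :
    Function.Surjective (MvPolynomial.aeval (R := R) (fun l => reesι R ↥I (f₀ l))) := by
  let q : SymModAlg R ↥I →ₐ[R] ReesModAlg R ↥I := Ideal.Quotient.mkₐ R _
  have hq : Function.Surjective q := Ideal.Quotient.mkₐ_surjective R _
  rw [← AlgHom.range_eq_top, eq_top_iff, ← (AlgHom.range_eq_top q).2 hq, ← Algebra.map_top,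
    ← symι_gen, AlgHom.map_adjoin, Algebra.adjoin_le_iff]
  rintro _ ⟨_, ⟨x, rfl⟩, rfl⟩
  have hx : x ∈ Submodule.span R (Set.range f₀) := hf ▸ Submodule.mem_top
  have : Submodule.span R (Set.range f₀) ≤ ((MvPolynomial.aeval (R := R)
      (fun l => reesι R ↥I (f₀ l))).range.toSubmodule).comap (q.toLinearMap ∘ₗ symι ↥I) := by
    rw [Submodule.span_le]
    rintro _ ⟨l, rfl⟩
    exact ⟨MvPolynomial.X l, by simp; rfl⟩
  exact this hx

/-- the special fiber ring -/
abbrev SF (R : Type u) [CommRing R] [IsLocalRing R] (I : Ideal R) : Type u :=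
  ReesModAlg R ↥I ⧸ fiberIdeal R ↥I

/-- canonical map to the special fiber ring -/
def sfι (x : ↥I) : SF R I := Ideal.Quotient.mk _ (reesι R ↥I x)

lemma sf_gen {f₀ : Fin m → ↥I} (hf : Submodule.span R (Set.range f₀) = ⊤) :
    Function.Surjective (MvPolynomial.aeval (R := R) (fun l => sfι (f₀ l))) := by
  have e : MvPolynomial.aeval (R := R) (fun l => sfι (f₀ l)) =
    (Ideal.Quotient.mkₐ R (fiberIdeal R ↥I)).comp
      (MvPolynomial.aeval (R := R) (fun l => reesι R ↥I (f₀ l))) := by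
    apply MvPolynomial.algHom_ext
    intro l
    simp [sfι]
  rw [e]
  exact (Ideal.Quotient.mkₐ_surjective R _).comp (rees_gen hf)

lemma sf_max (r : R) (hr : r ∈ maximalIdeal R) : algebraMap R (SF R I) r = 0 := by
  have : algebraMap R (SF R I) r = Ideal.Quotient.mk _ (algebraMap R (ReesModAlg R ↥I) r) := rfl
  rw [this, Ideal.Quotient.eq_zero_iff_mem]
  exact Ideal.mem_map_of_mem _ hr

variable {S : Type u} [CommRing S] [IsLocalRing S] [Algebra R S] [Module.Flat R S]

/-- Rees algebra map to an honest Rees algebra -/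
lemma exists_rho : ∃ ρ : ReesModAlg R ↥I →ₐ[R] reesAlgebra (I.map (algebraMap R S)),
    ∀ x : ↥I, ((ρ (reesι R ↥I x) : _) : Polynomial S) =
      Polynomial.C (algebraMap R S x) * Polynomial.X := by
  let φ : ↥I →ₗ[R] reesAlgebra (I.map (algebraMap R S)) :=
    { toFun := fun x => ⟨Polynomial.monomial 1 (algebraMap R S x), by
        refine reesAlgebra.monomial_mem.2 ?_
        rw [pow_one]; exact Ideal.mem_map_of_mem _ x.2⟩
      map_add' := fun x y => by ext1; simp
      map_smul' := fun r x => by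
        ext1
        simp [Algebra.smul_def, Polynomial.C_mul_monomial, IsScalarTower.algebraMap_apply R S (Polynomial S)] }
  have hker : ∀ a ∈ torsionIdeal R (SymModAlg R ↥I), symLift φ a = 0 := by
    rintro a ⟨r, hr, ha⟩
    have h1 : r • symLift φ a = 0 := by rw [← map_smul, ha, map_zero]
    have hreg : IsSMulRegular S (algebraMap R S r) := IsSMulRegular.of_flat (by
      have := mem_nonZeroDivisors_iff_right.1 hr
      exact isSMulRegular_iff_right_eq_zero_of_smul.2 (fun x hx => this x (by
        rw [mul_comm]; exact hx)))
    ext1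
    apply Polynomial.ext
    intro n
    have h2 := congrArg (fun z : reesAlgebra (I.map (algebraMap R S)) => (z : Polynomial S).coeff n) h1
    have h3 : algebraMap R S r • ((symLift φ a : _) : Polynomial S).coeff n = 0 := by
      simpa [Algebra.smul_def] using h2
    simpa using hreg.right_eq_zero_of_smul h3
  refine ⟨Ideal.Quotient.liftₐ _ (symLift φ) hker, fun x => ?_⟩
  have : Ideal.Quotient.liftₐ _ (symLift φ) hker (reesι R ↥I x) = symLift φ (symι _ x) := rfl
  rw [this, symLift_ι]
  simp [φ, Polynomial.C_mul_X_eq_monomial]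

lemma coeff_of_map {I' : Ideal S} {z : reesAlgebra I'}
    (hz : z ∈ (maximalIdeal S).map (algebraMap S (reesAlgebra I'))) (e : ℕ) :
    (z : Polynomial S).coeff e ∈ maximalIdeal S * I' ^ e := by
  induction hz using Submodule.span_induction generalizing e with
  | mem x hx =>
    obtain ⟨r, hr, rfl⟩ := hx
    have : ((algebraMap S (reesAlgebra I') r : _) : Polynomial S) = Polynomial.C r := rfl
    rw [this, Polynomial.coeff_C]
    split_ifs with h
    · subst h; simpa using hr
    · exact zero_mem _
  | zero => simp
  | add x y _ _ hx hy =>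
    rw [AddMemClass.coe_add, Polynomial.coeff_add]
    exact add_mem (hx e) (hy e)
  | smul a x _ hx =>
    rw [smul_eq_mul, MulMemClass.coe_mul, Polynomial.coeff_mul]
    refine Ideal.sum_mem _ fun ij hij => ?_
    rw [Finset.HasAntidiagonal.mem_antidiagonal] at hij
    rw [← hij, pow_add, mul_left_comm]
    exact Ideal.mul_mem_mul (a.2 _) (hx _)

lemma fib_core [IsLocalHom (algebraMap R S)] {F : Type u} [CommRing F] [Algebra R F]
    (hm : (maximalIdeal R).map (algebraMap R S) = maximalIdeal S) {ℓ : ℕ}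
    (hl : ringKrullDim F = ℓ) (hR : ∀ r ∈ maximalIdeal R, algebraMap R F r = 0)
    {u : Fin m → F} (hsur : Function.Surjective (MvPolynomial.aeval (R := R) u))
    {I' : Ideal S} {f : Fin m → S} (z : Fin m → reesAlgebra I')
    (hz : ∀ l, (z l : Polynomial S) = Polynomial.C (f l) * Polynomial.X)
    {B : Type u} [CommRing B] [Algebra S B] [Algebra R B] [IsScalarTower R S B]
    (π : reesAlgebra I' →ₐ[S] B)
    (hπ : ∀ z, π z = 0 → z ∈ (maximalIdeal S).map (algebraMap S (reesAlgebra I')))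
    (σ : F →ₐ[R] B) (hσ : ∀ l, σ (u l) = π (z l)) :
    ∃ Ψ : MvPolynomial (Fin m) S →ₐ[S] (S ⊗[R] F), Fib S (S ⊗[R] F) f I' ℓ Ψ := by
  have hmS : ∀ s ∈ maximalIdeal S, algebraMap S (S ⊗[R] F) s = 0 := by
    intro s hs
    rw [← hm] at hs
    have : (maximalIdeal R).map (algebraMap R S) ≤ RingHom.ker (algebraMap S (S ⊗[R] F)) := by
      rw [Ideal.map_le_iff_le_comap]
      intro r hr
      show algebraMap S (S ⊗[R] F) (algebraMap R S r) = 0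
      rw [← IsScalarTower.algebraMap_apply, Algebra.TensorProduct.algebraMap_apply',
        hR r hr, TensorProduct.tmul_zero]
    exact this hs
  have ft : Algebra.FiniteType R F := Algebra.FiniteType.of_surjective _ hsur
  refine ⟨MvPolynomial.aeval fun l => (1 : S) ⊗ₜ[R] u l, ?_, hmS, ?_, ?_⟩
  · intro z
    induction z with
    | zero => exact ⟨0, map_zero _⟩
    | add x y hx hy =>
      obtain ⟨a, rfl⟩ := hx
      obtain ⟨b, rfl⟩ := hy
      exact ⟨a + b, map_add _ _ _⟩
    | tmul s x =>
      obtain ⟨p, rfl⟩ := hsur x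
      refine ⟨MvPolynomial.C s * MvPolynomial.map (algebraMap R S) p, ?_⟩
      rw [map_mul, MvPolynomial.aeval_C, MvPolynomial.aeval_map_algebraMap,
        MvPolynomial.aeval_one_tmul, Algebra.TensorProduct.algebraMap_apply,
        Algebra.TensorProduct.tmul_mul_tmul]
      simp
  · intro h hh e
    let Φ : S ⊗[R] F →ₐ[S] B :=
      Algebra.TensorProduct.lift (Algebra.ofId _ _) σ (fun _ _ => Commute.all _ _)
    let Z : MvPolynomial (Fin m) S →ₐ[S] reesAlgebra I' := MvPolynomial.aeval z
    have hZ : (reesAlgebra I').val.comp Z = ev f := by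
      apply MvPolynomial.algHom_ext
      intro l
      simp [Z, ev, hz]
    have hΦ : Φ.comp (MvPolynomial.aeval fun l => (1 : S) ⊗ₜ[R] u l) = π.comp Z := by
      apply MvPolynomial.algHom_ext
      intro l
      simp only [AlgHom.comp_apply, MvPolynomial.aeval_X, Z, Φ, Algebra.TensorProduct.lift_tmul,
        map_one, one_mul]
      exact hσ l
    have h0 : π (Z h) = 0 := by
      have := DFunLike.congr_fun hΦ h
      rw [AlgHom.comp_apply, hh, map_zero] at this
      exact this.symm
    have h2 := coeff_of_map (hπ _ h0) e
    rw [← hZ]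
    exact h2
  · exact dim_fib hR hmS ℓ hl

lemma exists_fib [IsLocalHom (algebraMap R S)]
    (hm : (maximalIdeal R).map (algebraMap R S) = maximalIdeal S) {ℓ : ℕ}
    (hl : analyticSpread R ↥I = ℓ) {f₀ : Fin m → ↥I} (hf : Submodule.span R (Set.range f₀) = ⊤) :
    ∃ (F : Type u) (_ : CommRing F) (_ : Algebra S F) (Ψ : MvPolynomial (Fin m) S →ₐ[S] F),
      Fib S F (fun l => algebraMap R S (f₀ l)) (I.map (algebraMap R S)) ℓ Ψ := by
  obtain ⟨ρ, hρ⟩ := exists_rho (I := I) (S := S)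
  let N := (maximalIdeal S).map (algebraMap S (reesAlgebra (I.map (algebraMap R S))))
  let π : reesAlgebra (I.map (algebraMap R S)) →ₐ[S] reesAlgebra (I.map (algebraMap R S)) ⧸ N := Ideal.Quotient.mkₐ S N
  let σ : SF R I →ₐ[R] reesAlgebra (I.map (algebraMap R S)) ⧸ N :=
    Ideal.Quotient.liftₐ _ ((π.restrictScalars R).comp ρ) (by
      intro a ha
      have : fiberIdeal R ↥I ≤ RingHom.ker ((π.restrictScalars R).comp ρ) := by
        rw [fiberIdeal, Ideal.map_le_iff_le_comap]
        intro r hr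
        show (π.restrictScalars R).comp ρ (algebraMap R _ r) = 0
        rw [AlgHom.commutes]
        have : algebraMap R (reesAlgebra (I.map (algebraMap R S)) ⧸ N) r = Ideal.Quotient.mk N
          (algebraMap S (reesAlgebra (I.map (algebraMap R S))) (algebraMap R S r)) := rfl
        rw [this, Ideal.Quotient.eq_zero_iff_mem]
        refine Ideal.mem_map_of_mem _ ?_
        rw [← hm]
        exact Ideal.mem_map_of_mem _ hr
      exact this ha)
  have hσ : ∀ l, σ (sfι (f₀ l)) = π (ρ (reesι R ↥I (f₀ l))) := fun l => rfl
  obtain ⟨Ψ, hΨ⟩ := fib_core (F := SF R I) (B := reesAlgebra (I.map (algebraMap R S)) ⧸ N)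
    hm hl sf_max (sf_gen hf) (fun l => ρ (reesι R ↥I (f₀ l)))
    (fun l => hρ _) π (fun z hz => Ideal.Quotient.eq_zero_iff_mem.1 hz) σ hσ
  exact ⟨_, _, _, Ψ, hΨ⟩
end
end LT

set_option linter.unusedSectionVars false
set_option linter.unusedVariables false
namespace LT

open IsLocalRing

lemma gens_localized {R M : Type u} [CommRing R] [AddCommGroup M] [Module R M] [Module.Finite R M]
    (P : Submonoid R) {n : ℕ} (f : Fin n → LocalizedModule P M)
    (hf : Submodule.span (Localization P) (Set.range f) = ⊤) :
    ∃ (x : Fin n → M) (s : R), s ∈ P ∧ ∀ y, s • y ∈ Submodule.span R (Set.range x) := by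
  classical
  have h1 : ∀ i, ∃ (x : M) (s : P), f i = LocalizedModule.mk x s := by
    intro i
    induction f i using LocalizedModule.induction_on with
    | _ m s => exact ⟨m, s, rfl⟩
  choose x s hx using h1
  have h2 : (Submodule.span R (Set.range x)).localized' (Localization P) P
      (LocalizedModule.mkLinearMap P M) = ⊤ := by
    rw [eq_top_iff, ← hf, Submodule.span_le]
    rintro _ ⟨i, rfl⟩
    rw [SetLike.mem_coe, Submodule.mem_localized']
    exact ⟨x i, Submodule.subset_span ⟨i, rfl⟩, s i, by
      rw [hx i, ← IsLocalizedModule.mk_eq_mk']⟩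
  have h3 : ∀ y : M, ∃ r : R, r ∈ P ∧ r • y ∈ Submodule.span R (Set.range x) := by
    intro y
    have : LocalizedModule.mkLinearMap P M y ∈ (⊤ : Submodule (Localization P) _) := trivial
    rw [← h2, Submodule.mem_localized'] at this
    obtain ⟨z, hz, t, e⟩ := this
    rw [← IsLocalizedModule.mk_eq_mk', LocalizedModule.mkLinearMap_apply, LocalizedModule.mk_eq] at e
    obtain ⟨u, hu⟩ := e
    refine ⟨u * t, mul_mem u.2 t.2, ?_⟩
    have : ((u : R) * t) • y = (u : R) • z := by
      rw [mul_smul]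
      have := hu.symm
      simpa [Submonoid.smul_def] using this
    rw [this]
    exact Submodule.smul_mem _ _ hz
  choose r hr1 hr2 using h3
  obtain ⟨T, hT⟩ := (Module.Finite.fg_top : (⊤ : Submodule R M).FG)
  refine ⟨x, ∏ y ∈ T, r y, prod_mem fun y _ => hr1 y, fun y => ?_⟩
  have : Submodule.span R (T : Set M) ≤ (Submodule.span R (Set.range x)).comap
      (LinearMap.lsmul R M (∏ y ∈ T, r y)) := by
    rw [Submodule.span_le]
    intro z hz
    show (∏ y ∈ T, r y) • z ∈ Submodule.span R (Set.range x)
    rw [← Finset.prod_erase_mul T r hz, mul_smul]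
    exact Submodule.smul_mem _ _ (hr2 z)
  exact this (hT ▸ Submodule.mem_top)

lemma gen_of_minGens {R : Type u} [CommRing R] [IsNoetherianRing R] {I p : Ideal R} (hp : p.IsPrime)
    {t : ℕ} (h : minGens (Localization (primeCompl' R p hp)) (LocalizedModule (primeCompl' R p hp) ↥I) ≤ t) :
    gen I t ⊥ p := by
  classical
  have hne : {n | ∃ f : Fin n → LocalizedModule (primeCompl' R p hp) ↥I,
      Submodule.span (Localization (primeCompl' R p hp)) (Set.range f) = ⊤}.Nonempty := by
    obtain ⟨n, f, hf⟩ := Submodule.fg_iff_exists_fin_generating_family.1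
      (Module.Finite.fg_top (R := Localization (primeCompl' R p hp))
        (M := LocalizedModule (primeCompl' R p hp) ↥I))
    exact ⟨n, f, hf⟩
  obtain ⟨f, hf⟩ := Nat.sInf_mem hne
  obtain ⟨x, s, hs, hx⟩ := gens_localized _ f hf
  refine ⟨s, hs, Finset.univ.image (fun i => (x i : R)), ?_, ?_, ?_⟩
  · refine Finset.card_image_le.trans ?_
    rw [Finset.card_univ, Fintype.card_fin]
    exact h
  · intro v hv
    obtain ⟨i, -, rfl⟩ := Finset.mem_image.1 hv
    exact (x i).2
  · intro y hy
    refine Ideal.mem_sup_right ?_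
    have := Submodule.mem_map_of_mem (f := I.subtype) (hx ⟨y, hy⟩)
    rw [Submodule.map_span, ← Set.range_comp] at this
    rw [Finset.coe_image, Finset.coe_univ, Set.image_univ]
    exact this

lemma gen_map {R S : Type u} [CommRing R] [CommRing S] [Algebra R S] {I : Ideal R} {q : Ideal S} {t : ℕ}
    (h : gen I t ⊥ (q.under R)) : gen (I.map (algebraMap R S)) t ⊥ q := by
  classical
  obtain ⟨s, hs, F, hF, hFI, hx⟩ := h
  refine ⟨algebraMap R S s, hs, F.image (algebraMap R S), Finset.card_image_le.trans hF, ?_, ?_⟩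
  · intro v hv
    obtain ⟨w, hw, rfl⟩ := Finset.mem_image.1 hv
    exact Ideal.mem_map_of_mem _ (hFI w hw)
  · intro x hxI
    rw [bot_sup_eq, Finset.coe_image, ← Ideal.map_span]
    have : (Ideal.span {s} * I) ≤ Ideal.span (F : Set R) := by
      rw [Ideal.span_singleton_mul_le_iff]
      intro z hz
      simpa using hx z hz
    have h2 := Ideal.map_mono (f := algebraMap R S) this
    refine h2 ?_
    rw [Ideal.map_mul]
    exact Ideal.mul_mem_mul (Ideal.mem_map_of_mem _ (Ideal.mem_span_singleton_self s)) hxI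

lemma localDim_eq {R : Type u} [CommRing R] (p : Ideal R) (hp : p.IsPrime) :
    localDimAt R p hp = (p.height : WithBot ℕ∞) :=
  IsLocalization.AtPrime.ringKrullDim_eq_height p (Localization.AtPrime p)

lemma under_height {R S : Type u} [CommRing R] [IsNoetherianRing R] [CommRing S] [IsNoetherianRing S]
    [Algebra R S] [Module.Flat R S] (q : Ideal S) [q.IsPrime] : (q.under R).height ≤ q.height := by
  rw [Ideal.height_eq_height_add_of_liesOver_of_hasGoingDown (q.under R) q]
  exact le_self_add

lemma isCM_of {R : Type u} [CommRing R] [IsLocalRing R] (h : IsCMLocalRing R) {d : ℕ}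
    (hd : ringKrullDim R = (d : WithBot ℕ∞)) : IsCM R d := by
  refine ⟨hd, ?_⟩
  unfold IsCMLocalRing moduleDepth sequenceGrade at h
  rw [hd] at h
  have h' := WithBot.coe_injective h
  have hne : {n : ℕ∞ | ∃ rs : List R, (rs.length : ℕ∞) = n ∧ (∀ r ∈ rs, r ∈ maximalIdeal R) ∧
    RingTheory.Sequence.IsRegular R rs}.Nonempty :=
    ⟨0, [], by simp, by simp, RingTheory.Sequence.IsRegular.nil R R⟩
  have : Nonempty _ := hne.to_subtype
  have hm := ENat.sSup_mem_of_nonempty_of_lt_top (lt_of_eq_of_lt h' (ENat.natCast_lt_top d))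
  rw [h'] at hm
  obtain ⟨rs, h1, h2, h3⟩ := hm
  exact ⟨rs, by exact_mod_cast h1, h2, h3⟩

lemma isCM_ff {R S : Type u} [CommRing R] [IsLocalRing R] [CommRing S] [IsLocalRing S] [Algebra R S]
    [Module.FaithfullyFlat R S] [IsLocalHom (algebraMap R S)] {d : ℕ} (h : IsCM R d)
    (hS : ringKrullDim S = (d : WithBot ℕ∞)) : IsCM S d := by
  obtain ⟨-, rs, h1, h2, h3⟩ := h
  refine ⟨hS, rs.map (algebraMap R S), by simpa using h1, ?_,
    RingTheory.Sequence.IsRegular.of_faithfullyFlat h3⟩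
  intro r hr
  obtain ⟨x, hx, rfl⟩ := List.mem_map.1 hr
  have : (maximalIdeal R).map (algebraMap R S) ≤ maximalIdeal S :=
    ((local_hom_TFAE (algebraMap R S)).out 0 2).1 ‹_›
  exact this (Ideal.mem_map_of_mem _ (h2 x hx))

lemma reduce {R S : Type u} [CommRing R] [IsLocalRing R] [IsNoetherianRing R] [CommRing S]
    [IsLocalRing S] [IsNoetherianRing S] [Algebra R S] [Module.FaithfullyFlat R S]
    [IsLocalHom (algebraMap R S)] [Infinite (ResidueField S)]
    (hm : (maximalIdeal R).map (algebraMap R S) = maximalIdeal S)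
    (hGor : IsGorensteinLocalRing R) (d : ℕ) (hd : ringKrullDim R = (d : WithBot ℕ∞))
    (hdS : ringKrullDim S = (d : WithBot ℕ∞))
    (I : Ideal R) (g ℓ : ℕ) (hg : idealHeight R I = (g : WithBot ℕ∞)) (hg1 : 1 ≤ g)
    (hl : analyticSpread R ↥I = (ℓ : WithBot ℕ∞))
    (hG : GcondIdeal R I (ℓ + 1))
    (hext : ∀ j : ℕ, 1 ≤ j → j + g ≤ ℓ → j + g + 1 ≤ d →
      extVanish R ↥(I ^ j) R (g + j - 1)) :
    IsLinearType R ↥I := by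
  have cm := isCM_ff (S := S) (isCM_of hGor.1 hd) hdS
  have hItop : I ≠ ⊤ := by
    rintro rfl
    have : idealHeight R (⊤ : Ideal R) = ⊤ := by
      unfold idealHeight
      rw [sInf_eq_top]
      rintro _ ⟨p, hp, h, -⟩
      exact (hp.ne_top (top_le_iff.1 h)).elim
    rw [this] at hg
    exact ENat.natCast_ne_top g (WithBot.coe_injective hg).symm
  have htI : HtGe I g := by
    intro p hp hIp
    have : (g : WithBot ℕ∞) ≤ localDimAt R p hp := by
      rw [← hg]
      exact sInf_le ⟨p, hp, hIp, rfl⟩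
    rw [localDim_eq] at this
    exact_mod_cast this
  obtain ⟨m, f₀, hf⟩ := Submodule.fg_iff_exists_fin_generating_family.1
      (Module.Finite.fg_top (R := R) (M := ↥I))
  obtain ⟨F, _, _, Ψ, hF⟩ := exists_fib (S := S) hm hl hf
  have hle : ∀ q : Ideal S, I.map (algebraMap R S) ≤ q → I ≤ q.under R := fun q h =>
    Ideal.map_le_iff_le_comap.1 h
  suffices h : ∃ (a : ℕ → S) (n : ℕ), (∀ k, a k ∈ I.map (algebraMap R S)) ∧
      Concl n (I.map (algebraMap R S)) a by
    obtain ⟨a, n, ha, hc⟩ := h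
    exact descent I a n ha hc
  refine general_concl (d := d) (g := g) hF ?_ ?_ cm hg1 ?_ ?_ ?_
  · rw [Fintype.range_linearCombination]
    have : I = Ideal.span (Set.range fun l => (f₀ l : R)) := by
      have := congrArg (Submodule.map I.subtype) hf
      rw [Submodule.map_span, ← Set.range_comp, Submodule.map_top, Submodule.range_subtype] at this
      exact this.symm
    conv_rhs => rw [this, Ideal.map_span, ← Set.range_comp]
    rfl
  · rw [← hm]
    exact Ideal.map_mono (le_maximalIdeal hItop)
  · intro q hq h
    exact (htI _ inferInstance (hle q h)).trans (under_height q)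
  · intro t q hq h ht hqt
    have h1 : (q.under R).height ≤ t := (under_height q).trans hqt
    refine gen_map (gen_of_minGens (inferInstance : (q.under R).IsPrime) ?_)
    have h2 := hG (q.under R) inferInstance (hle q h)
    rw [localDim_eq] at h2
    have h3 := h2 (by
      have : (q.under R).height + 1 ≤ ((ℓ + 1 : ℕ) : ℕ∞) := by
        rw [Nat.cast_add, Nat.cast_one]
        gcongr
        exact h1.trans (by exact_mod_cast ht)
      exact_mod_cast this)
    have h4 := h3.trans (WithBot.coe_le_coe.2 h1)
    exact_mod_cast h4
  · intro j h1 h2 h3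
    have := hext j h1 h2 h3
    obtain ⟨k, hk⟩ : ∃ k, g + j - 1 = k + 1 := ⟨g + j - 2, by omega⟩
    rw [hk] at this ⊢
    rw [← Ideal.map_pow]
    exact ext_ideal_baseChange S (I ^ j) k (E_of_extVanish _ _ _ this)

section
variable (R : Type u) [CommRing R] [IsLocalRing R]

/-- the extension of the maximal ideal to the polynomial ring -/
def PX : Ideal (Polynomial R) := (maximalIdeal R).map Polynomial.C

instance : (PX R).IsPrime := Ideal.isPrime_map_C_of_isPrime

/-- the ring `R(X)` -/
abbrev RX : Type u := Localization.AtPrime (PX R)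

lemma RX_max : (maximalIdeal R).map (algebraMap R (RX R)) = maximalIdeal (RX R) := by
  rw [IsScalarTower.algebraMap_eq R (Polynomial R) (RX R), ← Ideal.map_map]
  exact Localization.AtPrime.map_eq_maximalIdeal

instance : IsLocalHom (algebraMap R (RX R)) :=
  ((local_hom_TFAE (algebraMap R (RX R))).out 0 2).2 (RX_max R).le

instance : Module.Flat R (RX R) := Module.Flat.trans R (Polynomial R) _

instance : Module.FaithfullyFlat R (RX R) := Module.FaithfullyFlat.of_flat_of_isLocalHom

instance : Infinite (ResidueField (RX R)) := by
  refine Infinite.of_injective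
    (fun n : ℕ => residue (RX R) (algebraMap (Polynomial R) (RX R) (Polynomial.X ^ n))) ?_
  intro i j hij
  by_contra hne
  have h1 : residue (RX R) (algebraMap (Polynomial R) (RX R) (Polynomial.X ^ i - Polynomial.X ^ j)) = 0 := by
    rw [map_sub, map_sub, sub_eq_zero]; exact hij
  rw [residue_eq_zero_iff] at h1
  have h2 : (Polynomial.X ^ i - Polynomial.X ^ j : Polynomial R) ∈ PX R :=
    (IsLocalization.AtPrime.to_map_mem_maximal_iff (RX R) (PX R) _).1 h1
  have h3 := Ideal.mem_map_C_iff.1 h2 i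
  rw [Polynomial.coeff_sub, Polynomial.coeff_X_pow_self, Polynomial.coeff_X_pow, if_neg hne,
    sub_zero] at h3
  exact (Ideal.ne_top_iff_one _).1 (maximalIdeal.isMaximal R).ne_top h3

lemma RX_dim [IsNoetherianRing R] : ringKrullDim (RX R) = ringKrullDim R := by
  rw [IsLocalization.AtPrime.ringKrullDim_eq_height (PX R) (RX R), PX, Polynomial.height_map_C,
    maximalIdeal_height_eq_ringKrullDim]
end
end LT

/-- Over a Gorenstein local ring of dimension `d`, an ideal `I` of height
`g ≥ 1` and analytic spread `ℓ` satisfying `G_{ℓ+1}` with `Ext^{g+j-1}(I^j, R) = 0` for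
`1 ≤ j ≤ min (ℓ - g) (d - g - 1)` is of linear type. -/
theorem statement_4 (R : Type u) [CommRing R] [IsLocalRing R] [IsNoetherianRing R]
    (hGor : IsGorensteinLocalRing R) (d : ℕ) (hd : ringKrullDim R = (d : WithBot ℕ∞))
    (I : Ideal R) (g ℓ : ℕ) (hg : idealHeight R I = (g : WithBot ℕ∞)) (hg1 : 1 ≤ g)
    (hl : analyticSpread R ↥I = (ℓ : WithBot ℕ∞))
    (hG : GcondIdeal R I (ℓ + 1))
    (hext : ∀ j : ℕ, 1 ≤ j → j + g ≤ ℓ → j + g + 1 ≤ d →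
      extVanish R ↥(I ^ j) R (g + j - 1)) :
    IsLinearType R ↥I := by
  exact LT.reduce (S := LT.RX R) (LT.RX_max R) hGor d hd ((LT.RX_dim R).trans hd) I g ℓ hg hg1 hl hG hext
end
end

section
/- Let R' be a Noetherian ring, and let C• be a complex C_j → C_{j−1} → ⋯ → C_1 → C_0 → M → 0 of finitely generated R'-modules (with M finitely generated), with homology modules H_0, …, H_j (of the augmented complex). Fix positive integers k and s with k ≤ s − 2 and j ≤ k. Assume: (i) Ext_{R'}^{j+1−i}(C_i, R') = 0 for 0 ≤ i ≤ j; (ii) grade(H_i) ≥ s for all 0 ≤ i ≤ j. Then Ext_{R'}^{j+1}(M, R') = 0. -/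
open scoped TensorProduct

noncomputable section

universe u

open CategoryTheory CategoryTheory.Limits in
/-- The derived-functor `Ext` of the statement vanishes in positive degree iff `Abelian.Ext` does. -/
theorem extVanish_succ_iff (R : Type u) [CommRing R] (M : ModuleCat.{u} R) (n : ℕ) :
    extVanish R (M : Type u) R (n + 1) ↔
      Subsingleton (Abelian.Ext.{u} M (ModuleCat.of R R) (n + 1)) := by
  let P : ProjectiveResolution M := projectiveResolution M
  let K := P.complex.linearYonedaObj R (ModuleCat.of R R)
  have h1 : extVanish R (M : Type u) R (n + 1) ↔ K.ExactAt (n + 1) := by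
    rw [HomologicalComplex.exactAt_iff_isZero_homology]
    have e : ((Ext R (ModuleCat.{u} R) (n + 1)).obj (Opposite.op M)).obj (ModuleCat.of R R) ≅
      K.homology (n + 1) := P.isoExt (n + 1) (ModuleCat.of R R)
    rw [← e.isZero_iff, ModuleCat.isZero_iff_subsingleton]
    rfl
  rw [h1, HomologicalComplex.exactAt_iff' K n (n + 1) (n + 2) (by simp) (by simp),
    ShortComplex.moduleCat_exact_iff]
  constructor
  · intro h
    refine subsingleton_of_forall_eq 0 fun α => ?_
    obtain ⟨f, hf, rfl⟩ := P.extMk_surjective α (n + 2) rfl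
    rw [P.extMk_eq_zero_iff f (n + 2) rfl hf n rfl]
    exact h f hf
  · intro h f hf
    exact (P.extMk_eq_zero_iff f (n + 2) rfl hf n rfl).1 (Subsingleton.elim _ _)

open CategoryTheory in
theorem ext_step_quot {R : Type u} [CommRing R] {S : ShortComplex (ModuleCat.{u} R)}
    (hS : S.ShortExact) (Y : ModuleCat.{u} R) (n : ℕ)
    (h1 : Subsingleton (Abelian.Ext.{u} S.X₁ Y n))
    (h2 : Subsingleton (Abelian.Ext.{u} S.X₂ Y (n + 1))) :
    Subsingleton (Abelian.Ext.{u} S.X₃ Y (n + 1)) := by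
  refine subsingleton_of_forall_eq 0 fun x => ?_
  obtain ⟨y, rfl⟩ := Abelian.Ext.contravariant_sequence_exact₃ hS Y x (Subsingleton.elim _ _)
    (n₀ := n) (by omega)
  rw [Subsingleton.elim y 0, Abelian.Ext.comp_zero]

open CategoryTheory in
theorem ext_step_mid {R : Type u} [CommRing R] {S : ShortComplex (ModuleCat.{u} R)}
    (hS : S.ShortExact) (Y : ModuleCat.{u} R) (n : ℕ)
    (h1 : Subsingleton (Abelian.Ext.{u} S.X₁ Y n))
    (h3 : Subsingleton (Abelian.Ext.{u} S.X₃ Y n)) :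
    Subsingleton (Abelian.Ext.{u} S.X₂ Y n) := by
  refine subsingleton_of_forall_eq 0 fun x => ?_
  obtain ⟨y, rfl⟩ := Abelian.Ext.contravariant_sequence_exact₂ hS Y x (Subsingleton.elim _ _)
  rw [Subsingleton.elim y 0, Abelian.Ext.comp_zero]

open CategoryTheory CategoryTheory.Limits in
theorem ext_zero_of_isZero {R : Type u} [CommRing R] {X : ModuleCat.{u} R} (hX : IsZero X)
    (Y : ModuleCat.{u} R) (n : ℕ) : Subsingleton (Abelian.Ext.{u} X Y n) := by
  refine subsingleton_of_forall_eq 0 fun x => ?_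
  rw [← Abelian.Ext.mk₀_id_comp x, hX.eq_of_src (𝟙 X) 0, Abelian.Ext.mk₀_zero,
    Abelian.Ext.zero_comp]

open CategoryTheory CategoryTheory.Limits in
theorem ext_zero_of_grade {R : Type u} [CommRing R] [IsNoetherianRing R] (H : ModuleCat.{u} R)
    [Module.Finite R H] (s n : ℕ) (hg : (s : ℕ∞) ≤ moduleGrade R (H : Type u)) (hn : n < s) :
    Subsingleton (Abelian.Ext.{u} H (ModuleCat.of R R) n) := by
  by_cases hI : Module.annihilator R H = ⊤
  · refine ext_zero_of_isZero ?_ _ _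
    rw [ModuleCat.isZero_iff_subsingleton]
    exact Module.annihilator_eq_top_iff.1 hI
  · have hlt : (n : ℕ∞) < moduleGrade R (H : Type u) :=
      lt_of_lt_of_le (by exact_mod_cast hn) hg
    obtain ⟨_, ⟨rs, rfl, hmem, hreg⟩, hlen⟩ := lt_sSup_iff.1 hlt
    refine ModuleCat.subsingleton_ext_of_exists_isRegular (Module.annihilator R H) H
      (by rw [Module.support_eq_zeroLocus]) (ModuleCat.of R R) ?_ rs hmem hreg n
      (by exact_mod_cast hlen)
    rw [lt_top_iff_ne_top]
    simpa using hI

open CategoryTheory CategoryTheory.Limits in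
/-- `0 → Z_i → D_i → Y → 0` when `d` factors as an epi to `Y` followed by a mono. -/
theorem shortExact_cycles {R : Type u} [CommRing R] (D : ChainComplex (ModuleCat.{u} R) ℕ)
    (i : ℕ) {Y : ModuleCat.{u} R} (p : D.X (i + 1) ⟶ Y) (m : Y ⟶ D.X i) [Epi p] [Mono m]
    (hpm : p ≫ m = D.d (i + 1) i) :
    ∃ w : D.iCycles (i + 1) ≫ p = 0, (ShortComplex.mk (D.iCycles (i + 1)) p w).ShortExact := by
  have w : D.iCycles (i + 1) ≫ p = 0 := by
    rw [← cancel_mono m, Category.assoc, hpm, HomologicalComplex.iCycles_d, zero_comp]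
  refine ⟨w, ?_⟩
  let T := ShortComplex.mk (D.iCycles (i + 1)) (D.d (i + 1) i) (by simp)
  let S := ShortComplex.mk (D.iCycles (i + 1)) p w
  have hT : T.Exact := T.exact_of_f_is_kernel (D.cyclesIsKernel (i + 1) i (by simp))
  let φ : S ⟶ T := { τ₁ := 𝟙 _, τ₂ := 𝟙 _, τ₃ := m, comm₂₃ := by simp [S, T, hpm] }
  haveI : Epi φ.τ₁ := inferInstanceAs (Epi (𝟙 _))
  haveI : IsIso φ.τ₂ := inferInstanceAs (IsIso (𝟙 _))
  haveI : Mono φ.τ₃ := inferInstanceAs (Mono m)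
  have hS : S.Exact := (ShortComplex.exact_iff_of_epi_of_isIso_of_mono φ).2 hT
  exact { exact := hS, mono_f := inferInstanceAs (Mono (D.iCycles (i + 1))), epi_g := ‹Epi p› }

open CategoryTheory CategoryTheory.Limits in
/-- `0 → B_i → Z_i → H_i → 0`. -/
theorem shortExact_boundaries {R : Type u} [CommRing R] (D : ChainComplex (ModuleCat.{u} R) ℕ)
    (i : ℕ) :
    ∃ w : image.ι (D.toCycles (i + 1) i) ≫ D.homologyπ i = 0,
      (ShortComplex.mk (image.ι (D.toCycles (i + 1) i)) (D.homologyπ i) w).ShortExact := by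
  have w : image.ι (D.toCycles (i + 1) i) ≫ D.homologyπ i = 0 := by
    rw [← cancel_epi (factorThruImage (D.toCycles (i + 1) i)), image.fac_assoc]
    simp
  refine ⟨w, ?_⟩
  let T := ShortComplex.mk (D.toCycles (i + 1) i) (D.homologyπ i) (by simp)
  let S := ShortComplex.mk (image.ι (D.toCycles (i + 1) i)) (D.homologyπ i) w
  have hT : T.Exact := T.exact_of_g_is_cokernel (D.homologyIsCokernel (i + 1) i (by simp))
  let φ : T ⟶ S := { τ₁ := factorThruImage _, τ₂ := 𝟙 _, τ₃ := 𝟙 _ }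
  haveI : Epi φ.τ₁ := inferInstanceAs (Epi (factorThruImage _))
  haveI : IsIso φ.τ₂ := inferInstanceAs (IsIso (𝟙 _))
  haveI : Mono φ.τ₃ := inferInstanceAs (Mono (𝟙 _))
  have hS : S.Exact := (ShortComplex.exact_iff_of_epi_of_isIso_of_mono φ).1 hT
  exact { exact := hS, mono_f := inferInstanceAs (Mono (image.ι _)),
          epi_g := inferInstanceAs (Epi (D.homologyπ i)) }

open CategoryTheory CategoryTheory.Limits in
theorem finite_homology {R : Type u} [CommRing R] [IsNoetherianRing R]
    (D : ChainComplex (ModuleCat.{u} R) ℕ) (i : ℕ) [Module.Finite R (D.X i)] :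
    Module.Finite R (D.homology i) := by
  haveI : Module.Finite R (D.cycles i) :=
    Module.Finite.of_injective (D.iCycles i).hom
      ((ModuleCat.mono_iff_injective (D.iCycles i)).1 inferInstance)
  exact Module.Finite.of_surjective (D.homologyπ i).hom
    ((ModuleCat.epi_iff_surjective (D.homologyπ i)).1 inferInstance)

open CategoryTheory in
/-- (Lemma ExtPasses, homological core.) Given an augmented complex
`C_j → ⋯ → C_0 → M → 0` (encoded as a chain complex `D` with `D.X 0 = M` and
`D.X (i+1) = C_i`, exact at `0`, i.e. `H_{-1} = 0`) of finite modules over a Noetherian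
ring, if `Ext^{j+1-i}(C_i, R') = 0` for `0 ≤ i ≤ j` and all homologies `H_0, …, H_j`
have grade at least `s`, where `j ≤ k ≤ s - 2`, then `Ext^{j+1}(M, R') = 0`. -/
theorem statement_5 (R : Type u) [CommRing R] [IsNoetherianRing R]
    (D : ChainComplex (ModuleCat.{u} R) ℕ)
    (hfin : ∀ i, Module.Finite R (D.X i))
    (j k s : ℕ) (hk : 0 < k) (hs : 0 < s) (hks : k + 2 ≤ s) (hjk : j ≤ k)
    (hbd : ∀ i, j + 1 < i → Subsingleton (D.X i))
    (hsurj : D.ExactAt 0)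
    (hext : ∀ i, i ≤ j → extVanish R (D.X (i + 1) : Type u) R (j + 1 - i))
    (hgrade : ∀ i, i ≤ j → (s : ℕ∞) ≤ moduleGrade R (D.homology (i + 1) : Type u)) :
    extVanish R (D.X 0 : Type u) R (j + 1) := by
  have hD : ∀ i, i ≤ j → Subsingleton (Abelian.Ext.{u} (D.X (i + 1)) (ModuleCat.of R R)
      (j - i + 1)) := by
    intro i hi
    have h := hext i hi
    rw [show j + 1 - i = j - i + 1 by omega] at h
    exact (extVanish_succ_iff R (D.X (i + 1)) (j - i)).1 h
  have hH : ∀ i n, i ≤ j → n ≤ j → Subsingleton (Abelian.Ext.{u} (D.homology (i + 1))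
      (ModuleCat.of R R) n) := by
    intro i n hi hn
    haveI := hfin (i + 1)
    haveI := finite_homology D (i + 1)
    exact ext_zero_of_grade (D.homology (i + 1)) s n (hgrade i hi) (by omega)
  -- cycles: from boundaries
  have hZ : ∀ i n, i ≤ j → n ≤ j →
      Subsingleton (Abelian.Ext.{u} (Limits.image (D.toCycles (i + 2) (i + 1)))
        (ModuleCat.of R R) n) →
      Subsingleton (Abelian.Ext.{u} (D.cycles (i + 1)) (ModuleCat.of R R) n) := by
    intro i n hi hn hB
    obtain ⟨w, hw⟩ := shortExact_boundaries D (i + 1)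
    exact ext_step_mid hw _ n hB (hH i n hi hn)
  have hB : ∀ n i, n + i = j →
      Subsingleton (Abelian.Ext.{u} (Limits.image (D.toCycles (i + 2) (i + 1)))
        (ModuleCat.of R R) n) := by
    intro n
    induction n with
    | zero =>
      intro i hi
      refine ext_zero_of_isZero ?_ _ _
      haveI := hbd (i + 2) (by omega)
      have hz : Limits.IsZero (D.X (i + 2)) := ModuleCat.isZero_of_subsingleton _
      exact Limits.IsZero.of_epi (Limits.factorThruImage (D.toCycles (i + 2) (i + 1))) hz
    | succ n ih =>
      intro i hi
      have hc := hZ (i + 1) n (by omega) (by omega) (ih (i + 1) (by omega))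
      obtain ⟨w, hw⟩ := shortExact_cycles D (i + 1)
        (Limits.factorThruImage (D.toCycles (i + 2) (i + 1)))
        (Limits.image.ι (D.toCycles (i + 2) (i + 1)) ≫ D.iCycles (i + 1))
        (by rw [Limits.image.fac_assoc]; simp)
      have hd := hD (i + 1) (by omega)
      rw [show j - (i + 1) = n by omega] at hd
      exact ext_step_quot hw _ n hc hd
  rw [extVanish_succ_iff R (D.X 0) j]
  haveI : Epi (D.d 1 0) := by
    rw [HomologicalComplex.exactAt_iff' D 1 0 0 (by simp) (by simp)] at hsurj
    exact hsurj.epi_f (D.shape 0 0 (by simp))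
  obtain ⟨w, hw⟩ := shortExact_cycles D 0 (D.d 1 0) (𝟙 _) (by simp)
  exact ext_step_quot hw _ j (hZ 0 j (by omega) le_rfl (hB j 0 rfl)) (hD 0 (by omega))
end
end
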